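/- At the wetting critical point the contact fraction stays bounded away from zero: liminf_{N→∞} (1/N) E^w_{ε_c^w,N}[ℓ_N] > 0, where the expectation is with respect to the wetting measure P^w_{ε_c^w,N}; hence the wetting phase transition is of first order. -/

import Mathlib

open MeasureTheory Filter Topology Set
open scoped ENNReal NNReal BigOperators

noncomputable section

/-- The field `(φ_1, …, φ_{N-1})` extended to `ℤ` with zero boundary conditions
`φ_{-1} = φ_0 = φ_N = φ_{N+1} = 0`. -/
def fieldExt (N : ℕ) (φ : Fin (N - 1) → ℝ) (i : ℤ) : ℝ :=
  if h : 0 < i ∧ i < (N : ℤ) then φ ⟨i.toNat - 1, by omega⟩ else 0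

/-- `exp(−H_{[−1,N+1]}(φ))` with zero boundary conditions, where `E = exp(−V)` and
`H_{[a,b]}(φ) = ∑_{n=a+1}^{b-1} V(φ_{n+1} + φ_{n-1} - 2 φ_n)`. -/
def hamWeight (E : ℝ → ℝ) (N : ℕ) (φ : Fin (N - 1) → ℝ) : ℝ :=
  ∏ n ∈ Finset.Icc (0 : ℤ) (N : ℤ),
    E (fieldExt N φ (n + 1) + fieldExt N φ (n - 1) - 2 * fieldExt N φ n)

/-- the single-site reference measure `ε δ_0(dx) + dx` of the pinning model -/
def pinFactor (ε : ℝ) : Measure ℝ :=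
  ENNReal.ofReal ε • Measure.dirac 0 + volume

/-- the single-site reference measure `ε δ_0(dx) + dx 1_{(x ≥ 0)}` of the wetting model -/
def wetFactor (ε : ℝ) : Measure ℝ :=
  ENNReal.ofReal ε • Measure.dirac 0 + volume.restrict (Ici 0)

/-- the pinning partition function `Z^p_{ε,N}` -/
def Zpin (E : ℝ → ℝ) (ε : ℝ) (N : ℕ) : ℝ :=
  ∫ φ : Fin (N - 1) → ℝ, hamWeight E N φ ∂(Measure.pi fun _ => pinFactor ε)

/-- the wetting partition function `Z^w_{ε,N}` -/
def Zwet (E : ℝ → ℝ) (ε : ℝ) (N : ℕ) : ℝ :=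
  ∫ φ : Fin (N - 1) → ℝ, hamWeight E N φ ∂(Measure.pi fun _ => wetFactor ε)

/-- the pinning model `P^p_{ε,N}` -/
def Ppin (E : ℝ → ℝ) (ε : ℝ) (N : ℕ) : Measure (Fin (N - 1) → ℝ) :=
  (Measure.pi fun _ => pinFactor ε).withDensity
    fun φ => ENNReal.ofReal (hamWeight E N φ / Zpin E ε N)

/-- the wetting model `P^w_{ε,N}` -/
def Pwet (E : ℝ → ℝ) (ε : ℝ) (N : ℕ) : Measure (Fin (N - 1) → ℝ) :=
  (Measure.pi fun _ => wetFactor ε).withDensity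
    fun φ => ENNReal.ofReal (hamWeight E N φ / Zwet E ε N)

open scoped Classical in
/-- the contact number `ℓ_N(φ) = #{i ∈ {1,…,N} : φ_i = 0}` (with the convention `φ_N := 0`) -/
def contact (N : ℕ) (φ : Fin (N - 1) → ℝ) : ℕ :=
  ((Finset.Icc (1 : ℤ) (N : ℤ)).filter fun i => fieldExt N φ i = 0).card

/-- A gaussian weight in Fourier space can be integrated before the measure. -/
lemma integral_gaussian_mul_integral {α : Type*} [MeasurableSpace α] (ν : Measure α)
    [IsFiniteMeasure ν] {t : ℝ} (ht : 0 < t) {q : α → ℝ} (hq : Measurable q) {h : α → ℂ}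
    (hh : Measurable h) {B : ℝ} (hB : ∀ a, ‖h a‖ ≤ B) :
    ∫ ζ : ℝ, (Real.exp (-t * ζ ^ 2) : ℂ) * ∫ a, h a * Complex.exp ((ζ * q a : ℝ) * Complex.I) ∂ν
      = ∫ a, h a * ((Real.sqrt (Real.pi / t) * Real.exp (-(q a) ^ 2 / (4 * t)) : ℝ) : ℂ) ∂ν := by
  simp_rw [← integral_const_mul]
  rw [integral_integral_swap]
  · refine integral_congr_ae (.of_forall fun a => ?_)
    have key := fourierIntegral_gaussian (b := (t : ℂ)) (by simpa using ht) (q a : ℂ)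
    have hs : ((Real.pi : ℂ) / (t : ℂ)) ^ (1 / 2 : ℂ) = (Real.sqrt (Real.pi / t) : ℂ) := by
      rw [Real.sqrt_eq_rpow, Complex.ofReal_cpow (by positivity)]
      push_cast
      rfl
    rw [hs] at key
    calc ∫ ζ : ℝ, (Real.exp (-t * ζ ^ 2) : ℂ) * (h a * Complex.exp ((ζ * q a : ℝ) * Complex.I))
        = h a * ∫ ζ : ℝ, Complex.exp (Complex.I * (q a : ℂ) * ζ)
            * Complex.exp (-(t : ℂ) * ζ ^ 2) := by
          rw [← integral_const_mul]
          refine integral_congr_ae (.of_forall fun ζ => ?_)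
          push_cast
          ring_nf
      _ = _ := by
          rw [key]
          push_cast
          ring_nf
  · have hg : Integrable (fun ζ : ℝ => Real.exp (-t * ζ ^ 2)) := integrable_exp_neg_mul_sq ht
    have h2 : Integrable (fun p : ℝ × α => Real.exp (-t * p.1 ^ 2) * B) (volume.prod ν) :=
      hg.mul_prod (integrable_const B)
    refine h2.mono' ?_ (.of_forall fun p => ?_)
    · refine Measurable.aestronglyMeasurable ?_
      simp only [Function.uncurry_def]
      fun_prop
    · simp only [Function.uncurry]
      rw [norm_mul, norm_mul, Complex.norm_exp_ofReal_mul_I, mul_one, Complex.norm_real,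
        Real.norm_of_nonneg (Real.exp_pos _).le]
      gcongr
      exact hB _

/-- The mass of a small square is controlled by the `L¹` norm of the characteristic function. -/
lemma measure_closedBall_le_lintegral_char (ν : Measure (ℝ × ℝ)) [IsFiniteMeasure ν] (p : ℝ × ℝ)
    {δ : ℝ} (hδ : 0 < δ) :
    ν (Metric.closedBall p δ) ≤ (∫⁻ ξ : ℝ, ∫⁻ ζ : ℝ,
      ‖∫ a, Complex.exp ((ξ * a.1 + ζ * a.2 : ℝ) * Complex.I) ∂ν‖ₑ)
        * volume (Metric.closedBall p δ) := by
  set J := ∫⁻ ξ : ℝ, ∫⁻ ζ : ℝ, ‖∫ a, Complex.exp ((ξ * a.1 + ζ * a.2 : ℝ) * Complex.I) ∂ν‖ₑ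
  have ht : 0 < δ ^ 2 := by positivity
  set G : ℝ → ℝ := fun x => Real.sqrt (Real.pi / δ ^ 2) * Real.exp (-x ^ 2 / (4 * δ ^ 2)) with hG
  have hGm : Measurable G := by fun_prop
  have hG0 : ∀ x, 0 ≤ G x := fun x => by positivity
  have hG1 : ∀ x, G x ≤ Real.sqrt (Real.pi / δ ^ 2) := fun x => by
    have : Real.exp (-x ^ 2 / (4 * δ ^ 2)) ≤ 1 := Real.exp_le_one_iff.2 (by
      rw [neg_div]; have : 0 ≤ x ^ 2 / (4 * δ ^ 2) := by positivity
      linarith)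
    exact mul_le_of_le_one_right (Real.sqrt_nonneg _) this
  have hg1 : ∀ x : ℝ, ‖(Real.exp (-δ ^ 2 * x ^ 2) : ℂ)‖ₑ ≤ 1 := fun x => by
    rw [← ofReal_norm, Complex.norm_real, Real.norm_of_nonneg (Real.exp_pos _).le,
      ENNReal.ofReal_le_one]
    exact Real.exp_le_one_iff.2 (by nlinarith [sq_nonneg (δ * x)])
  have key : ∫ ξ : ℝ, (Real.exp (-δ ^ 2 * ξ ^ 2) : ℂ) * ∫ ζ : ℝ, (Real.exp (-δ ^ 2 * ζ ^ 2) : ℂ) *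
      ∫ a, Complex.exp ((ξ * (a.1 - p.1) : ℝ) * Complex.I)
        * Complex.exp ((ζ * (a.2 - p.2) : ℝ) * Complex.I) ∂ν
      = ((∫ a, G (a.1 - p.1) * G (a.2 - p.2) ∂ν : ℝ) : ℂ) := by
    have h1 : ∀ ξ : ℝ, ∫ ζ : ℝ, (Real.exp (-δ ^ 2 * ζ ^ 2) : ℂ) *
      ∫ a, Complex.exp ((ξ * (a.1 - p.1) : ℝ) * Complex.I)
        * Complex.exp ((ζ * (a.2 - p.2) : ℝ) * Complex.I) ∂ν
        = ∫ a, (G (a.2 - p.2) : ℂ) * Complex.exp ((ξ * (a.1 - p.1) : ℝ) * Complex.I) ∂ν := by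
      intro ξ
      rw [integral_gaussian_mul_integral ν ht (q := fun a : ℝ × ℝ => a.2 - p.2) (by fun_prop)
        (by fun_prop) (B := 1) (fun a => (Complex.norm_exp_ofReal_mul_I _).le)]
      simp_rw [mul_comm (Complex.exp _)]
      rfl
    simp_rw [h1]
    rw [integral_gaussian_mul_integral ν ht (q := fun a : ℝ × ℝ => a.1 - p.1) (by fun_prop)
        (by fun_prop) (B := Real.sqrt (Real.pi / δ ^ 2)) (fun a => by
          rw [Complex.norm_real, Real.norm_of_nonneg (hG0 _)]; exact hG1 _)]
    rw [← integral_complex_ofReal]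
    refine integral_congr_ae (.of_forall fun a => ?_)
    simp only [hG]
    push_cast
    ring
  have hup : ENNReal.ofReal (∫ a, G (a.1 - p.1) * G (a.2 - p.2) ∂ν) ≤ J := by
    rw [← Real.enorm_of_nonneg (integral_nonneg fun a => mul_nonneg (hG0 _) (hG0 _))]
    rw [show ‖∫ a, G (a.1 - p.1) * G (a.2 - p.2) ∂ν‖ₑ
      = ‖((∫ a, G (a.1 - p.1) * G (a.2 - p.2) ∂ν : ℝ) : ℂ)‖ₑ from
        by rw [← ofReal_norm, ← ofReal_norm, Complex.norm_real], ← key]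
    refine (enorm_integral_le_lintegral_enorm _).trans (lintegral_mono fun ξ => ?_)
    rw [enorm_mul]
    refine (mul_le_of_le_one_left' (hg1 ξ)).trans
      ((enorm_integral_le_lintegral_enorm _).trans (lintegral_mono fun ζ => ?_))
    rw [enorm_mul]
    refine (mul_le_of_le_one_left' (hg1 ζ)).trans (le_of_eq ?_)
    have : ∀ a : ℝ × ℝ, Complex.exp ((ξ * (a.1 - p.1) : ℝ) * Complex.I)
        * Complex.exp ((ζ * (a.2 - p.2) : ℝ) * Complex.I)
        = Complex.exp ((-(ξ * p.1 + ζ * p.2) : ℝ) * Complex.I)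
          * Complex.exp ((ξ * a.1 + ζ * a.2 : ℝ) * Complex.I) := fun a => by
      rw [← Complex.exp_add, ← Complex.exp_add]
      push_cast
      ring_nf
    simp_rw [this, integral_const_mul, enorm_mul]
    rw [← ofReal_norm (Complex.exp _), Complex.norm_exp_ofReal_mul_I]
    simp
  have hlow : ENNReal.ofReal (1 / (4 * δ ^ 2)) * ν (Metric.closedBall p δ)
      ≤ ENNReal.ofReal (∫ a, G (a.1 - p.1) * G (a.2 - p.2) ∂ν) := by
    rw [ofReal_integral_eq_lintegral_ofReal]
    · rw [← setLIntegral_const]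
      refine (setLIntegral_mono' Metric.isClosed_closedBall.measurableSet fun a ha => ?_).trans
        (setLIntegral_le_lintegral _ _)
      refine ENNReal.ofReal_le_ofReal ?_
      have hGl : ∀ x : ℝ, |x| ≤ δ → 1 / (2 * δ) ≤ G x := by
        intro x hx
        have h1 : -x ^ 2 / (4 * δ ^ 2) ≥ -(1 / 4) := by
          rw [ge_iff_le, le_div_iff₀ (by positivity)]
          have : x ^ 2 ≤ δ ^ 2 := by rw [← sq_abs]; gcongr
          nlinarith
        have h2 : 3 / 4 ≤ Real.exp (-x ^ 2 / (4 * δ ^ 2)) := by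
          have := Real.add_one_le_exp (-x ^ 2 / (4 * δ ^ 2))
          linarith
        have h3 : 1 / δ ≤ Real.sqrt (Real.pi / δ ^ 2) := by
          apply Real.le_sqrt_of_sq_le
          rw [div_pow, one_pow]
          gcongr
          linarith [Real.pi_gt_three]
        calc 1 / (2 * δ) ≤ 1 / δ * (3 / 4) := by
              rw [div_mul_div_comm, div_le_div_iff₀ (by positivity) (by positivity)]; nlinarith
          _ ≤ _ := by simp only [hG]; gcongr
      rw [Metric.mem_closedBall, Prod.dist_eq, max_le_iff, Real.dist_eq, Real.dist_eq] at ha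
      calc 1 / (4 * δ ^ 2) = 1 / (2 * δ) * (1 / (2 * δ)) := by field_simp; norm_num
        _ ≤ _ := mul_le_mul (hGl _ ha.1) (hGl _ ha.2) (by positivity) (hG0 _)
    · refine Integrable.of_bound (by fun_prop)
        (Real.sqrt (Real.pi / δ ^ 2) * Real.sqrt (Real.pi / δ ^ 2)) (.of_forall fun a => ?_)
      rw [Real.norm_of_nonneg (mul_nonneg (hG0 _) (hG0 _))]
      exact mul_le_mul (hG1 _) (hG1 _) (hG0 _) (Real.sqrt_nonneg _)
    · exact .of_forall fun a => mul_nonneg (hG0 _) (hG0 _)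
  have hvol : volume (Metric.closedBall p δ) = ENNReal.ofReal (4 * δ ^ 2) := by
    rw [← closedBall_prod_same, Measure.volume_eq_prod, Measure.prod_prod, Real.volume_closedBall,
      Real.volume_closedBall, ← ENNReal.ofReal_mul (by positivity)]
    ring_nf
  have h1 : ENNReal.ofReal (4 * δ ^ 2) * ENNReal.ofReal (1 / (4 * δ ^ 2)) = 1 := by
    rw [← ENNReal.ofReal_mul (by positivity), mul_one_div_cancel (by positivity)]
    simp
  calc ν (Metric.closedBall p δ)
      = ENNReal.ofReal (4 * δ ^ 2)
          * (ENNReal.ofReal (1 / (4 * δ ^ 2)) * ν (Metric.closedBall p δ)) := by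
        rw [← mul_assoc, h1, one_mul]
    _ ≤ ENNReal.ofReal (4 * δ ^ 2) * J := by gcongr; exact hlow.trans hup
    _ = _ := by rw [hvol, mul_comm]

/-- A finite measure on the plane with integrable characteristic function is dominated by a
multiple of Lebesgue measure. -/
lemma measure_le_lintegral_char_smul_volume (ν : Measure (ℝ × ℝ)) [IsFiniteMeasure ν] {C : ℝ≥0}
    (hC : (∫⁻ ξ : ℝ, ∫⁻ ζ : ℝ,
      ‖∫ a, Complex.exp ((ξ * a.1 + ζ * a.2 : ℝ) * Complex.I) ∂ν‖ₑ) ≤ C) :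
    ν ≤ C • volume := by
  refine Measure.le_intro fun s _ _ => ?_
  refine (Besicovitch.vitaliFamily ν).measure_le_of_frequently_le (C • volume)
    Measure.AbsolutelyContinuous.rfl s fun x _ => ?_
  refine Filter.Eventually.frequently ?_
  rw [VitaliFamily.eventually_filterAt_iff]
  refine ⟨1, one_pos, fun a ha _ => ?_⟩
  obtain ⟨r, hr, rfl⟩ := ha
  refine (measure_closedBall_le_lintegral_char ν x hr).trans ?_
  rw [Measure.smul_apply, ENNReal.smul_def, smul_eq_mul]
  gcongr

/-- A bounded continuous centred probability density with finite variance, positive at `0`. -/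
structure IsStepDensity (E : ℝ → ℝ) (σ M : ℝ) : Prop where
  nonneg : ∀ x, 0 ≤ E x
  cont : Continuous E
  le_bound : ∀ x, E x ≤ M
  pos_zero : 0 < E 0
  integrable : Integrable E
  mass : ∫ x, E x = 1
  mom1 : Integrable fun x => x * E x
  mean : ∫ x, x * E x = 0
  mom2 : Integrable fun x => x ^ 2 * E x
  var : ∫ x, x ^ 2 * E x = σ ^ 2
  sigma_pos : 0 < σ

/-- The step density with values in `ℝ≥0∞`. -/
def eDens (E : ℝ → ℝ) (x : ℝ) : ℝ≥0∞ := ENNReal.ofReal (E x)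

/-- The law of a single step. -/
def stepLaw (E : ℝ → ℝ) : Measure ℝ := volume.withDensity (eDens E)

namespace IsStepDensity

variable {E : ℝ → ℝ} {σ M : ℝ}

lemma bound_pos (h : IsStepDensity E σ M) : 0 < M := h.pos_zero.trans_le (h.le_bound 0)

lemma measurable_eDens (h : IsStepDensity E σ M) : Measurable (eDens E) :=
  h.cont.measurable.ennreal_ofReal

lemma eDens_le (h : IsStepDensity E σ M) (x : ℝ) : eDens E x ≤ ENNReal.ofReal M :=
  ENNReal.ofReal_le_ofReal (h.le_bound x)

lemma lintegral_eDens (h : IsStepDensity E σ M) : ∫⁻ x, eDens E x = 1 := by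
  simp_rw [eDens]
  rw [← ofReal_integral_eq_lintegral_ofReal h.integrable (.of_forall h.nonneg), h.mass]
  simp

lemma isProbabilityMeasure (h : IsStepDensity E σ M) : IsProbabilityMeasure (stepLaw E) :=
  ⟨by rw [stepLaw, withDensity_apply _ MeasurableSet.univ, Measure.restrict_univ,
    h.lintegral_eDens]⟩

lemma integral_stepLaw (h : IsStepDensity E σ M) {F : Type*} [NormedAddCommGroup F]
    [NormedSpace ℝ F] (f : ℝ → F) : ∫ x, f x ∂(stepLaw E) = ∫ x, E x • f x := by
  rw [stepLaw, integral_withDensity_eq_integral_toReal_smul h.measurable_eDens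
    (.of_forall fun x => ENNReal.ofReal_lt_top)]
  simp [eDens, ENNReal.toReal_ofReal (h.nonneg _)]

lemma lintegral_stepLaw (h : IsStepDensity E σ M) {f : ℝ → ℝ≥0∞} (hf : Measurable f) :
    ∫⁻ x, f x ∂(stepLaw E) = ∫⁻ x, eDens E x * f x := by
  rw [stepLaw, lintegral_withDensity_eq_lintegral_mul _ h.measurable_eDens hf]
  rfl

/-- The density is bounded below near the origin. -/
lemma exists_lower (h : IsStepDensity E σ M) :
    ∃ r e : ℝ, 0 < r ∧ r ≤ 1 ∧ 0 < e ∧ ∀ x, |x| ≤ r → e ≤ E x := by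
  have h1 : ∀ᶠ x in 𝓝 (0 : ℝ), E 0 / 2 < E x :=
    h.cont.continuousAt.eventually_const_lt (by linarith [h.pos_zero])
  obtain ⟨r, hr, hr'⟩ := Metric.eventually_nhds_iff.1 h1
  refine ⟨min (r / 2) 1, E 0 / 2, by positivity, min_le_right _ _, by linarith [h.pos_zero],
    fun x hx => (hr' ?_).le⟩
  rw [Real.dist_eq, sub_zero]
  linarith [min_le_left (r / 2) 1]

end IsStepDensity

lemma abs_sin_le_abs_mul (t : ℝ) : |Real.sin t| ≤ |t| * (1 - min 1 (t ^ 2) / 20) := by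
  have hpi : Real.pi ^ 2 ≤ 10 := by nlinarith [Real.pi_lt_d2, Real.pi_gt_three]
  rcases le_total |t| 2 with h | h
  · have h1 : Real.sin t = 2 * Real.sin (t / 2) * Real.cos (t / 2) := by
      rw [← Real.sin_two_mul]; ring_nf
    have h2 : |t / 2| ≤ 1 := by rw [abs_div, abs_two]; linarith
    have h3 : 0 ≤ Real.cos (t / 2) := Real.cos_nonneg_of_neg_pi_div_two_le_of_le
      (by linarith [(abs_le.1 h2).1, Real.pi_gt_three])
      (by linarith [(abs_le.1 h2).2, Real.pi_gt_three])
    have h5 : Real.cos (t / 2) ≤ 1 - 2 / Real.pi ^ 2 * (t / 2) ^ 2 :=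
      Real.cos_le_one_sub_mul_cos_sq (by linarith [Real.pi_gt_three])
    have h6 : Real.cos (t / 2) ≤ 1 - t ^ 2 / 20 := by
      refine h5.trans ?_
      have : 1 / 5 ≤ 2 / Real.pi ^ 2 := by
        rw [div_le_div_iff₀ (by norm_num) (by positivity)]; linarith
      nlinarith [sq_nonneg t]
    rw [h1, abs_mul, abs_mul, abs_two, abs_of_nonneg h3]
    have h7 : |Real.sin (t / 2)| ≤ |t| / 2 := by
      have := Real.abs_sin_le_abs (x := t / 2)
      rwa [abs_div, abs_two] at this
    have h8 : Real.cos (t / 2) ≤ 1 - min 1 (t ^ 2) / 20 := by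
      linarith [min_le_right 1 (t ^ 2)]
    calc 2 * |Real.sin (t / 2)| * Real.cos (t / 2) ≤ 2 * (|t| / 2) * (1 - min 1 (t ^ 2) / 20) := by
          gcongr
      _ = _ := by ring
  · have h1 := Real.abs_sin_le_one t
    have h2 := min_le_left 1 (t ^ 2)
    nlinarith

namespace IsStepDensity

variable {E : ℝ → ℝ} {σ M : ℝ}

lemma charFun_stepLaw (h : IsStepDensity E σ M) (t : ℝ) :
    charFun (stepLaw E) t = ∫ x, (E x : ℂ) * Complex.exp (t * x * Complex.I) := by
  rw [charFun_apply_real, h.integral_stepLaw]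
  simp [Complex.real_smul]

lemma norm_charFun_le_exp (h : IsStepDensity E σ M) :
    ∃ c : ℝ, 0 < c ∧ ∀ t, ‖charFun (stepLaw E) t‖ ≤ Real.exp (-c * min 1 (t ^ 2)) := by
  obtain ⟨r, e, hr, hr1, he, hE⟩ := h.exists_lower
  refine ⟨2 * r * e * (r ^ 2 / 20), by positivity, fun t => ?_⟩
  have hexp : ∀ x : ℝ, ‖Complex.exp (t * x * Complex.I)‖ = 1 := fun x => by
    rw [← Complex.ofReal_mul]; exact Complex.norm_exp_ofReal_mul_I _
  have hm : Measurable fun x : ℝ => Complex.exp (t * x * Complex.I) := by fun_prop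
  set D : ℝ → ℝ := (Icc (-r) r).indicator fun _ => e with hD
  have hDint : Integrable D := (integrable_indicator_iff measurableSet_Icc).2
    (integrableOn_const (by simp))
  have hDE : ∀ x, D x ≤ E x := fun x => by
    by_cases hx : x ∈ Icc (-r) r
    · rw [hD, indicator_of_mem hx]; exact hE x (abs_le.2 hx)
    · rw [hD, indicator_of_notMem hx]; exact h.nonneg x
  have hDI : ∫ x, D x = 2 * r * e := by
    rw [hD, integral_indicator measurableSet_Icc, setIntegral_const, measureReal_def,
      Real.volume_Icc, ENNReal.toReal_ofReal (by linarith), smul_eq_mul]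
    ring
  have hi1 : Integrable fun x : ℝ => ((E x - D x : ℝ) : ℂ) * Complex.exp (t * x * Complex.I) := by
    refine (h.integrable.sub hDint).norm.mono' ?_ (.of_forall fun x => ?_)
    · exact ((h.integrable.sub hDint).ofReal (𝕜 := ℂ)).aestronglyMeasurable.mul
        hm.aestronglyMeasurable
    · rw [norm_mul, hexp, mul_one, Complex.norm_real]
      rfl
  have hi2 : Integrable fun x : ℝ => (D x : ℂ) * Complex.exp (t * x * Complex.I) := by
    refine hDint.norm.mono' ?_ (.of_forall fun x => ?_)
    · exact (hDint.ofReal (𝕜 := ℂ)).aestronglyMeasurable.mul hm.aestronglyMeasurable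
    · rw [norm_mul, hexp, mul_one, Complex.norm_real]
  have hsplit : charFun (stepLaw E) t
      = (∫ x, ((E x - D x : ℝ) : ℂ) * Complex.exp (t * x * Complex.I))
        + ∫ x, (D x : ℂ) * Complex.exp (t * x * Complex.I) := by
    rw [h.charFun_stepLaw, ← integral_add hi1 hi2]
    refine integral_congr_ae (.of_forall fun x => ?_)
    push_cast
    ring
  have hb1 : ‖∫ x, ((E x - D x : ℝ) : ℂ) * Complex.exp (t * x * Complex.I)‖ ≤ 1 - 2 * r * e := by
    refine (norm_integral_le_integral_norm _).trans (le_of_eq ?_)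
    rw [← h.mass, ← hDI, ← integral_sub h.integrable hDint]
    refine integral_congr_ae (.of_forall fun x => ?_)
    simp only
    rw [norm_mul, hexp, mul_one, Complex.norm_real,
      Real.norm_of_nonneg (sub_nonneg.2 (hDE x))]
  have hb2 : ‖∫ x, (D x : ℂ) * Complex.exp (t * x * Complex.I)‖
      ≤ 2 * r * e * (1 - min 1 ((t * r) ^ 2) / 20) := by
    rcases eq_or_ne t 0 with rfl | ht
    · refine (norm_integral_le_integral_norm _).trans (le_of_eq ?_)
      simp only [zero_mul, ne_eq, OfNat.ofNat_ne_zero, not_false_eq_true, zero_pow, zero_le_one,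
        inf_of_le_right, zero_div, sub_zero, mul_one]
      rw [← hDI]
      refine integral_congr_ae (.of_forall fun x => ?_)
      have : 0 ≤ D x := indicator_nonneg (fun _ _ => he.le) x
      simp [abs_of_nonneg this]
    · have h1 : ∫ x, (D x : ℂ) * Complex.exp (t * x * Complex.I)
          = e * ∫ x in (-r)..r, Complex.exp ((t * Complex.I) * x) := by
        rw [intervalIntegral.integral_of_le (by linarith), ← integral_Icc_eq_integral_Ioc,
          ← integral_const_mul, ← integral_indicator measurableSet_Icc]
        refine integral_congr_ae (.of_forall fun x => ?_)
        by_cases hx : x ∈ Icc (-r) r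
        · simp only [hD, indicator_of_mem hx]; ring_nf
        · simp only [hD, indicator_of_notMem hx]; simp
      have htI : (t : ℂ) * Complex.I ≠ 0 := by simp [ht]
      have h2 : ∫ x in (-r)..r, Complex.exp ((t * Complex.I) * x)
          = ((2 * Real.sin (t * r) / t : ℝ) : ℂ) := by
        rw [integral_exp_mul_complex htI]
        push_cast
        rw [Complex.sin]
        have hI : Complex.I ≠ 0 := Complex.I_ne_zero
        have ht' : (t : ℂ) ≠ 0 := by simp [ht]
        field_simp
        rw [Complex.I_sq]
        ring_nf
      rw [h1, h2, norm_mul, Complex.norm_real, Complex.norm_real, Real.norm_of_nonneg he.le,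
        Real.norm_eq_abs, abs_div, abs_mul, abs_two]
      have h3 := abs_sin_le_abs_mul (t * r)
      have ht' : 0 < |t| := abs_pos.2 ht
      rw [abs_mul t r, abs_of_pos hr] at h3
      rw [mul_div_assoc']
      rw [div_le_iff₀ ht']
      nlinarith
  have hmin : r ^ 2 * min 1 (t ^ 2) ≤ min 1 ((t * r) ^ 2) := by
    refine le_min ?_ ?_
    · have : min 1 (t ^ 2) ≤ 1 := min_le_left _ _
      have h0 : 0 ≤ min 1 (t ^ 2) := by positivity
      nlinarith
    · have := min_le_right 1 (t ^ 2)
      nlinarith [sq_nonneg r]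
  calc ‖charFun (stepLaw E) t‖ ≤ (1 - 2 * r * e) + 2 * r * e * (1 - min 1 ((t * r) ^ 2) / 20) := by
        rw [hsplit]; exact (norm_add_le _ _).trans (add_le_add hb1 hb2)
    _ ≤ -(2 * r * e * (r ^ 2 / 20)) * min 1 (t ^ 2) + 1 := by
        have : 0 < 2 * r * e := by positivity
        nlinarith
    _ ≤ _ := Real.add_one_le_exp _

end IsStepDensity

namespace IsStepDensity

variable {E : ℝ → ℝ} {σ M : ℝ}

lemma charFun_mul_conj (h : IsStepDensity E σ M) (ζ : ℝ) :
    ((‖charFun (stepLaw E) ζ‖ ^ 2 : ℝ) : ℂ) = ∫ a : ℝ × ℝ,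
      (1 : ℂ) * Complex.exp ((ζ * (a.1 - a.2) : ℝ) * Complex.I) ∂((stepLaw E).prod (stepLaw E)) := by
  have := h.isProbabilityMeasure
  have h1 : ∀ a : ℝ × ℝ, (1 : ℂ) * Complex.exp ((ζ * (a.1 - a.2) : ℝ) * Complex.I)
      = Complex.exp (ζ * a.1 * Complex.I) * Complex.exp ((-ζ : ℝ) * a.2 * Complex.I) := fun a => by
    rw [← Complex.exp_add, one_mul]
    push_cast
    ring_nf
  simp_rw [h1]
  rw [integral_prod_mul (μ := stepLaw E) (ν := stepLaw E)
    (fun x : ℝ => Complex.exp (ζ * x * Complex.I))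
    (fun x : ℝ => Complex.exp ((-ζ : ℝ) * x * Complex.I)), ← charFun_apply_real,
    ← charFun_apply_real, charFun_neg, Complex.mul_conj, Complex.normSq_eq_norm_sq]

lemma lintegral_gaussian_charFun_sq_le (h : IsStepDensity E σ M) {t : ℝ} (ht : 0 < t) :
    ∫⁻ ζ : ℝ, ENNReal.ofReal (Real.exp (-t * ζ ^ 2) * ‖charFun (stepLaw E) ζ‖ ^ 2)
      ≤ ENNReal.ofReal (2 * Real.pi * M) := by
  have := h.isProbabilityMeasure
  have hM := h.bound_pos
  have hint : Integrable fun ζ : ℝ => Real.exp (-t * ζ ^ 2) * ‖charFun (stepLaw E) ζ‖ ^ 2 := by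
    refine (integrable_exp_neg_mul_sq ht).mono' ?_ (.of_forall fun ζ => ?_)
    · have : Measurable (charFun (stepLaw E)) := measurable_charFun
      exact Measurable.aestronglyMeasurable (by fun_prop)
    · rw [Real.norm_of_nonneg (by positivity)]
      exact mul_le_of_le_one_right (Real.exp_pos _).le
        (pow_le_one₀ (norm_nonneg _) (norm_charFun_le_one _))
  rw [← ofReal_integral_eq_lintegral_ofReal hint (.of_forall fun ζ => by positivity)]
  refine ENNReal.ofReal_le_ofReal ?_
  have key := integral_gaussian_mul_integral ((stepLaw E).prod (stepLaw E)) ht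
    (q := fun a : ℝ × ℝ => a.1 - a.2) (by fun_prop) (h := fun _ => (1 : ℂ)) measurable_const
    (B := 1) (fun _ => by simp)
  simp_rw [← h.charFun_mul_conj] at key
  simp_rw [one_mul, ← Complex.ofReal_mul] at key
  rw [integral_complex_ofReal, integral_complex_ofReal, Complex.ofReal_inj] at key
  rw [key]
  have hg : Integrable fun x : ℝ => Real.sqrt (Real.pi / t) * Real.exp (-x ^ 2 / (4 * t)) := by
    have := (integrable_exp_neg_mul_sq (b := 1 / (4 * t)) (by positivity)).const_mul
      (Real.sqrt (Real.pi / t))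
    refine this.congr (.of_forall fun x => ?_)
    simp only
    ring_nf
  have hgi : ∫ x : ℝ, Real.sqrt (Real.pi / t) * Real.exp (-x ^ 2 / (4 * t)) = 2 * Real.pi := by
    have h1 : ∀ x : ℝ, -x ^ 2 / (4 * t) = -(1 / (4 * t)) * x ^ 2 := fun x => by ring
    simp_rw [h1]
    rw [integral_const_mul, integral_gaussian, ← Real.sqrt_mul (by positivity)]
    rw [show Real.pi / t * (Real.pi / (1 / (4 * t))) = (2 * Real.pi) ^ 2 by field_simp; norm_num]
    exact Real.sqrt_sq (by positivity)
  have hb : Integrable (fun a : ℝ × ℝ => Real.sqrt (Real.pi / t) *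
      Real.exp (-(a.1 - a.2) ^ 2 / (4 * t))) ((stepLaw E).prod (stepLaw E)) := by
    refine Integrable.of_bound (Measurable.aestronglyMeasurable (by fun_prop))
      (Real.sqrt (Real.pi / t)) (.of_forall fun a => ?_)
    rw [Real.norm_of_nonneg (by positivity)]
    refine mul_le_of_le_one_right (Real.sqrt_nonneg _) (Real.exp_le_one_iff.2 ?_)
    rw [neg_div]
    have : 0 ≤ (a.1 - a.2) ^ 2 / (4 * t) := by positivity
    linarith
  rw [integral_prod _ hb]
  have hin : ∀ x : ℝ, ∫ y, Real.sqrt (Real.pi / t) * Real.exp (-(x - y) ^ 2 / (4 * t)) ∂(stepLaw E)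
      ≤ 2 * Real.pi * M := by
    intro x
    rw [h.integral_stepLaw]
    have hg' := hg.comp_sub_left x
    have e1 : ∫ y, M * (Real.sqrt (Real.pi / t) * Real.exp (-(x - y) ^ 2 / (4 * t)))
        = 2 * Real.pi * M := by
      rw [integral_const_mul,
        integral_sub_left_eq_self (fun y => Real.sqrt (Real.pi / t) * Real.exp (-y ^ 2 / (4 * t))),
        hgi]
      ring
    rw [← e1]
    refine integral_mono_of_nonneg (.of_forall fun y => ?_) (hg'.const_mul M)
      (.of_forall fun y => ?_)
    · exact smul_nonneg (h.nonneg y) (by positivity)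
    · simp only [smul_eq_mul]
      gcongr
      exact h.le_bound y
  calc _ ≤ ∫ _, 2 * Real.pi * M ∂(stepLaw E) :=
        integral_mono hb.integral_prod_left (integrable_const _) hin
    _ = _ := by simp

/-- The characteristic function of a bounded density is square integrable. -/
lemma lintegral_charFun_sq_le (h : IsStepDensity E σ M) :
    ∫⁻ ζ : ℝ, ‖charFun (stepLaw E) ζ‖ₑ ^ 2 ≤ ENNReal.ofReal (2 * Real.pi * M) := by
  have := h.isProbabilityMeasure
  have hmeas : Measurable (charFun (stepLaw E)) := measurable_charFun
  set F : ℕ → ℝ → ℝ≥0∞ := fun n ζ =>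
    ENNReal.ofReal (Real.exp (-(1 / ((n : ℝ) + 1)) * ζ ^ 2) * ‖charFun (stepLaw E) ζ‖ ^ 2) with hF
  have hlim : ∀ ζ, Tendsto (fun n => F n ζ) atTop (𝓝 (‖charFun (stepLaw E) ζ‖ₑ ^ 2)) := by
    intro ζ
    have h1 : Tendsto (fun n : ℕ => Real.exp (-(1 / ((n : ℝ) + 1)) * ζ ^ 2)
        * ‖charFun (stepLaw E) ζ‖ ^ 2) atTop (𝓝 (Real.exp (-0 * ζ ^ 2)
          * ‖charFun (stepLaw E) ζ‖ ^ 2)) :=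
      ((Real.continuous_exp.tendsto _).comp
        ((tendsto_one_div_add_atTop_nhds_zero_nat.neg).mul_const _)).mul_const _
    have h2 := (ENNReal.continuous_ofReal.tendsto _).comp h1
    simp only [neg_zero, zero_mul, Real.exp_zero, one_mul] at h2
    rwa [ENNReal.ofReal_pow (norm_nonneg _), ofReal_norm] at h2
  calc ∫⁻ ζ : ℝ, ‖charFun (stepLaw E) ζ‖ₑ ^ 2 = ∫⁻ ζ, liminf (fun n => F n ζ) atTop := by
        simp_rw [(hlim _).liminf_eq]
    _ ≤ liminf (fun n => ∫⁻ ζ, F n ζ) atTop := lintegral_liminf_le fun n => by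
        simp only [hF]; fun_prop
    _ ≤ liminf (fun _ : ℕ => ENNReal.ofReal (2 * Real.pi * M)) atTop :=
        liminf_le_liminf (.of_forall fun n => h.lintegral_gaussian_charFun_sq_le (by positivity))
    _ = _ := liminf_const _

/-- High powers of the characteristic function have small integral. -/
lemma lintegral_charFun_pow_le (h : IsStepDensity E σ M) : ∃ C : ℝ, 0 < C ∧ ∀ q : ℕ, 2 ≤ q →
    ∫⁻ ζ : ℝ, ‖charFun (stepLaw E) ζ‖ₑ ^ q ≤ ENNReal.ofReal (C / Real.sqrt q) := by
  have := h.isProbabilityMeasure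
  have hM := h.bound_pos
  obtain ⟨c, hc, hψ⟩ := h.norm_charFun_le_exp
  set A := 2 * Real.pi * M
  have hA : 0 < A := by positivity
  refine ⟨Real.sqrt (Real.pi / c) + A * (Real.exp (2 * c) / Real.sqrt c), by positivity,
    fun q hq => ?_⟩
  have hq0 : (0 : ℝ) < q := by exact_mod_cast (by omega : 0 < q)
  have hpt : ∀ ζ : ℝ, ‖charFun (stepLaw E) ζ‖ₑ ^ q ≤ ENNReal.ofReal (Real.exp (-(c * q) * ζ ^ 2))
      + ENNReal.ofReal (Real.exp (-c * (q - 2))) * ‖charFun (stepLaw E) ζ‖ₑ ^ 2 := by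
    intro ζ
    rcases le_total (ζ ^ 2) 1 with h1 | h1
    · refine le_trans ?_ le_self_add
      rw [← ofReal_norm, ← ENNReal.ofReal_pow (norm_nonneg _)]
      refine ENNReal.ofReal_le_ofReal ?_
      calc ‖charFun (stepLaw E) ζ‖ ^ q ≤ Real.exp (-c * min 1 (ζ ^ 2)) ^ q := by
            gcongr; exact hψ ζ
        _ = _ := by rw [min_eq_right h1, ← Real.exp_nat_mul]; ring_nf
    · refine le_trans ?_ le_add_self
      rw [← ofReal_norm, ← ENNReal.ofReal_pow (norm_nonneg _), ← ENNReal.ofReal_pow (norm_nonneg _),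
        ← ENNReal.ofReal_mul (by positivity)]
      refine ENNReal.ofReal_le_ofReal ?_
      calc ‖charFun (stepLaw E) ζ‖ ^ q
          = ‖charFun (stepLaw E) ζ‖ ^ (q - 2) * ‖charFun (stepLaw E) ζ‖ ^ 2 := by
            rw [← pow_add]; congr 1; omega
        _ ≤ Real.exp (-c * min 1 (ζ ^ 2)) ^ (q - 2) * ‖charFun (stepLaw E) ζ‖ ^ 2 := by
            gcongr; exact hψ ζ
        _ = _ := by
            rw [min_eq_left h1, ← Real.exp_nat_mul, Nat.cast_sub hq]
            push_cast; ring_nf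
  have hmeas : Measurable (charFun (stepLaw E)) := measurable_charFun
  calc ∫⁻ ζ : ℝ, ‖charFun (stepLaw E) ζ‖ₑ ^ q
      ≤ ∫⁻ ζ : ℝ, (ENNReal.ofReal (Real.exp (-(c * q) * ζ ^ 2))
      + ENNReal.ofReal (Real.exp (-c * (q - 2))) * ‖charFun (stepLaw E) ζ‖ₑ ^ 2) :=
        lintegral_mono hpt
    _ = ENNReal.ofReal (Real.sqrt (Real.pi / (c * q)))
        + ENNReal.ofReal (Real.exp (-c * (q - 2))) * ∫⁻ ζ, ‖charFun (stepLaw E) ζ‖ₑ ^ 2 := by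
        rw [lintegral_add_left (by fun_prop), lintegral_const_mul _ (by fun_prop),
          ← ofReal_integral_eq_lintegral_ofReal (integrable_exp_neg_mul_sq (by positivity))
            (.of_forall fun _ => (Real.exp_pos _).le), integral_gaussian]
    _ ≤ ENNReal.ofReal (Real.sqrt (Real.pi / (c * q)))
        + ENNReal.ofReal (Real.exp (-c * (q - 2))) * ENNReal.ofReal A := by
        gcongr; exact h.lintegral_charFun_sq_le
    _ = ENNReal.ofReal (Real.sqrt (Real.pi / (c * q)) + Real.exp (-c * (q - 2)) * A) := by
        rw [← ENNReal.ofReal_mul (by positivity), ← ENNReal.ofReal_add (by positivity)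
          (by positivity)]
    _ ≤ _ := by
        refine ENNReal.ofReal_le_ofReal ?_
        rw [add_div, ← div_div Real.pi c, Real.sqrt_div (by positivity) (q : ℝ)]
        gcongr
        have h1 : Real.exp (-c * (q - 2)) = Real.exp (2 * c) / Real.exp (c * q) := by
          rw [← Real.exp_sub]; ring_nf
        have h2 : Real.sqrt (c * q) ≤ Real.exp (c * q) := by
          have h3 := Real.add_one_le_exp (c * q)
          have h4 : Real.sqrt (c * q) ≤ c * q + 1 := by
            rw [Real.sqrt_le_left (by positivity)]
            nlinarith [mul_pos hc hq0]
          linarith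
        rw [h1, mul_comm, ← mul_div_assoc, ← mul_div_assoc, div_div, ← Real.sqrt_mul hc.le]
        gcongr

end IsStepDensity

/-- The law of the pair of the last two positions of an integrated random walk after `n` steps,
started from the pair `s`. -/
def walkLaw (E : ℝ → ℝ) : ℕ → ℝ × ℝ → Measure (ℝ × ℝ)
  | 0, s => Measure.dirac s
  | n + 1, s => ((walkLaw E n s).prod (stepLaw E)).map
      fun p => (p.1.2, 2 * p.1.2 - p.1.1 + p.2)

/-- One-step transition operator of the integrated random walk. -/
def freeStep (E : ℝ → ℝ) (f : ℝ × ℝ → ℝ≥0∞) (s : ℝ × ℝ) : ℝ≥0∞ :=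
  ∫⁻ x, f (s.2, 2 * s.2 - s.1 + x) ∂(stepLaw E)

lemma lintegral_mul_shear {f : ℝ → ℝ≥0∞} (hf : Measurable f)
    (k q : ℕ) (hq : 0 < q) :
    ∫⁻ p : ℝ × ℝ, f (p.1 + k * p.2) * f (p.1 + (k + q : ℕ) * p.2)
      = ENNReal.ofReal ((q : ℝ)⁻¹) * (∫⁻ x, f x) ^ 2 := by
  have hq' : (q : ℝ) ≠ 0 := by exact_mod_cast hq.ne'
  rw [Measure.volume_eq_prod, lintegral_prod_symm _ (by fun_prop)]
  have h1 : ∀ θ : ℝ, ∫⁻ ζ : ℝ, f (ζ + k * θ) * f (ζ + (k + q : ℕ) * θ)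
      = ∫⁻ ζ : ℝ, f ζ * f (ζ + q * θ) := by
    intro θ
    rw [← lintegral_add_right_eq_self (fun ζ => f ζ * f (ζ + q * θ)) (k * θ)]
    refine lintegral_congr fun ζ => ?_
    push_cast
    ring_nf
  simp_rw [h1]
  rw [lintegral_lintegral_swap (by fun_prop)]
  have h2 : ∀ ζ : ℝ, ∫⁻ θ : ℝ, f ζ * f (ζ + q * θ)
      = f ζ * (ENNReal.ofReal ((q : ℝ)⁻¹) * ∫⁻ x, f x) := by
    intro ζ
    rw [lintegral_const_mul _ (by fun_prop)]
    congr 1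
    have h3 : Measurable fun x => f (ζ + x) := by fun_prop
    have h4 := Real.map_volume_mul_left hq'
    calc ∫⁻ θ : ℝ, f (ζ + q * θ) = ∫⁻ x, f (ζ + x) ∂(volume.map (fun θ : ℝ => (q : ℝ) * θ)) := by
          rw [lintegral_map h3 (by fun_prop)]
      _ = ENNReal.ofReal ((q : ℝ)⁻¹) * ∫⁻ x, f (ζ + x) := by
          rw [h4, lintegral_smul_measure, abs_of_nonneg (by positivity), smul_eq_mul]
      _ = _ := by rw [lintegral_add_left_eq_self]
  simp_rw [h2]
  rw [lintegral_mul_const _ hf]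
  ring

namespace IsStepDensity

variable {E : ℝ → ℝ} {σ M : ℝ}

lemma walkLaw_isProbabilityMeasure (h : IsStepDensity E σ M) (n : ℕ) (s : ℝ × ℝ) :
    IsProbabilityMeasure (walkLaw E n s) := by
  have := h.isProbabilityMeasure
  induction n with
  | zero => rw [walkLaw]; infer_instance
  | succ n ih => exact Measure.isProbabilityMeasure_map (by fun_prop)

lemma measurable_freeStep (h : IsStepDensity E σ M) {f : ℝ × ℝ → ℝ≥0∞} (hf : Measurable f) :
    Measurable (freeStep E f) := by
  have := h.isProbabilityMeasure
  exact Measurable.lintegral_prod_right' (f := fun p : (ℝ × ℝ) × ℝ =>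
    f (p.1.2, 2 * p.1.2 - p.1.1 + p.2)) (by fun_prop)

lemma lintegral_walkLaw_succ (h : IsStepDensity E σ M) (n : ℕ) (s : ℝ × ℝ)
    {f : ℝ × ℝ → ℝ≥0∞} (hf : Measurable f) :
    ∫⁻ p, f p ∂(walkLaw E (n + 1) s) = ∫⁻ p, freeStep E f p ∂(walkLaw E n s) := by
  have := h.isProbabilityMeasure
  have := h.walkLaw_isProbabilityMeasure n s
  rw [walkLaw, lintegral_map hf (by fun_prop), lintegral_prod _ (by fun_prop)]
  rfl

lemma enorm_char_walkLaw (h : IsStepDensity E σ M) (n : ℕ) (s : ℝ × ℝ) (ξ ζ : ℝ) :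
    ‖∫ a, Complex.exp ((ξ * a.1 + ζ * a.2 : ℝ) * Complex.I) ∂(walkLaw E n s)‖ₑ
      = ∏ k ∈ Finset.range n, ‖charFun (stepLaw E) (ζ + k * (ξ + ζ))‖ₑ := by
  have := h.isProbabilityMeasure
  induction n generalizing ξ ζ with
  | zero =>
    rw [walkLaw, integral_dirac, ← ofReal_norm, Complex.norm_exp_ofReal_mul_I]
    simp
  | succ n ih =>
    have := h.walkLaw_isProbabilityMeasure n s
    rw [walkLaw, integral_map (by fun_prop) (by fun_prop)]
    have h1 : ∀ p : (ℝ × ℝ) × ℝ,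
        Complex.exp ((ξ * p.1.2 + ζ * (2 * p.1.2 - p.1.1 + p.2) : ℝ) * Complex.I)
        = Complex.exp (((-ζ) * p.1.1 + (ξ + 2 * ζ) * p.1.2 : ℝ) * Complex.I)
          * Complex.exp (ζ * p.2 * Complex.I) := fun p => by
      rw [← Complex.exp_add]
      push_cast
      ring_nf
    simp_rw [h1]
    rw [integral_prod_mul (μ := walkLaw E n s) (ν := stepLaw E)
      (fun a : ℝ × ℝ => Complex.exp (((-ζ) * a.1 + (ξ + 2 * ζ) * a.2 : ℝ) * Complex.I))
      (fun x : ℝ => Complex.exp (ζ * x * Complex.I)), ← charFun_apply_real, enorm_mul, ih,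
      Finset.prod_range_succ']
    congr 1
    · refine Finset.prod_congr rfl fun k _ => ?_
      push_cast
      ring_nf
    · simp

/-- The characteristic function of the walk after `n ≥ 4` steps has `L¹` norm `O(n⁻²)`. -/
lemma lintegral_char_walkLaw_le (h : IsStepDensity E σ M) : ∃ C : ℝ, 0 < C ∧ ∀ n : ℕ, 4 ≤ n →
    ∀ s, ∫⁻ ξ : ℝ, ∫⁻ ζ : ℝ,
      ‖∫ a, Complex.exp ((ξ * a.1 + ζ * a.2 : ℝ) * Complex.I) ∂(walkLaw E n s)‖ₑ
        ≤ ENNReal.ofReal (C / (n : ℝ) ^ 2) := by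
  have := h.isProbabilityMeasure
  obtain ⟨C, hC, hI⟩ := h.lintegral_charFun_pow_le
  refine ⟨9 * C ^ 2, by positivity, fun n hn s => ?_⟩
  set q := n / 2 with hqdef
  have hq : 2 ≤ q := by omega
  have hq0 : (0 : ℝ) < q := by exact_mod_cast (by omega : 0 < q)
  set Ψ : ℝ → ℝ≥0∞ := fun t => ‖charFun (stepLaw E) t‖ₑ with hΨ
  have hmeas : Measurable (charFun (stepLaw E)) := measurable_charFun
  have hΨm : Measurable Ψ := by fun_prop
  have hΨ1 : ∀ t, Ψ t ≤ 1 := fun t => by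
    simp only [hΨ]
    rw [← ofReal_norm, ENNReal.ofReal_le_one]
    exact norm_charFun_le_one _
  simp_rw [h.enorm_char_walkLaw]
  rw [lintegral_lintegral_swap (by fun_prop)]
  have h1 : ∀ ζ : ℝ, ∫⁻ ξ : ℝ, ∏ k ∈ Finset.range n, Ψ (ζ + k * (ξ + ζ))
      = ∫⁻ θ : ℝ, ∏ k ∈ Finset.range n, Ψ (ζ + k * θ) := fun ζ =>
    lintegral_add_right_eq_self (fun θ => ∏ k ∈ Finset.range n, Ψ (ζ + k * θ)) ζ
  calc ∫⁻ ζ : ℝ, ∫⁻ ξ : ℝ, ∏ k ∈ Finset.range n, ‖charFun (stepLaw E) (ζ + k * (ξ + ζ))‖ₑ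
      = ∫⁻ ζ : ℝ, ∫⁻ θ : ℝ, ∏ k ∈ Finset.range n, Ψ (ζ + k * θ) := lintegral_congr h1
    _ = ∫⁻ p : ℝ × ℝ, ∏ k ∈ Finset.range n, Ψ (p.1 + k * p.2) := by
        rw [Measure.volume_eq_prod, lintegral_prod _ (by fun_prop)]
    _ ≤ ∫⁻ p : ℝ × ℝ, ∏ k ∈ Finset.range q,
          ((Ψ (p.1 + k * p.2) ^ q * Ψ (p.1 + (k + q : ℕ) * p.2) ^ q)) ^ ((q : ℝ)⁻¹) := by
        refine lintegral_mono fun p => ?_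
        have e1 : ∀ k : ℕ, (Ψ (p.1 + k * p.2) ^ q * Ψ (p.1 + (k + q : ℕ) * p.2) ^ q) ^ ((q : ℝ)⁻¹)
            = Ψ (p.1 + k * p.2) * Ψ (p.1 + (k + q : ℕ) * p.2) := fun k => by
          rw [← mul_pow, ← ENNReal.rpow_natCast, ← ENNReal.rpow_mul,
            mul_inv_cancel₀ hq0.ne', ENNReal.rpow_one]
        simp_rw [e1]
        rw [Finset.prod_mul_distrib]
        have e2 : ∏ k ∈ Finset.range q, Ψ (p.1 + (k + q : ℕ) * p.2)
            = ∏ k ∈ Finset.range q, Ψ (p.1 + (q + k : ℕ) * p.2) :=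
          Finset.prod_congr rfl fun k _ => by rw [add_comm k q]
        rw [e2, ← Finset.prod_range_add (fun k : ℕ => Ψ (p.1 + k * p.2))]
        refine Finset.prod_le_prod_of_subset_of_le_one' ?_ fun _ _ _ => hΨ1 _
        intro k hk
        rw [Finset.mem_range] at hk ⊢
        omega
    _ ≤ ∏ k ∈ Finset.range q, (∫⁻ p : ℝ × ℝ,
          Ψ (p.1 + k * p.2) ^ q * Ψ (p.1 + (k + q : ℕ) * p.2) ^ q) ^ ((q : ℝ)⁻¹) := by
        refine ENNReal.lintegral_prod_norm_pow_le _ (fun k _ => by fun_prop) ?_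
          fun _ _ => by positivity
        rw [Finset.sum_const, Finset.card_range, nsmul_eq_mul, mul_inv_cancel₀ hq0.ne']
    _ = ENNReal.ofReal ((q : ℝ)⁻¹) * (∫⁻ x, Ψ x ^ q) ^ 2 := by
        have e3 := fun k : ℕ => lintegral_mul_shear (f := fun x => Ψ x ^ q)
          (hΨm.pow_const q) k q (by omega)
        simp_rw [e3]
        rw [Finset.prod_const, Finset.card_range, ← ENNReal.rpow_natCast, ← ENNReal.rpow_mul,
            inv_mul_cancel₀ hq0.ne', ENNReal.rpow_one]
    _ ≤ ENNReal.ofReal ((q : ℝ)⁻¹) * (ENNReal.ofReal (C / Real.sqrt q)) ^ 2 := by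
        gcongr
        exact hI q hq
    _ ≤ ENNReal.ofReal (9 * C ^ 2 / (n : ℝ) ^ 2) := by
        rw [← ENNReal.ofReal_pow (by positivity), ← ENNReal.ofReal_mul (by positivity)]
        refine ENNReal.ofReal_le_ofReal ?_
        rw [div_pow, Real.sq_sqrt hq0.le, inv_mul_eq_div, div_div,
          div_le_div_iff₀ (by positivity) (by positivity)]
        have hn3 : (n : ℝ) ≤ 3 * q := by exact_mod_cast (by omega : n ≤ 3 * q)
        have : (n : ℝ) ^ 2 ≤ 9 * (q * q) := by nlinarith [(Nat.cast_nonneg n : (0 : ℝ) ≤ n)]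
        nlinarith [sq_nonneg C]

end IsStepDensity

namespace IsStepDensity

variable {E : ℝ → ℝ} {σ M : ℝ}

lemma freeStep_freeStep_le (h : IsStepDensity E σ M) {f : ℝ × ℝ → ℝ≥0∞} (hf : Measurable f)
    (s : ℝ × ℝ) : freeStep E (freeStep E f) s ≤ ENNReal.ofReal (M ^ 2) * ∫⁻ p, f p := by
  have := h.isProbabilityMeasure
  have hle : ∀ {g : ℝ → ℝ≥0∞} (_ : Measurable g) (c : ℝ),
      ∫⁻ x, g (c + x) ∂(stepLaw E) ≤ ENNReal.ofReal M * ∫⁻ x, g x := by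
    intro g hg c
    rw [h.lintegral_stepLaw (by fun_prop), ← lintegral_add_left_eq_self g c,
      ← lintegral_const_mul _ (by fun_prop)]
    refine lintegral_mono fun x => ?_
    simp only
    gcongr
    exact h.eDens_le x
  rw [Measure.volume_eq_prod, lintegral_prod _ hf.aemeasurable]
  have h1 : Measurable fun z : ℝ => ∫⁻ y, f (z, y) := Measurable.lintegral_prod_right' hf
  calc freeStep E (freeStep E f) s
      ≤ ∫⁻ x, (ENNReal.ofReal M * ∫⁻ y, f (2 * s.2 - s.1 + x, y)) ∂(stepLaw E) := by
        refine lintegral_mono fun x => ?_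
        exact hle (g := fun y => f (2 * s.2 - s.1 + x, y)) (by fun_prop) _
    _ ≤ ENNReal.ofReal M * (ENNReal.ofReal M * ∫⁻ z, ∫⁻ y, f (z, y)) :=
        hle (g := fun z => ENNReal.ofReal M * ∫⁻ y, f (z, y)) (by fun_prop) _ |>.trans (by
          rw [lintegral_const_mul _ h1])
    _ = _ := by rw [← mul_assoc, ← ENNReal.ofReal_mul h.bound_pos.le, sq]

/-- The two-point density of the integrated walk after `n` steps is `O(n⁻²)`. -/
lemma exists_lintegral_walkLaw_le (h : IsStepDensity E σ M) : ∃ C : ℝ, 0 < C ∧ ∀ n : ℕ, 2 ≤ n →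
    ∀ s, ∀ f : ℝ × ℝ → ℝ≥0∞, Measurable f →
      ∫⁻ p, f p ∂(walkLaw E n s) ≤ ENNReal.ofReal (C / (n : ℝ) ^ 2) * ∫⁻ p, f p := by
  obtain ⟨C, hC, hJ⟩ := h.lintegral_char_walkLaw_le
  have hM := h.bound_pos
  refine ⟨C + 9 * M ^ 2, by positivity, fun n hn s f hf => ?_⟩
  have hn0 : (0 : ℝ) < n := by exact_mod_cast (by omega : 0 < n)
  rcases le_or_gt 4 n with h4 | h4
  · have := h.walkLaw_isProbabilityMeasure n s
    have hle := measure_le_lintegral_char_smul_volume (walkLaw E n s)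
      (C := Real.toNNReal (C / (n : ℝ) ^ 2)) (hJ n h4 s)
    calc ∫⁻ p, f p ∂(walkLaw E n s)
        ≤ ∫⁻ p, f p ∂(Real.toNNReal (C / (n : ℝ) ^ 2) • volume) := lintegral_mono' hle le_rfl
      _ = ENNReal.ofReal (C / (n : ℝ) ^ 2) * ∫⁻ p, f p := lintegral_smul_measure _ _
      _ ≤ _ := by gcongr; nlinarith
  · obtain ⟨m, rfl⟩ : ∃ m, n = m + 2 := ⟨n - 2, by omega⟩
    have := h.walkLaw_isProbabilityMeasure m s
    rw [h.lintegral_walkLaw_succ _ s hf, h.lintegral_walkLaw_succ _ s (h.measurable_freeStep hf)]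
    calc ∫⁻ p, freeStep E (freeStep E f) p ∂(walkLaw E m s)
        ≤ ∫⁻ _, (ENNReal.ofReal (M ^ 2) * ∫⁻ p, f p) ∂(walkLaw E m s) :=
          lintegral_mono fun p => h.freeStep_freeStep_le hf p
      _ = ENNReal.ofReal (M ^ 2) * ∫⁻ p, f p := by simp
      _ ≤ _ := by
        gcongr
        rw [le_div_iff₀ (by positivity)]
        have : ((m + 2 : ℕ) : ℝ) ≤ 3 := by exact_mod_cast (by omega : m + 2 ≤ 3)
        have h9 : ((m + 2 : ℕ) : ℝ) ^ 2 ≤ 9 := by nlinarith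
        nlinarith [sq_nonneg M]

/-- Second moments of affine functionals propagate explicitly. -/
lemma freeStep_sq (h : IsStepDensity E σ M) (α β γ c : ℝ) (hc : 0 ≤ c) :
    freeStep E (fun p => ENNReal.ofReal ((α * p.1 + β * p.2 + γ) ^ 2 + c))
      = fun p => ENNReal.ofReal (((-β) * p.1 + (α + 2 * β) * p.2 + γ) ^ 2
          + (c + β ^ 2 * σ ^ 2)) := by
  funext p
  have h1 : ∀ m : ℝ, ∫ x, E x * ((m + β * x) ^ 2 + c) = m ^ 2 + c + β ^ 2 * σ ^ 2 := by
    intro m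
    have e : ∀ x, E x * ((m + β * x) ^ 2 + c)
        = (m ^ 2 + c) * E x + 2 * m * β * (x * E x) + β ^ 2 * (x ^ 2 * E x) := fun x => by ring
    simp_rw [e]
    have hi : Integrable fun x => (m ^ 2 + c) * E x + 2 * m * β * (x * E x) :=
      (h.integrable.const_mul _).add (h.mom1.const_mul _)
    rw [integral_add hi (h.mom2.const_mul _), integral_add (h.integrable.const_mul _) (h.mom1.const_mul _), integral_const_mul,
      integral_const_mul, integral_const_mul, h.mass, h.mean, h.var]
    ring
  have hi : ∀ m : ℝ, Integrable fun x => E x * ((m + β * x) ^ 2 + c) := by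
    intro m
    have := ((h.integrable.const_mul (m ^ 2 + c)).add (h.mom1.const_mul (2 * m * β))).add
      (h.mom2.const_mul (β ^ 2))
    refine this.congr (.of_forall fun x => ?_)
    simp only [Pi.add_apply]
    ring
  set m := (-β) * p.1 + (α + 2 * β) * p.2 + γ with hm
  have h2 : ∀ x, eDens E x * ENNReal.ofReal
      ((α * p.2 + β * (2 * p.2 - p.1 + x) + γ) ^ 2 + c)
      = ENNReal.ofReal (E x * ((m + β * x) ^ 2 + c)) := fun x => by
    rw [eDens, ← ENNReal.ofReal_mul (h.nonneg x), hm]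
    ring_nf
  rw [freeStep, h.lintegral_stepLaw (by fun_prop)]
  simp_rw [h2]
  rw [← ofReal_integral_eq_lintegral_ofReal (hi m)
    (.of_forall fun x => mul_nonneg (h.nonneg x) (by positivity)), h1]
  ring_nf

lemma lintegral_slope_sq (h : IsStepDensity E σ M) (n : ℕ) (s : ℝ × ℝ) (γ : ℝ) :
    ∫⁻ p, ENNReal.ofReal ((p.2 - p.1 + γ) ^ 2) ∂(walkLaw E n s)
      = ENNReal.ofReal ((s.2 - s.1 + γ) ^ 2 + n * σ ^ 2) := by
  have key : ∀ (n : ℕ) (c : ℝ), 0 ≤ c →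
      ∫⁻ p, ENNReal.ofReal (((-1) * p.1 + 1 * p.2 + γ) ^ 2 + c) ∂(walkLaw E n s)
      = ENNReal.ofReal (((-1) * s.1 + 1 * s.2 + γ) ^ 2 + (c + n * σ ^ 2)) := by
    intro n
    induction n with
    | zero => intro c hc; rw [walkLaw, lintegral_dirac' _ (by fun_prop)]; simp
    | succ n ih =>
      intro c hc
      rw [h.lintegral_walkLaw_succ n s (by fun_prop), h.freeStep_sq _ _ _ _ hc]
      have := ih (c + 1 ^ 2 * σ ^ 2) (by positivity)
      rw [show ((-1 : ℝ) + 2 * 1) = 1 by norm_num, this]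
      push_cast
      ring_nf
  have := key n 0 le_rfl
  convert this using 3 <;> ring_nf

/-- The second moment of the position, with the variance bounded by `n³σ²`. -/
lemma lintegral_height_sq (h : IsStepDensity E σ M) (n : ℕ) (s : ℝ × ℝ) :
    ∃ v : ℝ, 0 ≤ v ∧ v ≤ n ^ 3 * σ ^ 2 ∧ ∀ γ : ℝ,
      ∫⁻ p, ENNReal.ofReal ((p.2 + γ) ^ 2) ∂(walkLaw E n s)
      = ENNReal.ofReal ((s.2 + n * (s.2 - s.1) + γ) ^ 2 + v) := by
  have key : ∀ (n : ℕ) (γ β c : ℝ), 0 ≤ c →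
      ∫⁻ p, ENNReal.ofReal ((-β * p.1 + (β + 1) * p.2 + γ) ^ 2 + c) ∂(walkLaw E n s)
      = ENNReal.ofReal ((-(β + n) * s.1 + (β + n + 1) * s.2 + γ) ^ 2
        + (c + σ ^ 2 * ∑ k ∈ Finset.range n, (β + 1 + k) ^ 2)) := by
    intro n γ
    induction n with
    | zero => intro β c hc; rw [walkLaw, lintegral_dirac' _ (by fun_prop)]; simp
    | succ n ih =>
      intro β c hc
      rw [h.lintegral_walkLaw_succ n s (by fun_prop), h.freeStep_sq _ _ _ _ hc]
      have := ih (β + 1) (c + (β + 1) ^ 2 * σ ^ 2) (by positivity)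
      rw [show (-β + 2 * (β + 1)) = β + 1 + 1 by ring, this, Finset.sum_range_succ']
      push_cast
      congr 1
      have e : ∀ k : ℕ, (β + 1 + ((k : ℝ) + 1)) ^ 2 = (β + 1 + 1 + k) ^ 2 := fun k => by ring
      simp_rw [e]
      ring
  refine ⟨σ ^ 2 * ∑ k ∈ Finset.range n, (0 + 1 + (k : ℝ)) ^ 2, by positivity, ?_, fun γ => ?_⟩
  · rw [mul_comm]
    gcongr
    calc ∑ k ∈ Finset.range n, (0 + 1 + (k : ℝ)) ^ 2 ≤ ∑ _k ∈ Finset.range n, (n : ℝ) ^ 2 := by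
          refine Finset.sum_le_sum fun k hk => ?_
          have : ((k + 1 : ℕ) : ℝ) ≤ n := by exact_mod_cast Finset.mem_range.1 hk
          push_cast at this
          gcongr
          linarith
      _ = (n : ℝ) ^ 3 := by simp; ring
  · have := key n γ 0 0 le_rfl
    convert this using 3 <;> ring_nf

end IsStepDensity

lemma measurableSet_strip (a b c d : ℝ) :
    MeasurableSet {p : ℝ × ℝ | |p.2 - a| ≤ b ∧ |p.2 - p.1 - c| ≤ d} := by
  measurability

lemma volume_strip_le (a b c d : ℝ) :
    volume {p : ℝ × ℝ | |p.2 - a| ≤ b ∧ |p.2 - p.1 - c| ≤ d}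
      ≤ ENNReal.ofReal (2 * b) * ENNReal.ofReal (2 * d) := by
  rw [Measure.volume_eq_prod, Measure.prod_apply_symm (measurableSet_strip _ _ _ _)]
  have h1 : ∀ y : ℝ, volume ((fun x => (x, y)) ⁻¹'
      {p : ℝ × ℝ | |p.2 - a| ≤ b ∧ |p.2 - p.1 - c| ≤ d})
      ≤ (Metric.closedBall a b).indicator (fun _ => ENNReal.ofReal (2 * d)) y := by
    intro y
    by_cases hy : y ∈ Metric.closedBall a b
    · rw [indicator_of_mem hy, ← Real.volume_closedBall (y - c)]
      refine measure_mono fun x hx => ?_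
      rw [Metric.mem_closedBall, Real.dist_eq, abs_sub_comm]
      have := hx.2
      simp only at this
      rwa [sub_right_comm] at this
    · rw [indicator_of_notMem hy, nonpos_iff_eq_zero]
      convert measure_empty (μ := (volume : Measure ℝ))
      ext x
      simp only [mem_preimage, mem_ofPred_eq, mem_empty_iff_false, iff_false, not_and]
      intro h
      exact absurd (by rwa [Metric.mem_closedBall, Real.dist_eq]) hy
  refine (lintegral_mono h1).trans ?_
  rw [lintegral_indicator Metric.isClosed_closedBall.measurableSet, setLIntegral_const,
    Real.volume_closedBall, mul_comm]

namespace IsStepDensity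

variable {E : ℝ → ℝ} {σ M : ℝ}

/-- The height of the walk is not too concentrated around its mean. -/
lemma walkLaw_small_ball_le (h : IsStepDensity E σ M) : ∃ κ : ℝ, 0 < κ ∧ ∀ n : ℕ, 2 ≤ n → ∀ s,
    walkLaw E n s {p | |p.2 - (s.2 + n * (s.2 - s.1))| ≤ κ * (n * Real.sqrt n)}
      ≤ ENNReal.ofReal (1 / 2) := by
  obtain ⟨C, hC, hK⟩ := h.exists_lintegral_walkLaw_le
  have hσ := h.sigma_pos
  refine ⟨1 / (32 * C * σ), by positivity, fun n hn s => ?_⟩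
  have hn0 : (0 : ℝ) < n := by exact_mod_cast (by omega : 0 < n)
  set κ := 1 / (32 * C * σ) with hκ
  set ν := walkLaw E n s
  set μ := s.2 + n * (s.2 - s.1)
  set A := {p : ℝ × ℝ | |p.2 - μ| ≤ κ * (n * Real.sqrt n) ∧
    |p.2 - p.1 - (s.2 - s.1)| ≤ 2 * σ * Real.sqrt n}
  set B := {p : ℝ × ℝ | ENNReal.ofReal (4 * σ ^ 2 * n)
    ≤ ENNReal.ofReal ((p.2 - p.1 + -(s.2 - s.1)) ^ 2)}
  have hAm : MeasurableSet A := measurableSet_strip _ _ _ _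
  have hsub : {p : ℝ × ℝ | |p.2 - μ| ≤ κ * (n * Real.sqrt n)} ⊆ A ∪ B := by
    intro p hp
    by_cases hp2 : |p.2 - p.1 - (s.2 - s.1)| ≤ 2 * σ * Real.sqrt n
    · exact Or.inl ⟨hp, hp2⟩
    · refine Or.inr (ENNReal.ofReal_le_ofReal ?_)
      rw [← sub_eq_add_neg, ← sq_abs (p.2 - p.1 - (s.2 - s.1)),
        show 4 * σ ^ 2 * n = (2 * σ * Real.sqrt n) ^ 2 by
          rw [mul_pow, Real.sq_sqrt hn0.le]; ring]
      push Not at hp2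
      gcongr
  have hA : ν A ≤ ENNReal.ofReal (1 / 4) := by
    have h1 := hK n hn s (A.indicator 1) (measurable_one.indicator hAm)
    rw [lintegral_indicator_one hAm, lintegral_indicator_one hAm] at h1
    refine h1.trans ?_
    calc ENNReal.ofReal (C / (n : ℝ) ^ 2) * volume A
        ≤ ENNReal.ofReal (C / (n : ℝ) ^ 2) * (ENNReal.ofReal (2 * (κ * (n * Real.sqrt n)))
          * ENNReal.ofReal (2 * (2 * σ * Real.sqrt n))) := by
          gcongr; exact volume_strip_le _ _ _ _
      _ = ENNReal.ofReal (C / (n : ℝ) ^ 2 * ((2 * (κ * (n * Real.sqrt n)))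
          * (2 * (2 * σ * Real.sqrt n)))) := by
          rw [← ENNReal.ofReal_mul (by positivity), ← ENNReal.ofReal_mul (by positivity)]
      _ = ENNReal.ofReal (1 / 4) := by
          congr 1
          rw [hκ]
          have := Real.mul_self_sqrt hn0.le
          field_simp
          rw [Real.sq_sqrt hn0.le]
          ring
  have hB : ν B ≤ ENNReal.ofReal (1 / 4) := by
    have h1 := mul_meas_ge_le_lintegral (μ := ν)
      (f := fun p : ℝ × ℝ => ENNReal.ofReal ((p.2 - p.1 + -(s.2 - s.1)) ^ 2)) (by fun_prop)
      (ENNReal.ofReal (4 * σ ^ 2 * n))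
    rw [h.lintegral_slope_sq n s] at h1
    have h2 : (s.2 - s.1 + -(s.2 - s.1)) ^ 2 + n * σ ^ 2 = 4 * σ ^ 2 * n * (1 / 4) := by ring
    rw [h2, ENNReal.ofReal_mul (p := 4 * σ ^ 2 * n) (q := 1 / 4) (by positivity)] at h1
    exact (ENNReal.mul_le_mul_iff_right (by simp; positivity) ENNReal.ofReal_ne_top).1 h1
  calc ν _ ≤ ν (A ∪ B) := measure_mono hsub
    _ ≤ ν A + ν B := measure_union_le _ _
    _ ≤ ENNReal.ofReal (1 / 4) + ENNReal.ofReal (1 / 4) := add_le_add hA hB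
    _ = _ := by rw [← ENNReal.ofReal_add (by norm_num) (by norm_num)]; norm_num

/-- If the mean height is not too large, the walk is negative with uniformly positive
probability. -/
lemma walkLaw_pos_le (h : IsStepDensity E σ M) : ∃ κ p : ℝ, 0 < κ ∧ 0 < p ∧ p ≤ 1 ∧
    ∀ n : ℕ, 2 ≤ n → ∀ s : ℝ × ℝ, |s.2 + n * (s.2 - s.1)| ≤ κ * (n * Real.sqrt n) →
      walkLaw E n s {q | 0 < q.2} ≤ ENNReal.ofReal (1 - p) := by
  obtain ⟨κ, hκ, hball⟩ := h.walkLaw_small_ball_le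
  have hσ := h.sigma_pos
  have main : ∀ n : ℕ, 2 ≤ n → ∀ s : ℝ × ℝ, |s.2 + n * (s.2 - s.1)| ≤ κ / 16 * (n * Real.sqrt n) →
      κ ^ 2 / (32 * σ ^ 2) ≤ (walkLaw E n s).real {q | q.2 ≤ 0} := by
    intro n hn s hs
    have := h.walkLaw_isProbabilityMeasure n s
    have hn0 : (0 : ℝ) < n := by exact_mod_cast (by omega : 0 < n)
    obtain ⟨v, hv0, hv, hmom⟩ := h.lintegral_height_sq n s
    have hb := hball n hn s
    set ν := walkLaw E n s
    set μ := s.2 + n * (s.2 - s.1) with hμ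
    set R : ℝ := n * Real.sqrt n with hR
    have hR0 : 0 < R := by positivity
    have hR2 : R ^ 2 = n ^ 3 := by rw [hR, mul_pow, Real.sq_sqrt hn0.le]; ring
    have hmom' : ∀ γ : ℝ, ∫⁻ p, ENNReal.ofReal ((p.2 - μ + γ) ^ 2) ∂ν
        = ENNReal.ofReal (γ ^ 2 + v) := fun γ => by
      have := hmom (-μ + γ)
      rw [show (μ + (-μ + γ)) ^ 2 + v = γ ^ 2 + v by ring] at this
      rw [← this]
      refine lintegral_congr fun p => ?_
      ring_nf
    have hint : ∀ γ : ℝ, Integrable (fun p : ℝ × ℝ => (p.2 - μ + γ) ^ 2) ν := fun γ =>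
      ⟨Measurable.aestronglyMeasurable (by fun_prop), by
        rw [hasFiniteIntegral_iff_ofReal (.of_forall fun p => sq_nonneg _), hmom' γ]
        exact ENNReal.ofReal_lt_top⟩
    have hval : ∀ γ : ℝ, ∫ p, (p.2 - μ + γ) ^ 2 ∂ν = γ ^ 2 + v := fun γ => by
      rw [integral_eq_lintegral_of_nonneg_ae (.of_forall fun p => sq_nonneg _)
        (hint γ).aestronglyMeasurable, hmom' γ, ENNReal.toReal_ofReal (by positivity)]
    have hY2 : Integrable (fun p : ℝ × ℝ => (p.2 - μ) ^ 2) ν := by simpa using hint 0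
    have hY2v : ∫ p, (p.2 - μ) ^ 2 ∂ν = v := by simpa using hval 0
    have hYm : Measurable fun p : ℝ × ℝ => p.2 - μ := by fun_prop
    have hY : Integrable (fun p : ℝ × ℝ => p.2 - μ) ν := by
      refine ((integrable_const (1 : ℝ)).add hY2).mono' hYm.aestronglyMeasurable
        (.of_forall fun p => ?_)
      rw [Real.norm_eq_abs, Pi.add_apply, ← sq_abs (p.2 - μ)]
      nlinarith [sq_nonneg (|p.2 - μ| - 1)]
    have hY0 : ∫ p, (p.2 - μ) ∂ν = 0 := by
      have h1 := hval 1
      have e : ∀ p : ℝ × ℝ, (p.2 - μ + 1) ^ 2 = (p.2 - μ) ^ 2 + (2 * (p.2 - μ) + 1) := fun p => by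
        ring
      simp_rw [e] at h1
      have hi : Integrable (fun p : ℝ × ℝ => 2 * (p.2 - μ) + 1) ν :=
        (hY.const_mul 2).add (integrable_const 1)
      rw [integral_add hY2 hi,
        integral_add (hY.const_mul 2) (integrable_const 1), integral_const_mul, hY2v] at h1
      simp only [integral_const, probReal_univ, smul_eq_mul] at h1
      linarith
    -- lower bound for the first absolute moment
    have hAbs : κ * R / 2 ≤ ∫ p, |p.2 - μ| ∂ν := by
      set A := {p : ℝ × ℝ | |p.2 - μ| ≤ κ * R} with hA
      have hAm : MeasurableSet A := measurableSet_le (by fun_prop) (by fun_prop)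
      have hAr : ν.real A ≤ 1 / 2 := by
        rw [measureReal_def]
        exact ENNReal.toReal_le_of_le_ofReal (by norm_num) hb
      have hAc : 1 / 2 ≤ ν.real Aᶜ := by
        rw [probReal_compl_eq_one_sub hAm]; linarith
      calc κ * R / 2 ≤ κ * R * ν.real Aᶜ := by
            have : 0 < κ * R := by positivity
            nlinarith
        _ = ∫ p, Aᶜ.indicator (fun _ => κ * R) p ∂ν := by
            rw [integral_indicator hAm.compl, setIntegral_const, smul_eq_mul, mul_comm]
        _ ≤ _ := by
            refine integral_mono ((integrable_const _).indicator hAm.compl) hY.abs fun p => ?_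
            by_cases hp : p ∈ Aᶜ
            · rw [indicator_of_mem hp]
              exact (not_le.1 (by simpa [hA] using hp)).le
            · rw [indicator_of_notMem hp]; exact abs_nonneg _
    set m := κ * R / 4 with hm
    have hm0 : 0 < m := by positivity
    set t := 2 * σ ^ 2 * R ^ 2 / m with ht
    have ht0 : 0 < t := by positivity
    set B := {q : ℝ × ℝ | q.2 ≤ 0} with hB
    have hBm : MeasurableSet B := measurableSet_le (by fun_prop) (by fun_prop)
    have hneg : m ≤ |μ| + v / (2 * t) + t / 2 * ν.real B := by
      have hI : Integrable (fun p : ℝ × ℝ => |μ| + (p.2 - μ) ^ 2 / (2 * t)) ν :=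
        (integrable_const _).add (hY2.div_const _)
      calc m ≤ ∫ p, (|p.2 - μ| - (p.2 - μ)) / 2 ∂ν := by
            rw [integral_div, integral_sub hY.abs hY, hY0]
            linarith
        _ ≤ ∫ p, (|μ| + (p.2 - μ) ^ 2 / (2 * t)) + B.indicator (fun _ => t / 2) p ∂ν := by
            refine integral_mono ((hY.abs.sub hY).div_const 2)
              (hI.add ((integrable_const _).indicator hBm)) fun p => ?_
            simp only
            by_cases hp : p ∈ B
            · rw [indicator_of_mem hp]
              have h1 : (|p.2 - μ| - (p.2 - μ)) / 2 ≤ |p.2 - μ| := by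
                linarith [neg_abs_le (p.2 - μ)]
              have h2 : |p.2 - μ| ≤ (p.2 - μ) ^ 2 / (2 * t) + t / 2 := by
                rw [div_add_div _ _ (by positivity) (by norm_num), le_div_iff₀ (by positivity),
                  ← sq_abs (p.2 - μ)]
                nlinarith [sq_nonneg (|p.2 - μ| - t)]
              linarith [abs_nonneg μ]
            · rw [indicator_of_notMem hp]
              have hp' : 0 < p.2 := not_le.1 hp
              have h2 : 0 ≤ (p.2 - μ) ^ 2 / (2 * t) := by positivity
              rcases abs_cases (p.2 - μ) with ⟨h3, _⟩ | ⟨h3, _⟩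
              · rw [h3]; linarith [abs_nonneg μ]
              · rw [h3]; linarith [le_abs_self μ]
        _ = _ := by
            rw [integral_add hI ((integrable_const _).indicator hBm),
              integral_add (integrable_const _) (hY2.div_const _), integral_div, hY2v,
              integral_indicator hBm, setIntegral_const]
            simp [mul_comm]
    have hvt : v / (2 * t) ≤ m / 4 := by
      rw [ht, div_le_iff₀ (by positivity)]
      have : m / 4 * (2 * (2 * σ ^ 2 * R ^ 2 / m)) = R ^ 2 * σ ^ 2 := by field_simp; norm_num
      rw [this, hR2]
      exact hv
    have hμm : |μ| ≤ m / 4 := by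
      refine hs.trans (le_of_eq ?_)
      rw [hm]; ring
    have hfin : m / 2 ≤ t / 2 * ν.real B := by linarith
    have e : κ ^ 2 / (32 * σ ^ 2) = m / t := by
      rw [ht, hm]; field_simp; norm_num
    rw [e, div_le_iff₀ ht0]
    linarith
  refine ⟨κ / 16, min 1 (κ ^ 2 / (32 * σ ^ 2)), by positivity, by positivity, min_le_left _ _,
    fun n hn s hs => ?_⟩
  have := h.walkLaw_isProbabilityMeasure n s
  have h1 := main n hn s hs
  have hBm : MeasurableSet {q : ℝ × ℝ | q.2 ≤ 0} := measurableSet_le (by fun_prop) (by fun_prop)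
  have e : {q : ℝ × ℝ | 0 < q.2} = {q : ℝ × ℝ | q.2 ≤ 0}ᶜ := by ext q; simp
  rw [e, ← ofReal_measureReal, probReal_compl_eq_one_sub hBm]
  refine ENNReal.ofReal_le_ofReal ?_
  linarith [min_le_right 1 (κ ^ 2 / (32 * σ ^ 2))]

end IsStepDensity

/-- Transition to a strictly positive height, with density. -/
def stepPos (E : ℝ → ℝ) (f : ℝ × ℝ → ℝ≥0∞) (s : ℝ × ℝ) : ℝ≥0∞ :=
  ∫⁻ w in Ioi 0, eDens E (w + s.1 - 2 * s.2) * f (s.2, w)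

/-- Transition to height `0`, followed by `c` evaluated at the previous height. -/
def stepZero (E : ℝ → ℝ) (c : ℝ → ℝ≥0∞) (s : ℝ × ℝ) : ℝ≥0∞ :=
  eDens E (s.1 - 2 * s.2) * c s.2

lemma stepPos_mono (E : ℝ → ℝ) : Monotone (stepPos E) := fun _ _ hfg _ =>
  lintegral_mono fun _ => mul_le_mul_right (hfg _) _

lemma stepPos_congr_pos {E : ℝ → ℝ} {f g : ℝ × ℝ → ℝ≥0∞} (hfg : ∀ u v, 0 < v → f (u, v) ≤ g (u, v)) :
    stepPos E f ≤ stepPos E g := fun _ =>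
  setLIntegral_mono' measurableSet_Ioi fun w hw => mul_le_mul_right (hfg _ w hw) _

/-- The indicator of positive height. -/
def posRestrict (f : ℝ × ℝ → ℝ≥0∞) : ℝ × ℝ → ℝ≥0∞ := {q : ℝ × ℝ | 0 < q.2}.indicator f

lemma measurable_posRestrict {f : ℝ × ℝ → ℝ≥0∞} (hf : Measurable f) : Measurable (posRestrict f) :=
  hf.indicator (measurableSet_lt measurable_const measurable_snd)

namespace IsStepDensity

variable {E : ℝ → ℝ} {σ M : ℝ}

lemma measurable_stepPos (h : IsStepDensity E σ M) {f : ℝ × ℝ → ℝ≥0∞} (hf : Measurable f) :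
    Measurable (stepPos E f) := by
  have hE := h.measurable_eDens
  exact Measurable.lintegral_prod_right' (f := fun p : (ℝ × ℝ) × ℝ =>
    eDens E (p.2 + p.1.1 - 2 * p.1.2) * f (p.1.2, p.2)) (by fun_prop)

lemma measurable_iterate_stepPos (h : IsStepDensity E σ M) {f : ℝ × ℝ → ℝ≥0∞} (hf : Measurable f)
    (n : ℕ) : Measurable ((stepPos E)^[n] f) := by
  induction n with
  | zero => exact hf
  | succ n ih => rw [Function.iterate_succ_apply']; exact h.measurable_stepPos ih

lemma measurable_stepZero (h : IsStepDensity E σ M) {c : ℝ → ℝ≥0∞} (hc : Measurable c) :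
    Measurable (stepZero E c) := by
  have hE := h.measurable_eDens
  unfold stepZero
  fun_prop

lemma freeStep_eq (h : IsStepDensity E σ M) {f : ℝ × ℝ → ℝ≥0∞} (hf : Measurable f) (s : ℝ × ℝ) :
    freeStep E f s = ∫⁻ w, eDens E (w + s.1 - 2 * s.2) * f (s.2, w) := by
  have hE := h.measurable_eDens
  rw [freeStep, h.lintegral_stepLaw (by fun_prop), ← lintegral_add_left_eq_self
    (fun w => eDens E (w + s.1 - 2 * s.2) * f (s.2, w)) (2 * s.2 - s.1)]
  refine lintegral_congr fun x => ?_
  ring_nf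

lemma stepPos_le_freeStep (h : IsStepDensity E σ M) {f : ℝ × ℝ → ℝ≥0∞} (hf : Measurable f) :
    stepPos E f ≤ freeStep E f := fun s => by
  rw [h.freeStep_eq hf]
  exact setLIntegral_le_lintegral _ _

lemma iterate_stepPos_le_walkLaw (h : IsStepDensity E σ M) {f : ℝ × ℝ → ℝ≥0∞} (hf : Measurable f)
    {n : ℕ} (hn : n ≠ 0) (s : ℝ × ℝ) :
    (stepPos E)^[n] f s ≤ ∫⁻ p, posRestrict f p ∂(walkLaw E n s) := by
  have key : ∀ (n : ℕ) {f : ℝ × ℝ → ℝ≥0∞} (_ : Measurable f),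
      (stepPos E)^[n] f s ≤ ∫⁻ p, f p ∂(walkLaw E n s) := by
    intro n
    induction n with
    | zero => intro f hf; rw [walkLaw, lintegral_dirac' _ hf]; rfl
    | succ n ih =>
      intro f hf
      rw [Function.iterate_succ_apply, h.lintegral_walkLaw_succ n s hf]
      exact (ih (h.measurable_stepPos hf)).trans (lintegral_mono (h.stepPos_le_freeStep hf))
  obtain ⟨m, rfl⟩ := Nat.exists_eq_succ_of_ne_zero hn
  refine le_trans ?_ (key _ (measurable_posRestrict hf))
  rw [Nat.succ_eq_add_one, Function.iterate_succ_apply, Function.iterate_succ_apply]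
  refine (stepPos_mono E).iterate m (stepPos_congr_pos fun u v hv => le_of_eq ?_) s
  rw [posRestrict, indicator_of_mem]
  exact hv

lemma stepPos_one_le (h : IsStepDensity E σ M) : stepPos E (fun _ => 1) ≤ fun _ => 1 := fun s => by
  refine (h.stepPos_le_freeStep measurable_const s).trans ?_
  have := h.isProbabilityMeasure
  simp [freeStep]

lemma stepPos_const_mul (h : IsStepDensity E σ M) (a : ℝ≥0∞) {f : ℝ × ℝ → ℝ≥0∞}
    (hf : Measurable f) : stepPos E (fun p => a * f p) = fun p => a * stepPos E f p := by
  funext s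
  have hE := h.measurable_eDens
  simp only [stepPos]
  rw [← lintegral_const_mul _ (by fun_prop)]
  refine lintegral_congr fun w => ?_
  ring

lemma iterate_stepPos_const_mul (h : IsStepDensity E σ M) (a : ℝ≥0∞) {f : ℝ × ℝ → ℝ≥0∞}
    (hf : Measurable f) (n : ℕ) :
    (stepPos E)^[n] (fun p => a * f p) = fun p => a * (stepPos E)^[n] f p := by
  induction n with
  | zero => rfl
  | succ n ih =>
    rw [Function.iterate_succ_apply', ih, h.stepPos_const_mul a (h.measurable_iterate_stepPos hf n),
      Function.iterate_succ_apply']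

lemma iterate_stepPos_one_anti (h : IsStepDensity E σ M) {m n : ℕ} (hmn : m ≤ n) :
    (stepPos E)^[n] (fun _ => 1) ≤ (stepPos E)^[m] (fun _ => 1) := by
  obtain ⟨k, rfl⟩ := Nat.exists_eq_add_of_le hmn
  rw [Function.iterate_add_apply]
  refine (stepPos_mono E).iterate m ?_
  induction k with
  | zero => exact le_rfl
  | succ k ih =>
    rw [Function.iterate_succ_apply']
    exact (stepPos_mono E (ih (by omega))).trans h.stepPos_one_le

end IsStepDensity

/-- Lyapunov function at time scale `T`. -/
def lyap (c T : ℝ) (s : ℝ × ℝ) : ℝ := 1 + c * ((s.2 - s.1) ^ 2 / T + s.2 ^ 2 / T ^ 3)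

namespace IsStepDensity

variable {E : ℝ → ℝ} {σ M : ℝ}

lemma measurable_lyap (c T : ℝ) : Measurable (lyap c T) := by unfold lyap; fun_prop

lemma lintegral_lyap_le (h : IsStepDensity E σ M) {c : ℝ} (hc : 0 < c) {n : ℕ} (hn : 0 < n)
    (s : ℝ × ℝ) :
    ∫⁻ p, posRestrict (fun q => ENNReal.ofReal (lyap c n q)) p ∂(walkLaw E n s)
      ≤ walkLaw E n s {q | 0 < q.2} + ENNReal.ofReal (2 * c * σ ^ 2 +
        3 * (c * ((s.2 - s.1) ^ 2 / n + s.2 ^ 2 / n ^ 3))) := by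
  have hn0 : (0 : ℝ) < n := by exact_mod_cast hn
  have hpm : MeasurableSet {q : ℝ × ℝ | 0 < q.2} := measurableSet_lt measurable_const measurable_snd
  obtain ⟨v, hv0, hv, hmom⟩ := h.lintegral_height_sq n s
  have hm0 := hmom 0
  have hs0 := h.lintegral_slope_sq n s 0
  simp only [add_zero] at hm0 hs0
  have hpt : ∀ p, posRestrict (fun q => ENNReal.ofReal (lyap c n q)) p
      ≤ {q : ℝ × ℝ | 0 < q.2}.indicator 1 p + (ENNReal.ofReal (c / n) * ENNReal.ofReal ((p.2 - p.1) ^ 2)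
        + ENNReal.ofReal (c / n ^ 3) * ENNReal.ofReal (p.2 ^ 2)) := by
    intro p
    by_cases hp : p ∈ {q : ℝ × ℝ | 0 < q.2}
    · rw [posRestrict, indicator_of_mem hp, indicator_of_mem hp, ← ENNReal.ofReal_mul (by positivity),
        ← ENNReal.ofReal_mul (by positivity), ← ENNReal.ofReal_add (by positivity) (by positivity),
        Pi.one_apply, ← ENNReal.ofReal_one, ← ENNReal.ofReal_add zero_le_one (by positivity)]
      refine ENNReal.ofReal_le_ofReal (le_of_eq ?_)
      rw [lyap]
      ring
    · rw [posRestrict, indicator_of_notMem hp]; exact zero_le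
  refine (lintegral_mono hpt).trans ?_
  rw [lintegral_add_left (measurable_one.indicator hpm), lintegral_indicator_one hpm,
    lintegral_add_left (by fun_prop), lintegral_const_mul _ (by fun_prop),
    lintegral_const_mul _ (by fun_prop), hm0, hs0, ← ENNReal.ofReal_mul (by positivity),
    ← ENNReal.ofReal_mul (by positivity), ← ENNReal.ofReal_add (by positivity) (by positivity)]
  refine add_le_add le_rfl (ENNReal.ofReal_le_ofReal ?_)
  have h1 : c / n * ((s.2 - s.1) ^ 2 + n * σ ^ 2) = c * (s.2 - s.1) ^ 2 / n + c * σ ^ 2 := by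
    field_simp
  have h2 : c / n ^ 3 * ((s.2 + n * (s.2 - s.1)) ^ 2 + v)
      ≤ 2 * (c * s.2 ^ 2 / n ^ 3) + 2 * (c * (s.2 - s.1) ^ 2 / n) + c * σ ^ 2 := by
    have e : 2 * (c * s.2 ^ 2 / n ^ 3) + 2 * (c * (s.2 - s.1) ^ 2 / n) + c * σ ^ 2
        = c / n ^ 3 * ((2 * s.2 ^ 2 + 2 * (n * (s.2 - s.1)) ^ 2) + n ^ 3 * σ ^ 2) := by
      field_simp
    rw [e]
    gcongr
    nlinarith [sq_nonneg (s.2 - n * (s.2 - s.1))]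
  have h3 : 0 ≤ c * s.2 ^ 2 / n ^ 3 := by positivity
  calc _ ≤ c * (s.2 - s.1) ^ 2 / n + c * σ ^ 2 + (2 * (c * s.2 ^ 2 / n ^ 3)
        + 2 * (c * (s.2 - s.1) ^ 2 / n) + c * σ ^ 2) := by rw [h1]; gcongr
    _ ≤ 2 * c * σ ^ 2 + 3 * (c * (s.2 - s.1) ^ 2 / n + c * s.2 ^ 2 / n ^ 3) := by linarith
    _ = _ := by ring

/-- The Lyapunov function contracts when the time scale is multiplied by a large factor. -/
lemma exists_lyap_contraction (h : IsStepDensity E σ M) : ∃ c p : ℝ, ∃ L : ℕ, 0 < c ∧ 0 < p ∧ p ≤ 1 ∧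
    2 ≤ L ∧ ∀ (T : ℕ), 0 < T → ∀ s, (stepPos E)^[L * T] (fun q => ENNReal.ofReal (lyap c (L * T : ℕ) q)) s
      ≤ ENNReal.ofReal (1 - p / 2) * ENNReal.ofReal (lyap c T s) := by
  obtain ⟨κ, p, hκ, hp, hp1, hpos⟩ := h.walkLaw_pos_le
  have hσ := h.sigma_pos
  set c := p / (8 * σ ^ 2) with hcdef
  have hc : 0 < c := by positivity
  obtain ⟨L, hL⟩ := exists_nat_ge (max 24 (8 / (c * κ ^ 2)))
  have hL1 : (24 : ℝ) ≤ L := (le_max_left _ _).trans hL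
  have hL2 : 8 / (c * κ ^ 2) ≤ L := (le_max_right _ _).trans hL
  have hL24 : 24 ≤ L := by exact_mod_cast hL1
  refine ⟨c, p, L, hc, hp, hp1, by omega, fun T hT s => ?_⟩
  have hT0 : (0 : ℝ) < T := by exact_mod_cast hT
  have hLT : 2 ≤ L * T := by nlinarith
  have hn0 : (0 : ℝ) < (L * T : ℕ) := by exact_mod_cast (by omega : 0 < L * T)
  refine (h.iterate_stepPos_le_walkLaw (measurable_lyap c _).ennreal_ofReal (by omega) s).trans ?_
  refine (h.lintegral_lyap_le hc (by omega) s).trans ?_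
  have := h.walkLaw_isProbabilityMeasure (L * T) s
  set Q := c * ((s.2 - s.1) ^ 2 / T + s.2 ^ 2 / T ^ 3) with hQ
  have hQ0 : 0 ≤ Q := by positivity
  have hlyap : lyap c T s = 1 + Q := rfl
  have hcoef : 2 * c * σ ^ 2 = p / 4 := by rw [hcdef]; field_simp; norm_num
  have hQ' : 3 * (c * ((s.2 - s.1) ^ 2 / (L * T : ℕ) + s.2 ^ 2 / (L * T : ℕ) ^ 3)) ≤ Q / 8 := by
    have e1 : (s.2 - s.1) ^ 2 / ((L * T : ℕ) : ℝ) ≤ (s.2 - s.1) ^ 2 / T / 24 := by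
      rw [div_div]
      exact div_le_div_of_nonneg_left (sq_nonneg _) (by positivity) (by push_cast; nlinarith)
    have e2 : s.2 ^ 2 / ((L * T : ℕ) : ℝ) ^ 3 ≤ s.2 ^ 2 / T ^ 3 / 24 := by
      rw [div_div]
      refine div_le_div_of_nonneg_left (sq_nonneg _) (by positivity) ?_
      have hL3 : (24 : ℝ) ≤ (L : ℝ) ^ 3 := hL1.trans (le_self_pow₀ (by linarith) (by norm_num))
      push_cast
      rw [mul_pow, mul_comm]
      exact mul_le_mul_of_nonneg_right hL3 (by positivity)
    calc _ ≤ 3 * (c * ((s.2 - s.1) ^ 2 / T / 24 + s.2 ^ 2 / T ^ 3 / 24)) := by gcongr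
      _ = Q / 8 := by rw [hQ]; ring
  rw [hlyap, ← ENNReal.ofReal_mul (by linarith)]
  have hfin : ∀ x : ℝ, 0 ≤ x → walkLaw E (L * T) s {q | 0 < q.2} ≤ ENNReal.ofReal x →
      x + p / 4 + Q / 8 ≤ (1 - p / 2) * (1 + Q) →
      walkLaw E (L * T) s {q | 0 < q.2} + ENNReal.ofReal (2 * c * σ ^ 2 +
        3 * (c * ((s.2 - s.1) ^ 2 / (L * T : ℕ) + s.2 ^ 2 / (L * T : ℕ) ^ 3)))
      ≤ ENNReal.ofReal ((1 - p / 2) * (1 + Q)) := by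
    intro x hx0 hx hxQ
    refine (add_le_add_left hx _).trans ?_
    rw [← ENNReal.ofReal_add hx0 (by positivity)]
    refine ENNReal.ofReal_le_ofReal ?_
    linarith
  rcases le_or_gt 2 Q with h2 | h2
  · refine hfin 1 zero_le_one (by simpa using prob_le_one) ?_
    nlinarith
  · refine hfin (1 - p) (by linarith) (hpos (L * T) hLT s ?_) (by nlinarith)
    set n : ℝ := ((L * T : ℕ) : ℝ) with hn
    have hnL : n = L * T := by rw [hn]; push_cast; ring
    refine abs_le_of_sq_le_sq ?_ (by positivity)
    have e0 : (κ * (n * Real.sqrt n)) ^ 2 = κ ^ 2 * n ^ 3 := by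
      rw [mul_pow, mul_pow, Real.sq_sqrt hn0.le]; ring
    rw [e0]
    have ha : (s.2 - s.1) ^ 2 ≤ 2 * T / c := by
      have h3 : c * ((s.2 - s.1) ^ 2 / T) ≤ 2 := by
        have : 0 ≤ c * (s.2 ^ 2 / T ^ 3) := by positivity
        rw [hQ, mul_add] at h2
        linarith
      rw [le_div_iff₀ hc]
      rw [← mul_div_assoc, div_le_iff₀ hT0] at h3
      linarith
    have hv : s.2 ^ 2 ≤ 2 * T ^ 3 / c := by
      have h3 : c * (s.2 ^ 2 / T ^ 3) ≤ 2 := by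
        have : 0 ≤ c * ((s.2 - s.1) ^ 2 / T) := by positivity
        rw [hQ, mul_add] at h2
        linarith
      rw [le_div_iff₀ hc]
      rw [← mul_div_assoc, div_le_iff₀ (by positivity)] at h3
      linarith
    calc (s.2 + n * (s.2 - s.1)) ^ 2 ≤ 2 * s.2 ^ 2 + 2 * n ^ 2 * (s.2 - s.1) ^ 2 := by
          nlinarith [sq_nonneg (s.2 - n * (s.2 - s.1))]
      _ ≤ 2 * (2 * T ^ 3 / c) + 2 * n ^ 2 * (2 * T / c) := by gcongr
      _ = 4 / c * T ^ 3 * (1 + L ^ 2) := by rw [hnL]; ring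
      _ ≤ 4 / c * T ^ 3 * (2 * L ^ 2) := by gcongr; nlinarith
      _ = 8 / c * L ^ 2 * T ^ 3 := by ring
      _ ≤ κ ^ 2 * L * L ^ 2 * T ^ 3 := by
          gcongr
          rw [div_le_iff₀ (by positivity)] at hL2 ⊢
          linarith
      _ = κ ^ 2 * n ^ 3 := by rw [hnL]; ring

end IsStepDensity

namespace IsStepDensity

variable {E : ℝ → ℝ} {σ M : ℝ}

lemma iterate_stepPos_const_le (h : IsStepDensity E σ M) (a : ℝ≥0∞) (n : ℕ) (s : ℝ × ℝ) :
    (stepPos E)^[n] (fun _ => a) s ≤ a * (stepPos E)^[n] (fun _ => 1) s := by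
  have := congrFun (h.iterate_stepPos_const_mul a (f := fun _ => 1) measurable_const n) s
  simp only [mul_one] at this
  exact this.le

lemma iterate_stepPos_one_le (h : IsStepDensity E σ M) (n : ℕ) (s : ℝ × ℝ) :
    (stepPos E)^[n] (fun _ => 1) s ≤ 1 :=
  h.iterate_stepPos_one_anti (Nat.zero_le n) s

/-- Polynomial decay of the survival probability, with a subquadratic dependence on the start. -/
lemma exists_survival_le_sq (h : IsStepDensity E σ M) : ∃ C δ : ℝ, 0 < C ∧ 0 < δ ∧
    ∀ n : ℕ, 0 < n → ∀ w : ℝ, 0 ≤ w → (stepPos E)^[n] (fun _ => 1) (0, w) ≤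
      ENNReal.ofReal (C * (1 + w) ^ 2 * (n : ℝ) ^ (-δ)) := by
  obtain ⟨c, p, L, hc, hp, hp1, hL, hcon⟩ := h.exists_lyap_contraction
  set q : ℝ := 1 - p / 2 with hq
  have hq0 : 0 < q := by linarith
  have hq1 : q < 1 := by linarith
  have hL1 : (1 : ℝ) < L := by exact_mod_cast (by omega : 1 < L)
  have hlogL : 0 < Real.log L := Real.log_pos hL1
  have hlogq : Real.log q < 0 := Real.log_neg hq0 hq1
  have iter : ∀ K : ℕ, ∃ N ≤ L ^ (K + 1), ∀ s,
      (stepPos E)^[N] (fun t => ENNReal.ofReal (lyap c (L ^ K : ℕ) t)) s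
        ≤ ENNReal.ofReal (q ^ K) * ENNReal.ofReal (lyap c 1 s) := by
    intro K
    induction K with
    | zero => exact ⟨0, Nat.zero_le _, fun s => by simp⟩
    | succ K ih =>
      obtain ⟨N, hN, hs⟩ := ih
      refine ⟨N + L * L ^ K, ?_, fun s => ?_⟩
      · have : L ^ (K + 1) * 2 ≤ L ^ (K + 1) * L := Nat.mul_le_mul_left _ hL
        rw [pow_succ L (K + 1), mul_comm L (L ^ K), ← pow_succ]
        omega
      · rw [Function.iterate_add_apply, pow_succ' L K]
        refine ((stepPos_mono E).iterate N (hcon (L ^ K) (by positivity)) s).trans ?_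
        rw [h.iterate_stepPos_const_mul _ (measurable_lyap c _).ennreal_ofReal, pow_succ',
          ENNReal.ofReal_mul hq0.le, mul_assoc]
        exact mul_le_mul_right (hs s) _
  set δ := -Real.log q / Real.log L with hδ
  have hδ0 : 0 < δ := div_pos (by linarith) hlogL
  have hqK : ∀ K : ℕ, q ^ K = ((L : ℝ) ^ K) ^ (-δ) := by
    intro K
    rw [← Real.rpow_natCast, ← Real.rpow_natCast, ← Real.rpow_mul (by positivity),
      Real.rpow_def_of_pos hq0, Real.rpow_def_of_pos (by positivity), hδ]
    congr 1
    field_simp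
  refine ⟨q⁻¹ ^ 2 * (1 + 2 * c), δ, by positivity, hδ0, fun n hn w hw => ?_⟩
  set K := Nat.log L n with hK
  have hnK : q ^ (K + 1) ≤ (n : ℝ) ^ (-δ) := by
    rw [hqK]
    refine Real.rpow_le_rpow_of_nonpos (by exact_mod_cast hn) ?_ (by linarith)
    exact_mod_cast (Nat.lt_pow_succ_log_self (by omega) n).le
  have hw2 : 1 + 2 * c * w ^ 2 ≤ (1 + 2 * c) * (1 + w) ^ 2 := by
    have : 0 ≤ c * w := by positivity
    nlinarith
  rcases Nat.eq_zero_or_pos K with h0 | h0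
  · refine (h.iterate_stepPos_one_le n _).trans ?_
    rw [← ENNReal.ofReal_one]
    refine ENNReal.ofReal_le_ofReal ?_
    rw [h0, zero_add, pow_one] at hnK
    have hw1 : 1 ≤ (1 + 2 * c) * (1 + w) ^ 2 := le_trans (by nlinarith [sq_nonneg w]) hw2
    calc (1 : ℝ) ≤ q⁻¹ := (one_le_inv₀ hq0).2 hq1.le
      _ = q⁻¹ ^ 2 * 1 * q := by field_simp
      _ ≤ q⁻¹ ^ 2 * ((1 + 2 * c) * (1 + w) ^ 2) * (n : ℝ) ^ (-δ) := by gcongr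
      _ = _ := by ring
  · obtain ⟨k, hk⟩ := Nat.exists_eq_succ_of_ne_zero h0.ne'
    obtain ⟨N, hN, hs⟩ := iter k
    have hNn : N ≤ n := hN.trans (by
      have := Nat.pow_log_le_self L hn.ne'
      rwa [← hK, hk] at this)
    refine (h.iterate_stepPos_one_anti hNn _).trans ?_
    refine ((stepPos_mono E).iterate N (fun t => ?_) _).trans ((hs _).trans ?_)
    · rw [← ENNReal.ofReal_one]
      refine ENNReal.ofReal_le_ofReal ?_
      rw [lyap, le_add_iff_nonneg_right]
      positivity
    · rw [← ENNReal.ofReal_mul (by positivity)]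
      refine ENNReal.ofReal_le_ofReal ?_
      have hly : lyap c 1 (0, w) = 1 + 2 * c * w ^ 2 := by simp only [lyap]; ring
      rw [hly]
      calc q ^ k * (1 + 2 * c * w ^ 2) = q⁻¹ ^ 2 * (1 + 2 * c * w ^ 2) * q ^ (K + 1) := by
            rw [hk]; field_simp; rw [← pow_add]
        _ ≤ q⁻¹ ^ 2 * ((1 + 2 * c) * (1 + w) ^ 2) * (n : ℝ) ^ (-δ) := by gcongr
        _ = _ := by ring

lemma exists_survival_le (h : IsStepDensity E σ M) : ∃ C δ : ℝ, 0 < C ∧ 0 < δ ∧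
    ∀ n : ℕ, 0 < n → ∀ w : ℝ, 0 ≤ w → (stepPos E)^[n] (fun _ => 1) (0, w) ≤
      ENNReal.ofReal (C * (1 + w) ^ (1 / 4 : ℝ) * (n : ℝ) ^ (-δ)) := by
  obtain ⟨C, δ, hC, hδ, hS⟩ := h.exists_survival_le_sq
  refine ⟨C ^ (1 / 8 : ℝ), δ / 8, by positivity, by positivity, fun n hn w hw => ?_⟩
  have hn0 : (0 : ℝ) < n := by exact_mod_cast hn
  set X := C * (1 + w) ^ 2 * (n : ℝ) ^ (-δ) with hX
  have hX0 : 0 ≤ X := by positivity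
  have e : C ^ (1 / 8 : ℝ) * (1 + w) ^ (1 / 4 : ℝ) * (n : ℝ) ^ (-(δ / 8)) = X ^ (1 / 8 : ℝ) := by
    rw [hX, Real.mul_rpow (by positivity) (by positivity), Real.mul_rpow (by positivity) (by positivity),
      ← Real.rpow_natCast (1 + w) 2, ← Real.rpow_mul (by positivity), ← Real.rpow_mul hn0.le]
    congr 2 <;> norm_num
    ring
  rw [e]
  rcases le_total X 1 with h1 | h1
  · exact (hS n hn w hw).trans (ENNReal.ofReal_le_ofReal
      (by simpa using Real.rpow_le_rpow_of_exponent_ge' hX0 h1 (by norm_num) (by norm_num : (1 / 8 : ℝ) ≤ 1)))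
  · refine (h.iterate_stepPos_one_le n _).trans ?_
    rw [← ENNReal.ofReal_one]
    exact ENNReal.ofReal_le_ofReal (Real.one_le_rpow h1 (by norm_num))

lemma lintegral_posRestrict_stepZero (h : IsStepDensity E σ M) {c : ℝ → ℝ≥0∞} (hc : Measurable c) :
    ∫⁻ p, posRestrict (stepZero E c) p = ∫⁻ x in Ioi 0, c x := by
  have hE := h.measurable_eDens
  rw [Measure.volume_eq_prod, lintegral_prod_symm' _ (measurable_posRestrict (h.measurable_stepZero hc)),
    ← lintegral_indicator measurableSet_Ioi]
  refine lintegral_congr fun v => ?_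
  by_cases hv : 0 < v
  · simp only [posRestrict, indicator, mem_ofPred_eq, mem_Ioi, hv, if_true, stepZero]
    rw [lintegral_mul_const _ (by fun_prop)]
    rw [lintegral_sub_right_eq_self (fun u => eDens E u) (2 * v), h.lintegral_eDens, one_mul]
  · simp [posRestrict, indicator, hv]

lemma exists_iterate_stepPos_stepZero_le (h : IsStepDensity E σ M) : ∃ C : ℝ, 0 < C ∧
    ∀ b : ℕ, 0 < b → ∀ (c : ℝ → ℝ≥0∞), Measurable c → ∀ s, (stepPos E)^[b] (stepZero E c) s ≤
      ENNReal.ofReal (C / b ^ 2) * ∫⁻ x in Ioi 0, c x := by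
  obtain ⟨C, hC, hK⟩ := h.exists_lintegral_walkLaw_le
  have hM := h.bound_pos
  have hE := h.measurable_eDens
  refine ⟨max C (M ^ 2), by positivity, fun b hb c hc s => ?_⟩
  rcases Nat.lt_or_ge 1 b with h2 | h1
  · refine (h.iterate_stepPos_le_walkLaw (h.measurable_stepZero hc) hb.ne' s).trans ?_
    refine (hK b h2 s _ (measurable_posRestrict (h.measurable_stepZero hc))).trans ?_
    rw [h.lintegral_posRestrict_stepZero hc]
    gcongr
    exact le_max_left _ _
  · obtain rfl : b = 1 := by omega
    rw [Function.iterate_one, stepPos, ← lintegral_const_mul _ hc]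
    refine lintegral_mono fun w => ?_
    rw [stepZero, ← mul_assoc]
    gcongr
    calc _ ≤ ENNReal.ofReal M * ENNReal.ofReal M := mul_le_mul' (h.eDens_le _) (h.eDens_le _)
      _ = ENNReal.ofReal (M ^ 2) := by rw [← ENNReal.ofReal_mul hM.le, sq]
      _ ≤ _ := ENNReal.ofReal_le_ofReal (by simp)

/-- A positive excursion of length `k` costs `k ^ (-2 - δ)`. -/
lemma exists_excursion_le (h : IsStepDensity E σ M) : ∃ C δ : ℝ, 0 < C ∧ 0 < δ ∧
    ∀ k : ℕ, 0 < k → ∀ w : ℝ, 0 ≤ w → ∀ (c : ℝ → ℝ≥0∞), Measurable c →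
      (stepPos E)^[k] (stepZero E c) (0, w) ≤
        ENNReal.ofReal (C * (k : ℝ) ^ (-(2 + δ)) * (1 + w) ^ (1 / 4 : ℝ)) * ∫⁻ x in Ioi 0, c x := by
  obtain ⟨C, hC, hT⟩ := h.exists_iterate_stepPos_stepZero_le
  obtain ⟨D, δ, hD, hδ, hS⟩ := h.exists_survival_le
  refine ⟨max C (4 * C * D * 3 ^ δ), δ, by positivity, hδ, fun k hk w hw c hc => ?_⟩
  rcases Nat.lt_or_ge 1 k with h2 | h1
  · set a := k / 2 with ha
    set b := k - k / 2 with hb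
    have hab : k = a + b := by omega
    have hk0 : (0 : ℝ) < k := by exact_mod_cast hk
    have hb2 : (k : ℝ) / 2 ≤ b := by
      rw [div_le_iff₀ (by norm_num)]; exact_mod_cast (by omega : k ≤ b * 2)
    have ha3 : (k : ℝ) / 3 ≤ a := by
      rw [div_le_iff₀ (by norm_num)]; exact_mod_cast (by omega : k ≤ a * 3)
    have hfirst : (stepPos E)^[k] (stepZero E c) (0, w) ≤ (ENNReal.ofReal (C / b ^ 2) *
        ∫⁻ x in Ioi 0, c x) * ENNReal.ofReal (D * (1 + w) ^ (1 / 4 : ℝ) * (a : ℝ) ^ (-δ)) := by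
      rw [hab, Function.iterate_add_apply]
      refine ((stepPos_mono E).iterate a (fun s => hT b (by omega) c hc s) (0, w)).trans ?_
      exact (h.iterate_stepPos_const_le _ a _).trans (mul_le_mul_right (hS a (by omega) w hw) _)
    refine hfirst.trans ?_
    rw [mul_right_comm, ← ENNReal.ofReal_mul (by positivity)]
    refine mul_le_mul' (ENNReal.ofReal_le_ofReal ?_) le_rfl
    have e1 : C / (b : ℝ) ^ 2 ≤ C / (k / 2) ^ 2 := by gcongr
    have e2 : (a : ℝ) ^ (-δ) ≤ ((k : ℝ) / 3) ^ (-δ) :=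
      Real.rpow_le_rpow_of_nonpos (by positivity) ha3 (by linarith)
    have e3 : ((k : ℝ) / 3) ^ (-δ) = 3 ^ δ * (k : ℝ) ^ (-δ) := by
      rw [Real.div_rpow hk0.le (by norm_num), Real.rpow_neg (by norm_num : (0 : ℝ) ≤ 3)]
      field_simp
    have e4 : (k : ℝ) ^ (-(2 + δ)) = ((k : ℝ) ^ 2)⁻¹ * (k : ℝ) ^ (-δ) := by
      rw [neg_add, Real.rpow_add hk0, Real.rpow_neg hk0.le]
      norm_num
    rw [e3] at e2
    calc _ ≤ C / ((k : ℝ) / 2) ^ 2 * (D * (1 + w) ^ (1 / 4 : ℝ) * (3 ^ δ * (k : ℝ) ^ (-δ))) := by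
          gcongr
      _ = (4 * C * D * 3 ^ δ) * (k : ℝ) ^ (-(2 + δ)) * (1 + w) ^ (1 / 4 : ℝ) := by
          rw [e4]; field_simp; ring
      _ ≤ _ := by gcongr; exact le_max_right _ _
  · obtain rfl : k = 1 := by omega
    refine (hT 1 one_pos c hc _).trans ?_
    gcongr
    have : 1 ≤ (1 + w) ^ (1 / 4 : ℝ) := Real.one_le_rpow (by linarith) (by norm_num)
    simp only [Nat.cast_one, one_pow, div_one, Real.one_rpow, mul_one]
    calc C = C * 1 := by ring
      _ ≤ _ := by gcongr; exact le_max_left _ _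

end IsStepDensity

/-- The weight `√(1 + w)`. -/
def rootWeight (w : ℝ) : ℝ≥0∞ := ENNReal.ofReal ((1 + w) ^ (1 / 2 : ℝ))

/-- Weight of the transitions from `(x, 0)` to a positive height, averaged against `rootWeight`. -/
def tailInt (E : ℝ → ℝ) (x : ℝ) : ℝ≥0∞ := ∫⁻ w in Ioi 0, eDens E (w + x) * rootWeight w

lemma measurable_rootWeight : Measurable rootWeight := by unfold rootWeight; fun_prop

lemma rootWeight_le {x w : ℝ} (hx : 0 ≤ x) (hw : 0 < w) :
    rootWeight w ≤ ENNReal.ofReal (1 + |w + x|) := by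
  refine ENNReal.ofReal_le_ofReal ?_
  rw [abs_of_nonneg (by linarith)]
  calc (1 + w) ^ (1 / 2 : ℝ) ≤ (1 + w) ^ (1 : ℝ) :=
        Real.rpow_le_rpow_of_exponent_le (by linarith) (by norm_num)
    _ ≤ 1 + (w + x) := by rw [Real.rpow_one]; linarith

namespace IsStepDensity

variable {E : ℝ → ℝ} {σ M : ℝ}

lemma measurable_tailInt (h : IsStepDensity E σ M) : Measurable (tailInt E) := by
  have hE := h.measurable_eDens
  have hr := measurable_rootWeight
  exact Measurable.lintegral_prod_right' (f := fun p : ℝ × ℝ =>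
    eDens E (p.2 + p.1) * rootWeight p.2) (by fun_prop)

lemma lintegral_eDens_mul_lt_top (h : IsStepDensity E σ M) :
    ∫⁻ z, eDens E z * ENNReal.ofReal ((1 + |z|) * (1 + |z|)) < ∞ := by
  have hi : Integrable fun z => E z + 2 * |z * E z| + z ^ 2 * E z :=
    (h.integrable.add (h.mom1.abs.const_mul 2)).add h.mom2
  refine lt_of_eq_of_lt (lintegral_congr fun z => ?_) hi.lintegral_lt_top
  rw [eDens, ← ENNReal.ofReal_mul (h.nonneg z), abs_mul, abs_of_nonneg (h.nonneg z)]
  congr 1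
  have := sq_abs z
  linear_combination E z * this

lemma exists_tailInt_le (h : IsStepDensity E σ M) : ∃ B : ℝ≥0∞, B < ∞ ∧
    ∀ x, 0 ≤ x → tailInt E x ≤ B := by
  refine ⟨_, h.lintegral_eDens_mul_lt_top, fun x hx => ?_⟩
  rw [← lintegral_add_right_eq_self (fun z => eDens E z * ENNReal.ofReal ((1 + |z|) * (1 + |z|))) x]
  refine (setLIntegral_mono' measurableSet_Ioi fun w hw => ?_).trans (setLIntegral_le_lintegral _ _)
  refine mul_le_mul_right ((rootWeight_le hx hw).trans (ENNReal.ofReal_le_ofReal ?_)) _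
  nlinarith [abs_nonneg (w + x)]

lemma lintegral_tailInt_lt_top (h : IsStepDensity E σ M) : ∫⁻ x in Ioi 0, tailInt E x < ∞ := by
  have hE := h.measurable_eDens
  refine lt_of_le_of_lt ?_ h.lintegral_eDens_mul_lt_top
  have hm : Measurable fun p : ℝ × ℝ => {p : ℝ × ℝ | 0 < p.1 ∧ p.1 < p.2}.indicator
      (fun p => eDens E p.2 * ENNReal.ofReal (1 + |p.2|)) p :=
    Measurable.indicator (by fun_prop) ((measurableSet_lt measurable_const measurable_fst).inter
      (measurableSet_lt measurable_fst measurable_snd))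
  calc ∫⁻ x in Ioi 0, tailInt E x
      ≤ ∫⁻ x, ∫⁻ z, {p : ℝ × ℝ | 0 < p.1 ∧ p.1 < p.2}.indicator
        (fun p => eDens E p.2 * ENNReal.ofReal (1 + |p.2|)) (x, z) := by
        rw [← lintegral_indicator measurableSet_Ioi]
        refine lintegral_mono fun x => ?_
        by_cases hx : 0 < x
        · rw [indicator_of_mem (mem_Ioi.2 hx), ← lintegral_add_right_eq_self _ x, tailInt,
            ← lintegral_indicator measurableSet_Ioi]
          refine lintegral_mono fun w => ?_
          by_cases hw : 0 < w
          · rw [indicator_of_mem (mem_Ioi.2 hw), indicator_of_mem (by simp [hx, hw])]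
            exact mul_le_mul_right (rootWeight_le hx.le hw) _
          · rw [indicator_of_notMem (by simpa using hw)]; exact zero_le
        · rw [indicator_of_notMem (by simpa using hx)]; exact zero_le
    _ = ∫⁻ z, ∫⁻ x, {p : ℝ × ℝ | 0 < p.1 ∧ p.1 < p.2}.indicator
        (fun p => eDens E p.2 * ENNReal.ofReal (1 + |p.2|)) (x, z) :=
        lintegral_lintegral_swap hm.aemeasurable
    _ ≤ _ := by
        refine lintegral_mono fun z => ?_
        have : ∀ x, {p : ℝ × ℝ | 0 < p.1 ∧ p.1 < p.2}.indicator
            (fun p => eDens E p.2 * ENNReal.ofReal (1 + |p.2|)) (x, z) =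
            (Ioo 0 z).indicator (fun _ => eDens E z * ENNReal.ofReal (1 + |z|)) x := by
          intro x
          simp [indicator]
        simp only [this]
        rw [lintegral_indicator measurableSet_Ioo, setLIntegral_const, Real.volume_Ioo, sub_zero,
          ENNReal.ofReal_mul (by positivity), mul_assoc]
        refine mul_le_mul_right (mul_le_mul_right (ENNReal.ofReal_le_ofReal ?_) _) _
        linarith [le_abs_self z]

lemma exists_lintegral_tailInt_le (h : IsStepDensity E σ M) {τ : ℝ≥0∞} (hτ : 0 < τ) :
    ∃ Y₀ : ℝ, ∀ Y, Y₀ ≤ Y → ∫⁻ x in Ioi Y, tailInt E x ≤ τ := by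
  set μ := (volume.restrict (Ioi 0)).withDensity (tailInt E) with hμ
  have hfin : μ univ ≠ ∞ := by
    rw [hμ, withDensity_apply _ MeasurableSet.univ, Measure.restrict_univ]
    exact h.lintegral_tailInt_lt_top.ne
  have htend := tendsto_measure_iInter_atTop (μ := μ) (s := fun n : ℕ => Ioi (n : ℝ))
    (fun n => measurableSet_Ioi.nullMeasurableSet)
    (fun m n hmn => Ioi_subset_Ioi (by exact_mod_cast hmn))
    ⟨0, ne_top_of_le_ne_top hfin (measure_mono (subset_univ _))⟩
  have hempty : ⋂ n : ℕ, Ioi (n : ℝ) = ∅ := by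
    ext x
    simp only [mem_iInter, mem_Ioi, mem_empty_iff_false, iff_false, not_forall, not_lt]
    exact exists_nat_ge x
  rw [hempty, measure_empty] at htend
  obtain ⟨n, hn⟩ := (htend.eventually (gt_mem_nhds hτ)).exists
  refine ⟨n, fun Y hY => le_trans ?_ hn.le⟩
  have hn0 : (0 : ℝ) ≤ n := by positivity
  rw [Function.comp_apply, hμ, withDensity_apply _ measurableSet_Ioi, Measure.restrict_restrict measurableSet_Ioi,
    inter_eq_left.2 (Ioi_subset_Ioi hn0)]
  exact lintegral_mono_set (Ioi_subset_Ioi hY)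

end IsStepDensity

/-- One step of the wetting transfer operator, with weight `e` for a contact. -/
def step (E : ℝ → ℝ) (e : ℝ≥0∞) (f : ℝ × ℝ → ℝ≥0∞) (s : ℝ × ℝ) : ℝ≥0∞ :=
  e * stepZero E (fun x => f (x, 0)) s + stepPos E f s

lemma step_mono (E : ℝ → ℝ) (e : ℝ≥0∞) : Monotone (step E e) := fun _ _ hfg s =>
  add_le_add (mul_le_mul_right (mul_le_mul_right (hfg _) _) _) (stepPos_mono E hfg s)

/-- Solution of the renewal equation `δ n = A * r n + ∑ j < n, η * r (n - j) * δ j`. -/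
def renewalSeq (A η : ℝ≥0∞) (r : ℕ → ℝ≥0∞) : ℕ → ℝ≥0∞
  | n => A * r n + ∑ j : Fin n, η * r (n - j) * renewalSeq A η r j

lemma renewalSeq_eq (A η : ℝ≥0∞) (r : ℕ → ℝ≥0∞) (n : ℕ) :
    renewalSeq A η r n = A * r n + ∑ j ∈ Finset.range n, η * r (n - j) * renewalSeq A η r j := by
  rw [renewalSeq, Finset.sum_range]

lemma renewalSeq_lt_top {A η : ℝ≥0∞} {r : ℕ → ℝ≥0∞} (hA : A < ∞) (hη : η < ∞) (hr : ∀ n, r n < ∞)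
    (n : ℕ) : renewalSeq A η r n < ∞ := by
  induction n using Nat.strong_induction_on with
  | _ n ih =>
    rw [renewalSeq_eq]
    refine ENNReal.add_lt_top.2 ⟨ENNReal.mul_lt_top hA (hr n), ?_⟩
    exact ENNReal.sum_lt_top.2 fun j hj =>
      ENNReal.mul_lt_top (ENNReal.mul_lt_top hη (hr _)) (ih j (Finset.mem_range.1 hj))

/-- The solution of a subcritical renewal equation inherits a finite first moment. -/
lemma tsum_renewalSeq_le {A η : ℝ≥0∞} {r : ℕ → ℝ≥0∞} (hA : A < ∞) (hη : η < ∞)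
    (hr : ∑' n : ℕ, (1 + (n : ℝ≥0∞)) * r n < ∞)
    (hsub : η * ∑' n : ℕ, (1 + (n : ℝ≥0∞)) * r n ≤ 1 / 2) :
    ∑' n : ℕ, (1 + (n : ℝ≥0∞)) * renewalSeq A η r n ≤
      2 * (A * ∑' n : ℕ, (1 + (n : ℝ≥0∞)) * r n) := by
  set R := ∑' n : ℕ, (1 + (n : ℝ≥0∞)) * r n with hR
  set δ := renewalSeq A η r with hδ
  have hrn : ∀ n, r n < ∞ := fun n => by
    refine lt_of_le_of_lt ?_ (lt_of_le_of_lt (ENNReal.le_tsum n) hr)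
    calc r n = 1 * r n := (one_mul _).symm
      _ ≤ _ := by gcongr; exact le_self_add
  rw [ENNReal.tsum_eq_iSup_nat]
  refine iSup_le fun N => ?_
  set S := ∑ n ∈ Finset.range N, (1 + (n : ℝ≥0∞)) * δ n with hS
  have hSfin : S < ∞ := ENNReal.sum_lt_top.2 fun n _ => ENNReal.mul_lt_top
    (by simp [ENNReal.add_lt_top]) (renewalSeq_lt_top hA hη hrn n)
  have hkey : S ≤ A * R + 1 / 2 * S := by
    calc S = ∑ n ∈ Finset.range N, (A * ((1 + (n : ℝ≥0∞)) * r n) +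
          ∑ j ∈ Finset.range n, η * ((1 + (n : ℝ≥0∞)) * r (n - j) * δ j)) := by
          refine Finset.sum_congr rfl fun n _ => ?_
          rw [hδ, renewalSeq_eq, mul_add, Finset.mul_sum]
          congr 1
          · ring
          · exact Finset.sum_congr rfl fun j _ => by ring
      _ = A * ∑ n ∈ Finset.range N, (1 + (n : ℝ≥0∞)) * r n +
          ∑ n ∈ Finset.range N, ∑ j ∈ Finset.range n, η * ((1 + (n : ℝ≥0∞)) * r (n - j) * δ j) := by
          rw [Finset.sum_add_distrib, Finset.mul_sum]
      _ ≤ A * R + ∑ j ∈ Finset.range N, η * R * ((1 + (j : ℝ≥0∞)) * δ j) := by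
          refine add_le_add (mul_le_mul_right (ENNReal.sum_le_tsum _) _) ?_
          calc ∑ n ∈ Finset.range N, ∑ j ∈ Finset.range n, η * ((1 + (n : ℝ≥0∞)) * r (n - j) * δ j)
              ≤ ∑ n ∈ Finset.range N, ∑ j ∈ Finset.range N, if j < n then
                η * ((1 + (n : ℝ≥0∞)) * r (n - j) * δ j) else 0 := by
                refine Finset.sum_le_sum fun n hn => ?_
                rw [← Finset.sum_filter]
                refine Finset.sum_le_sum_of_subset fun j hj => ?_
                simp only [Finset.mem_range, Finset.mem_filter] at hn hj ⊢
                omega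
            _ = ∑ j ∈ Finset.range N, ∑ n ∈ Finset.range N, if j < n then
                η * ((1 + (n : ℝ≥0∞)) * r (n - j) * δ j) else 0 := Finset.sum_comm
            _ ≤ _ := by
                refine Finset.sum_le_sum fun j _ => ?_
                rw [hR, ← ENNReal.tsum_mul_left, ← ENNReal.tsum_mul_right]
                rw [← Finset.sum_filter]
                set s := (Finset.range N).filter (fun n => j < n)
                calc ∑ n ∈ s, η * ((1 + (n : ℝ≥0∞)) * r (n - j) * δ j)
                    ≤ ∑ n ∈ s, η * ((1 + ((n - j : ℕ) : ℝ≥0∞)) * r (n - j)) *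
                      ((1 + (j : ℝ≥0∞)) * δ j) := by
                      refine Finset.sum_le_sum fun n hn => ?_
                      have hjn : j < n := (Finset.mem_filter.1 hn).2
                      obtain ⟨k, rfl⟩ := Nat.exists_eq_add_of_lt hjn
                      have e : j + k + 1 - j = k + 1 := by omega
                      rw [e]
                      have hle : (1 + ((j + k + 1 : ℕ) : ℝ≥0∞)) ≤
                          (1 + ((k + 1 : ℕ) : ℝ≥0∞)) * (1 + (j : ℝ≥0∞)) := by
                        have : 1 + (j + k + 1) ≤ (1 + (k + 1)) * (1 + j) := by nlinarith
                        exact_mod_cast this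
                      calc η * ((1 + ((j + k + 1 : ℕ) : ℝ≥0∞)) * r (k + 1) * δ j)
                          ≤ η * ((1 + ((k + 1 : ℕ) : ℝ≥0∞)) * (1 + (j : ℝ≥0∞)) * r (k + 1) * δ j) := by
                            gcongr
                        _ = _ := by ring
                  _ = ∑ m ∈ s.image (fun n => n - j), η * ((1 + (m : ℝ≥0∞)) * r m) *
                      ((1 + (j : ℝ≥0∞)) * δ j) := by
                      rw [Finset.sum_image]
                      intro a ha b hb hab
                      have := (Finset.mem_filter.1 ha).2
                      have := (Finset.mem_filter.1 hb).2
                      simp only at hab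
                      omega
                  _ ≤ _ := ENNReal.sum_le_tsum _
      _ ≤ A * R + 1 / 2 * S := by
          rw [← Finset.mul_sum]
          gcongr
  have h2 : S = 1 / 2 * S + 1 / 2 * S := by
    rw [← add_mul, ENNReal.add_halves, one_mul]
  have h3 : 1 / 2 * S ≤ A * R := by
    have hfin : 1 / 2 * S ≠ ∞ := (ENNReal.mul_lt_top (by simp) hSfin).ne
    refine (ENNReal.add_le_add_iff_right hfin).1 ?_
    rw [← h2]; exact hkey
  calc S = 2 * (1 / 2 * S) := by
        rw [← mul_assoc, one_div, ENNReal.mul_inv_cancel (by simp) (by simp), one_mul]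
    _ ≤ _ := by gcongr

lemma le_renewalSeq_succ (A η : ℝ≥0∞) {r : ℕ → ℝ≥0∞} (hr : r 1 = 1) (n : ℕ) :
    η * renewalSeq A η r n ≤ renewalSeq A η r (n + 1) := by
  rw [renewalSeq_eq A η r (n + 1), Finset.sum_range_succ, Nat.add_sub_cancel_left, hr, mul_one]
  exact le_add_left le_add_self

namespace IsStepDensity

variable {E : ℝ → ℝ} {σ M : ℝ}

lemma measurable_step (h : IsStepDensity E σ M) (e : ℝ≥0∞) {f : ℝ × ℝ → ℝ≥0∞} (hf : Measurable f) :
    Measurable (step E e f) :=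
  ((h.measurable_stepZero (c := fun x => f (x, 0)) (by fun_prop)).const_mul e).add
    (h.measurable_stepPos hf)

lemma stepPos_sum (h : IsStepDensity E σ M) {ι : Type*} (s : Finset ι) {f : ι → ℝ × ℝ → ℝ≥0∞}
    (hf : ∀ i ∈ s, Measurable (f i)) (p : ℝ × ℝ) :
    stepPos E (fun q => ∑ i ∈ s, f i q) p = ∑ i ∈ s, stepPos E (f i) p := by
  have hE := h.measurable_eDens
  simp only [stepPos, Finset.mul_sum]
  refine lintegral_finsetSum' _ fun i hi => ?_
  have := hf i hi
  exact Measurable.aemeasurable (by fun_prop)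

/-- Decomposition of a word according to its first contact. -/
lemma step_le_sum_excursion (h : IsStepDensity E σ M) {e : ℝ≥0∞} {F : ℕ → ℝ × ℝ → ℝ≥0∞}
    (hF : ∀ n, Measurable (F n)) (h0 : ∀ u v, 0 < v → F 0 (u, v) = 0)
    (hs : ∀ n, F (n + 1) ≤ step E e (F n)) (n : ℕ) (p : ℝ × ℝ) :
    step E e (F n) p ≤ ∑ k ∈ Finset.range (n + 1),
      e * (stepPos E)^[k] (stepZero E fun x => F (n - k) (x, 0)) p := by
  induction n generalizing p with
  | zero =>
    have hz : stepPos E (F 0) p ≤ stepPos E (fun _ => 0) p :=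
      stepPos_congr_pos (fun u v hv => (h0 u v hv).le) p
    have hz' : stepPos E (fun _ => (0 : ℝ≥0∞)) p = 0 := by simp [stepPos]
    rw [hz'] at hz
    simp [step, le_antisymm hz zero_le]
  | succ n ih =>
    rw [Finset.sum_range_succ', step]
    refine (add_comm _ _).le.trans (add_le_add ?_ (by simp))
    refine (stepPos_mono E ((hs n).trans ih) p).trans ?_
    have hm : ∀ k, Measurable ((stepPos E)^[k] (stepZero E fun x => F (n - k) (x, 0))) := fun k =>
      h.measurable_iterate_stepPos (h.measurable_stepZero
        ((hF _).comp (measurable_id.prodMk measurable_const))) k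
    rw [h.stepPos_sum _ fun k _ => (hm k).const_mul e]
    refine Finset.sum_le_sum fun k _ => ?_
    rw [h.stepPos_const_mul e (hm k), Function.iterate_succ_apply', Nat.add_sub_add_right]

end IsStepDensity

/-- Constants controlling words whose contacts avoid a compact set: `t k * h w` bounds excursions of
length `k` from height `w`, and beyond height `Y` the weight `η * K * rootWeight` dominates. -/
structure ExcursionControl (E : ℝ → ℝ) (t : ℕ → ℝ≥0∞) (h : ℝ → ℝ≥0∞) (B g₀ g₁ K η : ℝ≥0∞)
    (Y : ℝ) : Prop where
  le_bound : ∀ x, eDens E x ≤ B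
  t_zero : t 0 = 1
  excursion : ∀ k, 0 < k → ∀ w, 0 ≤ w → ∀ c : ℝ → ℝ≥0∞, Measurable c →
    (stepPos E)^[k] (stepZero E c) (0, w) ≤ t k * h w * ∫⁻ x in Ioi 0, c x
  h_mono : Monotone h
  one_le_h : ∀ w, 0 ≤ w → 1 ≤ h w
  h_le : ∀ w, 0 ≤ w → h w ≤ rootWeight w
  one_le_K : 1 ≤ K
  tail_le : ∀ x, 0 ≤ x → tailInt E x ≤ g₀
  lintegral_tail_le : ∫⁻ x in Ioi 0, tailInt E x ≤ g₁
  Y_nonneg : 0 ≤ Y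
  far_atom : ∀ w, Y < w → B * (K * g₀ + 2 * B) ≤ η * K * rootWeight w
  far : ∀ w, Y < w → h w * (K * g₁ + 2) ≤ η * K * rootWeight w
  near : ∀ w, 0 < w → h w * (K * (∫⁻ x in Ioi Y, tailInt E x) + 2) ≤ η * K * rootWeight w

/-- The profile dominating the weight of words at a contact, as a function of the height before. -/
def contactProfile (E : ℝ → ℝ) (K : ℝ≥0∞) (Y : ℝ) (L : ℝ≥0∞) (f : ℝ → ℝ≥0∞) (x : ℝ) : ℝ≥0∞ :=
  L * (K * tailInt E x + eDens E x) + ∫⁻ w in Ioc 0 Y, eDens E (w + x) * f w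

/-- Renewal weights built from the excursion weights. -/
def excWeight (t : ℕ → ℝ≥0∞) : ℕ → ℝ≥0∞
  | 0 => 0
  | 1 => 1
  | k + 2 => t k

namespace ExcursionControl

variable {E : ℝ → ℝ} {σ M : ℝ} {t : ℕ → ℝ≥0∞} {h : ℝ → ℝ≥0∞} {B g₀ g₁ K η : ℝ≥0∞} {Y : ℝ}
  {L : ℝ≥0∞} {f : ℝ → ℝ≥0∞}

lemma contactProfile_le (hC : ExcursionControl E t h B g₀ g₁ K η Y)
    (hL : f 0 + ∫⁻ x in Ioc 0 Y, f x ≤ L) (hf : Measurable f) {x : ℝ} (hx : 0 ≤ x) :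
    contactProfile E K Y L f x ≤ L * (K * g₀ + 2 * B) := by
  have h1 : ∫⁻ w in Ioc 0 Y, eDens E (w + x) * f w ≤ B * L := by
    calc _ ≤ ∫⁻ w in Ioc 0 Y, B * f w := lintegral_mono fun w => mul_le_mul_left (hC.le_bound _) _
      _ = B * ∫⁻ w in Ioc 0 Y, f w := lintegral_const_mul _ hf
      _ ≤ B * L := mul_le_mul_right (le_add_self.trans hL) _
  calc _ ≤ L * (K * g₀ + B) + B * L := by
        unfold contactProfile
        gcongr
        · exact hC.tail_le x hx
        · exact hC.le_bound x
    _ = _ := by ring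

lemma lintegral_contactProfile_le (hE : IsStepDensity E σ M)
    (hL : f 0 + ∫⁻ x in Ioc 0 Y, f x ≤ L) (hf : Measurable f) (K : ℝ≥0∞) (a : ℝ) :
    ∫⁻ x in Ioi a, contactProfile E K Y L f x ≤ L * (K * (∫⁻ x in Ioi a, tailInt E x) + 2) := by
  have hW := hE.measurable_eDens
  have hT := hE.measurable_tailInt
  have h1 : ∫⁻ x in Ioi a, ∫⁻ w in Ioc 0 Y, eDens E (w + x) * f w ≤ L := by
    refine (setLIntegral_le_lintegral _ _).trans ?_
    rw [lintegral_lintegral_swap (Measurable.aemeasurable (by fun_prop))]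
    refine le_trans (lintegral_mono fun w => ?_) (le_add_self.trans hL)
    rw [lintegral_mul_const _ (by fun_prop), lintegral_add_left_eq_self (fun x => eDens E x) w,
      hE.lintegral_eDens, one_mul]
  have h2 : ∫⁻ x in Ioi a, eDens E x ≤ 1 :=
    (setLIntegral_le_lintegral _ _).trans hE.lintegral_eDens.le
  unfold contactProfile
  rw [lintegral_add_left (by fun_prop), lintegral_const_mul _ (by fun_prop),
    lintegral_add_left (by fun_prop), lintegral_const_mul _ hT]
  calc _ ≤ L * (K * (∫⁻ x in Ioi a, tailInt E x) + 1) + L := by gcongr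
    _ = _ := by ring

/-- An excursion towards a contact far away, or starting far away, is dominated. -/
lemma excursion_le_of_far (hE : IsStepDensity E σ M) (hC : ExcursionControl E t h B g₀ g₁ K η Y)
    (hL : f 0 + ∫⁻ x in Ioc 0 Y, f x ≤ L) (hf : Measurable f) {c : ℝ → ℝ≥0∞} (hc : Measurable c)
    {D : ℝ≥0∞} (hcD : ∀ x, 0 ≤ x → c x ≤ D * contactProfile E K Y L f x) {w : ℝ} (hw : 0 < w)
    (hfar : Y < w ∨ ∀ x, 0 < x → x ≤ Y → c x = 0) (k : ℕ) :
    (stepPos E)^[k] (stepZero E c) (0, w) ≤ D * L * (η * K) * t k * rootWeight w := by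
  have hint : ∀ a, 0 ≤ a → ∫⁻ x in Ioi a, c x ≤
      D * (L * (K * (∫⁻ x in Ioi a, tailInt E x) + 2)) := fun a ha => by
    have hm : Measurable (contactProfile E K Y L f) := by
      have hW := hE.measurable_eDens
      have hT := hE.measurable_tailInt
      refine Measurable.add (by fun_prop) ?_
      exact Measurable.lintegral_prod_right' (f := fun p : ℝ × ℝ => eDens E (p.2 + p.1) * f p.2)
        (by fun_prop)
    calc _ ≤ ∫⁻ x in Ioi a, D * contactProfile E K Y L f x :=
          setLIntegral_mono' measurableSet_Ioi fun x hx => hcD x (ha.trans (le_of_lt hx))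
      _ = D * ∫⁻ x in Ioi a, contactProfile E K Y L f x := lintegral_const_mul _ hm
      _ ≤ _ := mul_le_mul_right (lintegral_contactProfile_le hE hL hf K a) _
  rcases Nat.eq_zero_or_pos k with rfl | hk
  · rw [hC.t_zero, mul_one, Function.iterate_zero_apply, stepZero]
    by_cases hwY : Y < w
    · calc _ ≤ B * (D * (L * (K * g₀ + 2 * B))) := mul_le_mul' (hC.le_bound _)
            ((hcD w hw.le).trans (mul_le_mul_right (hC.contactProfile_le hL hf hw.le) _))
        _ = D * L * (B * (K * g₀ + 2 * B)) := by ring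
        _ ≤ D * L * (η * K * rootWeight w) := mul_le_mul_right (hC.far_atom w hwY) _
        _ = _ := by ring
    · rw [hfar.resolve_left hwY w hw (not_lt.1 hwY), mul_zero]
      exact zero_le
  · refine (hC.excursion k hk w hw.le c hc).trans ?_
    by_cases hwY : Y < w
    · calc _ ≤ t k * h w * (D * (L * (K * g₁ + 2))) := by
            refine mul_le_mul_right ((hint 0 le_rfl).trans ?_) _
            gcongr
            exact hC.lintegral_tail_le
        _ = D * L * t k * (h w * (K * g₁ + 2)) := by ring
        _ ≤ D * L * t k * (η * K * rootWeight w) := mul_le_mul_right (hC.far w hwY) _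
        _ = _ := by ring
    · have hz := hfar.resolve_left hwY
      have hsplit : ∫⁻ x in Ioi 0, c x = ∫⁻ x in Ioi Y, c x := by
        rw [← Ioc_union_Ioi_eq_Ioi hC.Y_nonneg, lintegral_union measurableSet_Ioi
          (by rw [disjoint_left]; intro x hx hx'; exact absurd hx.2 (not_le.2 hx')),
          setLIntegral_congr_fun (g := fun _ => 0) measurableSet_Ioc fun x hx => hz x hx.1 hx.2]
        simp
      calc _ ≤ t k * h w * (D * (L * (K * (∫⁻ x in Ioi Y, tailInt E x) + 2))) := by
            rw [hsplit]
            exact mul_le_mul_right (hint Y hC.Y_nonneg) _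
        _ = D * L * t k * (h w * (K * (∫⁻ x in Ioi Y, tailInt E x) + 2)) := by ring
        _ ≤ D * L * t k * (η * K * rootWeight w) := mul_le_mul_right (hC.near w hw) _
        _ = _ := by ring

end ExcursionControl

/-- Iterates of the transfer operator started at contacts of height at most `Y`, killed at contacts
preceded by height at most `Y` during the first `b` steps, and killed after contacts followed by
height at most `Y` from step `b + 2` on. -/
structure IsKilledWord (E : ℝ → ℝ) (e : ℝ≥0∞) (Y : ℝ) (f : ℝ → ℝ≥0∞) (b : ℕ)
    (F : ℕ → ℝ × ℝ → ℝ≥0∞) : Prop where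
  measurable : ∀ n, Measurable (F n)
  zero_of_pos : ∀ u v, 0 < v → F 0 (u, v) = 0
  contact_zero_le : ∀ x, F 0 (x, 0) ≤ (Iic Y).indicator f x
  succ_le : ∀ n, F (n + 1) ≤ step E e (F n)
  early : ∀ n, n < b → ∀ x, 0 ≤ x → x ≤ Y → F (n + 1) (x, 0) = 0
  late : ∀ n, b < n → ∀ w, 0 ≤ w → w ≤ Y → F (n + 1) (0, w) = 0

namespace IsKilledWord

variable {E : ℝ → ℝ} {σ M : ℝ} {t : ℕ → ℝ≥0∞} {h : ℝ → ℝ≥0∞} {B g₀ g₁ K η : ℝ≥0∞} {Y : ℝ}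
  {L : ℝ≥0∞} {f : ℝ → ℝ≥0∞} {e ē : ℝ≥0∞} {b : ℕ} {F : ℕ → ℝ × ℝ → ℝ≥0∞}

lemma measurable_contact (hF : IsKilledWord E e Y f b F) (n : ℕ) :
    Measurable fun x => F n (x, 0) :=
  (hF.measurable n).comp (measurable_id.prodMk measurable_const)

lemma step_le_sum (hE : IsStepDensity E σ M) (hF : IsKilledWord E e Y f b F) (n : ℕ) (p : ℝ × ℝ) :
    step E e (F n) p ≤ e * (stepPos E)^[n] (stepZero E fun x => F 0 (x, 0)) p +
      ∑ j ∈ Finset.Ico 1 (n + 1), e * (stepPos E)^[n - j] (stepZero E fun x => F j (x, 0)) p := by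
  refine (hE.step_le_sum_excursion hF.measurable hF.zero_of_pos hF.succ_le n p).trans ?_
  rw [← Finset.sum_range_reflect, Finset.range_eq_Ico, Finset.sum_eq_sum_Ico_succ_bot (by omega)]
  refine add_le_add (le_of_eq (by simp)) (Finset.sum_le_sum fun j hj => le_of_eq ?_)
  have hj' := Finset.mem_Ico.1 hj
  have e1 : n + 1 - 1 - j = n - j := by omega
  have e2 : n - (n - j) = j := by omega
  rw [e1, e2]

lemma lintegral_zero_contact_le (hF : IsKilledWord E e Y f b F)
    (hL : f 0 + ∫⁻ x in Ioc 0 Y, f x ≤ L) : ∫⁻ x in Ioi 0, F 0 (x, 0) ≤ L := by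
  refine (lintegral_mono fun x => hF.contact_zero_le x).trans (le_trans ?_ (le_add_self.trans hL))
  rw [lintegral_indicator measurableSet_Iic, Measure.restrict_restrict measurableSet_Iic, inter_comm,
    Ioi_inter_Iic]

lemma lintegral_height_le (hE : IsStepDensity E σ M) (hC : ExcursionControl E t h B g₀ g₁ K η Y)
    (hL : f 0 + ∫⁻ x in Ioc 0 Y, f x ≤ L) (hf : Measurable f) (he : e ≤ ē)
    (hF : IsKilledWord E e Y f b F) {n : ℕ} (hn : 0 < n) {d : ℕ → ℝ≥0∞}
    (hd : ∀ j, 0 < j → j < n → ∀ x, 0 ≤ x → F j (x, 0) ≤ d j * contactProfile E K Y L f x)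
    (hbad : (∀ w, 0 < w → w ≤ Y → F n (0, w) = 0) ∨
      ∀ j, 0 < j → j < n → ∀ x, 0 < x → x ≤ Y → F j (x, 0) = 0) (x : ℝ) :
    ∫⁻ w in Ioi 0, eDens E (w + x) * F n (0, w) ≤
      (ē * (1 + B) * excWeight t (n + 1) + ∑ j ∈ Finset.Ico 1 n,
        ē * η * excWeight t (n + 1 - j) * d j) * contactProfile E K Y L f x := by
  have hW := hE.measurable_eDens
  have hH := measurable_rootWeight
  obtain ⟨m, rfl⟩ := Nat.exists_eq_succ_of_ne_zero hn.ne'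
  set S := ∑ j ∈ Finset.Ico 1 (m + 1), d j * L * (η * K) * t (m - j) with hS
  have hpt : ∀ w, 0 < w → F (m + 1) (0, w) ≤ ē * (t m * (B * (Ioc 0 Y).indicator f w + L * rootWeight w))
      + ē * S * rootWeight w := by
    intro w hw
    by_cases hz : F (m + 1) (0, w) = 0
    · rw [hz]; exact zero_le
    refine (hF.succ_le m _).trans ((hF.step_le_sum hE m _).trans ?_)
    refine add_le_add (mul_le_mul' he ?_) ?_
    · rcases Nat.eq_zero_or_pos m with rfl | hm
      · rw [hC.t_zero, one_mul, Function.iterate_zero_apply, stepZero]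
        refine le_add_right (mul_le_mul' (hC.le_bound _) ((hF.contact_zero_le w).trans (le_of_eq ?_)))
        simp [indicator, hw]
      · refine (hC.excursion m hm w hw.le _ (hF.measurable_contact 0)).trans ?_
        rw [mul_assoc, mul_comm (h w)]
        exact mul_le_mul_right (le_add_left (mul_le_mul' (hF.lintegral_zero_contact_le hL)
          (hC.h_le w hw.le))) _
    · rw [hS, mul_assoc, Finset.sum_mul, Finset.mul_sum]
      refine Finset.sum_le_sum fun j hj => mul_le_mul' he ?_
      obtain ⟨hj1, hj2⟩ := Finset.mem_Ico.1 hj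
      refine hC.excursion_le_of_far hE hL hf (hF.measurable_contact j) (hd j hj1 hj2) hw ?_ _
      rcases hbad with hb | hb
      · left
        by_contra hwY
        exact hz (hb w hw (not_lt.1 hwY))
      · exact Or.inr (hb j hj1 hj2)
  set G := contactProfile E K Y L f x with hG
  have hG1 : ∫⁻ w in Ioi 0, eDens E (w + x) * (Ioc 0 Y).indicator f w ≤ G := by
    refine (setLIntegral_le_lintegral _ _).trans (le_trans (le_of_eq ?_) le_add_self)
    rw [← lintegral_indicator measurableSet_Ioc]
    refine lintegral_congr fun w => ?_
    by_cases hw : w ∈ Ioc 0 Y <;> simp [hw]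
  have hG2 : L * (K * tailInt E x) ≤ G := by
    rw [hG, contactProfile, mul_add, add_assoc]; exact le_self_add
  have hG3 : L * tailInt E x ≤ G := le_trans (mul_le_mul_right
    (le_mul_of_one_le_left zero_le hC.one_le_K) _) hG2
  have hfi : Measurable ((Ioc 0 Y).indicator f) := hf.indicator measurableSet_Ioc
  calc ∫⁻ w in Ioi 0, eDens E (w + x) * F (m + 1) (0, w)
      ≤ ∫⁻ w in Ioi 0, (ē * t m * B * (eDens E (w + x) * (Ioc 0 Y).indicator f w) +
        (ē * t m * L + ē * S) * (eDens E (w + x) * rootWeight w)) := by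
        refine setLIntegral_mono' measurableSet_Ioi fun w hw => ?_
        refine (mul_le_mul_right (hpt w hw) _).trans (le_of_eq ?_)
        ring
    _ = ē * t m * B * (∫⁻ w in Ioi 0, eDens E (w + x) * (Ioc 0 Y).indicator f w) +
        (ē * t m * L + ē * S) * tailInt E x := by
        rw [lintegral_add_left (by fun_prop), lintegral_const_mul _ (by fun_prop),
          lintegral_const_mul _ (by fun_prop), tailInt]
    _ = ē * t m * B * (∫⁻ w in Ioi 0, eDens E (w + x) * (Ioc 0 Y).indicator f w) +
        ē * t m * (L * tailInt E x) + (∑ j ∈ Finset.Ico 1 (m + 1), ē * η * t (m - j) * d j) *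
          (L * (K * tailInt E x)) := by
        have : ē * S * tailInt E x = (∑ j ∈ Finset.Ico 1 (m + 1), ē * η * t (m - j) * d j) *
            (L * (K * tailInt E x)) := by
          rw [hS, Finset.mul_sum, Finset.sum_mul, Finset.sum_mul]
          exact Finset.sum_congr rfl fun j _ => by ring
        rw [add_mul, this]
        ring
    _ ≤ ē * t m * B * G + ē * t m * G + (∑ j ∈ Finset.Ico 1 (m + 1), ē * η * t (m - j) * d j) * G := by
        gcongr
    _ = _ := by
        have hsum : ∑ j ∈ Finset.Ico 1 (m + 1), ē * η * t (m - j) * d j =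
            ∑ j ∈ Finset.Ico 1 (m + 1), ē * η * excWeight t (m + 1 + 1 - j) * d j := by
          refine Finset.sum_congr rfl fun j hj => ?_
          have hj' := Finset.mem_Ico.1 hj
          have : m + 1 + 1 - j = (m - j) + 2 := by omega
          rw [this, excWeight]
        rw [hsum, Nat.succ_eq_add_one]
        simp only [excWeight]
        ring

end IsKilledWord

namespace IsKilledWord

variable {E : ℝ → ℝ} {σ M : ℝ} {t : ℕ → ℝ≥0∞} {h : ℝ → ℝ≥0∞} {B g₀ g₁ K η : ℝ≥0∞} {Y : ℝ}
  {L : ℝ≥0∞} {f : ℝ → ℝ≥0∞} {e ē : ℝ≥0∞} {b : ℕ} {F : ℕ → ℝ × ℝ → ℝ≥0∞}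

lemma sum_le_renewalSeq (A η : ℝ≥0∞) (r : ℕ → ℝ≥0∞) {m n : ℕ} (hmn : m ≤ n) :
    A * r n + ∑ j ∈ Finset.Ico 1 m, η * r (n - j) * renewalSeq A η r j ≤ renewalSeq A η r n := by
  rw [renewalSeq_eq A η r n]
  refine add_le_add le_rfl (Finset.sum_le_sum_of_subset fun j hj => ?_)
  have := Finset.mem_Ico.1 hj
  exact Finset.mem_range.2 (by omega)

/-- The weight of a killed word at a contact is dominated by the renewal sequence. -/
lemma step_contact_le (hE : IsStepDensity E σ M) (hC : ExcursionControl E t h B g₀ g₁ K η Y)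
    (hL : f 0 + ∫⁻ x in Ioc 0 Y, f x ≤ L) (hf : Measurable f) (he : e ≤ ē)
    (hF : IsKilledWord E e Y f b F) {D : ℝ≥0∞} (hD : ē * (K * g₀ + 2 * B) ≤ ē * η * D) (n : ℕ)
    {x : ℝ} (hx : 0 ≤ x) :
    step E e (F n) (x, 0) ≤ (if n ≤ b then 1 else 1 + D) *
      renewalSeq (ē * (1 + B)) (ē * η) (excWeight t) (n + 1) * contactProfile E K Y L f x := by
  set A := ē * (1 + B) with hA
  set η' := ē * η with hη'
  set r := excWeight t with hr
  set δ := renewalSeq A η' r with hδ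
  have hr1 : r 1 = 1 := rfl
  induction n using Nat.strong_induction_on generalizing x with
  | _ n ih =>
  set G := contactProfile E K Y L f x with hG
  have hstep : step E e (F n) (x, 0) = e * (eDens E x * F n (0, 0)) +
      ∫⁻ w in Ioi 0, eDens E (w + x) * F n (0, w) := by
    simp [step, stepPos, stepZero]
  have hWG : L * eDens E x ≤ G := by
    rw [hG, contactProfile, mul_add, add_assoc]
    exact le_add_left le_self_add
  have hA1 : ē ≤ A := by rw [hA]; exact le_mul_of_one_le_right zero_le le_self_add
  rw [hstep]
  rcases Nat.eq_zero_or_pos n with rfl | hn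
  · have hz : ∫⁻ w in Ioi 0, eDens E (w + x) * F 0 (0, w) = 0 := by
      rw [setLIntegral_congr_fun (g := fun _ => 0) measurableSet_Ioi fun w hw => by
        simp [hF.zero_of_pos 0 w hw]]
      simp
    have hF0 : F 0 (0, 0) ≤ L := (hF.contact_zero_le 0).trans ((indicator_le_self' (fun _ _ => zero_le) 0).trans
      (le_self_add.trans hL))
    have hδ1 : ē ≤ δ 1 := by
      rw [hδ, renewalSeq_eq, hr1, mul_one]
      exact hA1.trans le_self_add
    rw [hz, add_zero, if_pos (Nat.zero_le _), one_mul]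
    calc e * (eDens E x * F 0 (0, 0)) ≤ δ 1 * (eDens E x * L) := by gcongr; exact he.trans hδ1
      _ ≤ δ 1 * G := by rw [mul_comm (eDens E x)]; gcongr
  · have hd : ∀ j, 0 < j → j ≤ n → ∀ x, 0 ≤ x → F j (x, 0) ≤
        (if j ≤ b + 1 then 1 else 1 + D) * δ j * contactProfile E K Y L f x := by
      intro j hj hjn x hx
      obtain ⟨i, rfl⟩ := Nat.exists_eq_succ_of_ne_zero hj.ne'
      have := ih i (by omega) hx
      simp only [Nat.succ_eq_add_one, add_le_add_iff_right]
      exact (hF.succ_le i _).trans this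
    rcases Nat.lt_or_ge (b + 1) n with hbn | hbn
    · obtain ⟨i, rfl⟩ := Nat.exists_eq_succ_of_ne_zero hn.ne'
      rw [Nat.succ_eq_add_one] at *
      rw [hF.late i (by omega) 0 le_rfl hC.Y_nonneg, mul_zero, mul_zero, zero_add, if_neg (by omega)]
      refine (hF.lintegral_height_le hE hC hL hf he hn (d := fun j => (1 + D) * δ j) ?_
        (Or.inl fun w hw hwY => hF.late i (by omega) w hw.le hwY) x).trans ?_
      · intro j hj hjn x hx
        refine (hd j hj hjn.le x hx).trans ?_
        gcongr
        split_ifs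
        · exact le_self_add
        · exact le_rfl
      · refine mul_le_mul_left ?_ _
        calc _ ≤ (1 + D) * (A * r (i + 1 + 1)) + ∑ j ∈ Finset.Ico 1 (i + 1),
              (1 + D) * (η' * r (i + 1 + 1 - j) * δ j) := by
              refine add_le_add (le_mul_of_one_le_left zero_le le_self_add)
                (Finset.sum_le_sum fun j _ => le_of_eq (by ring))
          _ = (1 + D) * (A * r (i + 1 + 1) + ∑ j ∈ Finset.Ico 1 (i + 1), η' * r (i + 1 + 1 - j) * δ j) := by
              rw [mul_add, Finset.mul_sum]
          _ ≤ _ := mul_le_mul_right (sum_le_renewalSeq A η' r (by omega)) _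
    · have hint : ∫⁻ w in Ioi 0, eDens E (w + x) * F n (0, w) ≤ δ (n + 1) * G := by
        refine (hF.lintegral_height_le hE hC hL hf he hn (d := δ) ?_ (Or.inr ?_) x).trans ?_
        · intro j hj hjn x hx
          refine (hd j hj hjn.le x hx).trans (le_of_eq ?_)
          rw [if_pos (by omega), one_mul]
        · intro j hj hjn x hx hxY
          obtain ⟨i, rfl⟩ := Nat.exists_eq_succ_of_ne_zero hj.ne'
          exact hF.early i (by omega) x hx.le hxY
        · exact mul_le_mul_left (sum_le_renewalSeq A η' r (by omega)) _
      rcases Nat.lt_or_ge b n with hb | hb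
      · rw [if_neg (by omega), add_mul, one_mul, add_mul, add_comm]
        refine add_le_add hint ?_
        have h0 : F n (0, 0) ≤ δ n * (L * (K * g₀ + 2 * B)) := by
          refine (hd n hn le_rfl 0 le_rfl).trans ?_
          rw [if_pos hbn, one_mul]
          exact mul_le_mul_right (hC.contactProfile_le hL hf le_rfl) _
        calc e * (eDens E x * F n (0, 0)) ≤ ē * (eDens E x * (δ n * (L * (K * g₀ + 2 * B)))) := by gcongr
          _ = ē * (K * g₀ + 2 * B) * δ n * (L * eDens E x) := by ring
          _ ≤ η' * D * δ n * G := by gcongr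
          _ = D * (η' * δ n) * G := by ring
          _ ≤ D * δ (n + 1) * G := by gcongr; exact le_renewalSeq_succ A η' hr1 n
      · obtain ⟨i, rfl⟩ := Nat.exists_eq_succ_of_ne_zero hn.ne'
        rw [Nat.succ_eq_add_one] at *
        rw [hF.early i (by omega) 0 le_rfl hC.Y_nonneg, mul_zero, mul_zero, zero_add, if_pos hb, one_mul]
        exact hint

/-- The weight of a killed word read at a start of height at most `Y`. -/
lemma step_start_le (hE : IsStepDensity E σ M) (hC : ExcursionControl E t h B g₀ g₁ K η Y)
    (hL : f 0 + ∫⁻ x in Ioc 0 Y, f x ≤ L) (hf : Measurable f) (he : e ≤ ē) (hη : η ≤ 1)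
    (hF : IsKilledWord E e Y f b F) {D : ℝ≥0∞} (hD : ē * (K * g₀ + 2 * B) ≤ ē * η * D) {n : ℕ}
    (hn : 0 < n) {y : ℝ} (hy : 0 ≤ y) (hyY : y ≤ Y) :
    ē * η * step E e (F n) (0, y) ≤
      ((1 + D) * (K * g₀ + 2 * B) + ē * h Y * (1 + D) * (B * (K * g₀ + 2 * B) + K * g₁ + 2)) * L *
        renewalSeq (ē * (1 + B)) (ē * η) (excWeight t) (n + 2) := by
  set A := ē * (1 + B) with hA
  set η' := ē * η with hη'
  set r := excWeight t with hr
  set δ := renewalSeq A η' r with hδ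
  set Q := ē * h Y * (1 + D) * (B * (K * g₀ + 2 * B) + K * g₁ + 2) with hQ
  have hr1 : r 1 = 1 := rfl
  have hcontact : ∀ m, ∀ x, 0 ≤ x →
      step E e (F m) (x, 0) ≤ (1 + D) * δ (m + 1) * contactProfile E K Y L f x := by
    intro m x hx
    refine (hF.step_contact_le hE hC hL hf he hD m hx).trans ?_
    gcongr
    split_ifs
    · exact le_self_add
    · exact le_rfl
  rcases hy.eq_or_lt with rfl | hy0
  · calc η' * step E e (F n) (0, 0) ≤ η' * ((1 + D) * δ (n + 1) * (L * (K * g₀ + 2 * B))) :=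
          mul_le_mul_right ((hcontact n 0 le_rfl).trans
            (mul_le_mul_right (hC.contactProfile_le hL hf le_rfl) _)) _
      _ = (1 + D) * (K * g₀ + 2 * B) * L * (η' * δ (n + 1)) := by ring
      _ ≤ ((1 + D) * (K * g₀ + 2 * B) + Q) * L * δ (n + 2) := by
          gcongr
          · exact le_self_add
          · exact le_renewalSeq_succ A η' hr1 (n + 1)
  · have hhY : h y ≤ h Y := hC.h_mono hyY
    have hh1 : 1 ≤ h Y := hC.one_le_h Y hC.Y_nonneg
    set P := (1 + D) * (B * (K * g₀ + 2 * B) + K * g₁ + 2) with hP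
    have hP1 : 1 ≤ P := by
      calc (1 : ℝ≥0∞) ≤ 1 * (0 + 2) := by norm_num
        _ ≤ _ := by rw [hP]; gcongr <;> first | exact le_self_add | exact zero_le
    have hfirst : (stepPos E)^[n] (stepZero E fun x => F 0 (x, 0)) (0, y) ≤ h Y * P * L * r (n + 2) := by
      refine (hC.excursion n hn y hy _ (hF.measurable_contact 0)).trans ?_
      calc t n * h y * ∫⁻ x in Ioi 0, F 0 (x, 0) ≤ t n * h Y * L := by
            gcongr; exact hF.lintegral_zero_contact_le hL
        _ = h Y * 1 * L * t n := by ring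
        _ ≤ h Y * P * L * t n := by gcongr
    have hrest : ∀ j ∈ Finset.Ico 1 (n + 1), (stepPos E)^[n - j] (stepZero E fun x => F j (x, 0)) (0, y)
        ≤ h Y * P * L * (r (n + 2 - j) * δ j) := by
      intro j hj
      obtain ⟨hj1, hj2⟩ := Finset.mem_Ico.1 hj
      have hrj : r (n + 2 - j) = t (n - j) := by
        rw [show n + 2 - j = (n - j) + 2 by omega]; rfl
      have hc : ∀ x, 0 ≤ x → F j (x, 0) ≤ (1 + D) * δ j * contactProfile E K Y L f x := by
        intro x hx
        obtain ⟨i, rfl⟩ := Nat.exists_eq_succ_of_ne_zero (by omega : j ≠ 0)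
        exact (hF.succ_le i _).trans (hcontact i x hx)
      rw [hrj]
      rcases Nat.eq_zero_or_pos (n - j) with h0 | h0
      · rw [h0, hC.t_zero, one_mul, Function.iterate_zero_apply, stepZero]
        calc _ ≤ B * ((1 + D) * δ j * (L * (K * g₀ + 2 * B))) := mul_le_mul' (hC.le_bound _)
              ((hc y hy).trans (mul_le_mul_right (hC.contactProfile_le hL hf hy) _))
          _ = 1 * ((1 + D) * (B * (K * g₀ + 2 * B))) * L * δ j := by ring
          _ ≤ h Y * P * L * δ j := by
              rw [hP]
              gcongr
              rw [add_assoc]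
              exact le_self_add
      · refine (hC.excursion _ h0 y hy _ (hF.measurable_contact j)).trans ?_
        have hGm : AEMeasurable (contactProfile E K Y L f) (volume.restrict (Ioi 0)) := by
          have hW := hE.measurable_eDens
          have hT := hE.measurable_tailInt
          refine (Measurable.add (by fun_prop) ?_).aemeasurable
          exact Measurable.lintegral_prod_right' (f := fun p : ℝ × ℝ => eDens E (p.2 + p.1) * f p.2)
            (by fun_prop)
        have hint : ∫⁻ x in Ioi 0, F j (x, 0) ≤ (1 + D) * δ j * (L * (K * g₁ + 2)) := by
          calc _ ≤ ∫⁻ x in Ioi 0, (1 + D) * δ j * contactProfile E K Y L f x :=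
                setLIntegral_mono' measurableSet_Ioi fun x hx => hc x (le_of_lt hx)
            _ = (1 + D) * δ j * ∫⁻ x in Ioi 0, contactProfile E K Y L f x :=
                lintegral_const_mul'' _ hGm
            _ ≤ (1 + D) * δ j * (L * (K * (∫⁻ x in Ioi 0, tailInt E x) + 2)) :=
                mul_le_mul_right (ExcursionControl.lintegral_contactProfile_le hE hL hf K 0) _
            _ ≤ _ := by gcongr; exact hC.lintegral_tail_le
        calc _ ≤ t (n - j) * h Y * ((1 + D) * δ j * (L * (K * g₁ + 2))) := by gcongr
          _ = h Y * ((1 + D) * (K * g₁ + 2)) * L * (t (n - j) * δ j) := by ring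
          _ ≤ h Y * P * L * (t (n - j) * δ j) := by
              rw [hP]
              gcongr
              exact le_add_self
    have hη'A : η' ≤ A := by
      rw [hη', hA]
      gcongr
      exact hη.trans le_self_add
    calc η' * step E e (F n) (0, y)
        ≤ η' * (ē * (h Y * P * L * r (n + 2)) +
          ∑ j ∈ Finset.Ico 1 (n + 1), ē * (h Y * P * L * (r (n + 2 - j) * δ j))) := by
          refine mul_le_mul_right ((hF.step_le_sum hE n _).trans ?_) _
          exact add_le_add (mul_le_mul' he hfirst)
            (Finset.sum_le_sum fun j hj => mul_le_mul' he (hrest j hj))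
      _ = Q * L * (η' * r (n + 2) + ∑ j ∈ Finset.Ico 1 (n + 1), η' * r (n + 2 - j) * δ j) := by
          rw [mul_add, mul_add, Finset.mul_sum, Finset.mul_sum, hQ, hP]
          refine congrArg₂ _ (by ring) (Finset.sum_congr rfl fun j _ => by ring)
      _ ≤ Q * L * (A * r (n + 2) + ∑ j ∈ Finset.Ico 1 (n + 1), η' * r (n + 2 - j) * δ j) := by gcongr
      _ ≤ Q * L * δ (n + 2) := mul_le_mul_right (sum_le_renewalSeq A η' r (by omega)) _
      _ ≤ _ := by gcongr; exact le_add_self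

end IsKilledWord

lemma tsum_excWeight_lt_top {C δ : ℝ} (hC : 0 < C) (hδ : 0 < δ) {t : ℕ → ℝ≥0∞} (h0 : t 0 = 1)
    (ht : ∀ k, 0 < k → t k = ENNReal.ofReal (C * (k : ℝ) ^ (-(2 + δ)))) :
    ∑' n : ℕ, (1 + (n : ℝ≥0∞)) * excWeight t n < ∞ := by
  have hle : ∀ k : ℕ, (1 + ((k + 3 : ℕ) : ℝ≥0∞)) * excWeight t (k + 3) ≤
      ENNReal.ofReal (4 * C * ((k + 1 : ℕ) : ℝ) ^ (-(1 + δ))) := by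
    intro k
    have e1 : (1 + ((k + 3 : ℕ) : ℝ≥0∞)) = ENNReal.ofReal ((k + 4 : ℕ) : ℝ) := by
      rw [ENNReal.ofReal_natCast]
      push_cast
      ring
    rw [excWeight, ht (k + 1) (by omega), e1, ← ENNReal.ofReal_mul (by positivity)]
    refine ENNReal.ofReal_le_ofReal ?_
    set x : ℝ := ((k + 1 : ℕ) : ℝ) with hx
    have hx0 : 0 < x := by positivity
    have hx4 : ((k + 4 : ℕ) : ℝ) ≤ 4 * x := by rw [hx]; push_cast; linarith [(k.cast_nonneg : (0 : ℝ) ≤ k)]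
    have e2 : x ^ (-(1 + δ)) = x * x ^ (-(2 + δ)) := by
      rw [show -(1 + δ) = 1 + -(2 + δ) by ring, Real.rpow_add hx0, Real.rpow_one]
    rw [e2]
    calc _ ≤ 4 * x * (C * x ^ (-(2 + δ))) := by gcongr
      _ = _ := by ring
  rw [← ENNReal.summable.sum_add_tsum_nat_add' (f := fun n : ℕ => (1 + (n : ℝ≥0∞)) * excWeight t n) (k := 3)]
  refine ENNReal.add_lt_top.2 ⟨?_, (ENNReal.tsum_le_tsum hle).trans_lt ?_⟩
  · simp [Finset.sum_range_succ, excWeight, h0, ENNReal.add_lt_top]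
  · refine Summable.tsum_ofReal_lt_top (Summable.mul_left _ ?_)
    exact (summable_nat_add_iff 1).2 (Real.summable_nat_rpow.2 (by linarith))

/-- Summable bound for killed words, uniform in the contact weight. -/
lemma IsStepDensity.exists_killedWord_le {E : ℝ → ℝ} {σ M : ℝ} (hE : IsStepDensity E σ M) {ē : ℝ≥0∞}
    (hē0 : ē ≠ 0) (hē : ē ≠ ∞) : ∃ Y : ℝ, 0 ≤ Y ∧ ∃ δ : ℕ → ℝ≥0∞,
      ∑' n : ℕ, (1 + (n : ℝ≥0∞)) * δ n < ∞ ∧ ∀ e ≤ ē, ∀ f : ℝ → ℝ≥0∞, Measurable f → ∀ b F,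
      IsKilledWord E e Y f b F → ∀ n, 0 < n → ∀ y, 0 ≤ y → y ≤ Y →
        step E e (F n) (0, y) ≤ (f 0 + ∫⁻ x in Ioc 0 Y, f x) * δ (n + 2) := by
  obtain ⟨C, δ₀, hC, hδ₀, hexc⟩ := hE.exists_excursion_le
  obtain ⟨g₀, hg₀, htail⟩ := hE.exists_tailInt_le
  have hg₁ := hE.lintegral_tailInt_lt_top
  set g₁ := ∫⁻ x in Ioi 0, tailInt E x with hg₁def
  set t : ℕ → ℝ≥0∞ := fun k => if k = 0 then 1 else ENNReal.ofReal (C * (k : ℝ) ^ (-(2 + δ₀))) with ht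
  set h : ℝ → ℝ≥0∞ := fun w => ENNReal.ofReal ((1 + max w 0) ^ (1 / 4 : ℝ)) with hh
  set B := ENNReal.ofReal M with hB
  have hBtop : B < ∞ := ENNReal.ofReal_lt_top
  have hR := tsum_excWeight_lt_top hC hδ₀ (t := t) (by simp [ht]) (fun k hk => by simp [ht, hk.ne'])
  set R := ∑' n : ℕ, (1 + (n : ℝ≥0∞)) * excWeight t n with hRdef
  set η : ℝ≥0∞ := min 1 (2 * (ē * R))⁻¹ with hη
  have hη1 : η ≤ 1 := min_le_left _ _
  have hη0 : η ≠ 0 := by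
    have h1 : 2 * (ē * R) ≠ ∞ := ENNReal.mul_ne_top (by simp) (ENNReal.mul_ne_top hē hR.ne)
    rw [hη]
    exact (lt_min one_pos (ENNReal.inv_pos.2 h1)).ne'
  have hηtop : η ≠ ∞ := ne_top_of_le_ne_top ENNReal.one_ne_top hη1
  have hsub : ē * η * R ≤ 1 / 2 := by
    calc ē * η * R ≤ ē * (2 * (ē * R))⁻¹ * R := by gcongr; exact min_le_right _ _
      _ = 2⁻¹ * ((ē * R) * (ē * R)⁻¹) := by
          rw [ENNReal.mul_inv (by simp) (by simp)]; ring
      _ ≤ 2⁻¹ * 1 := by gcongr; exact ENNReal.mul_inv_le_one _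
      _ = 1 / 2 := by simp
  set K : ℝ≥0∞ := 1 + 4 * η⁻¹ with hK
  have hKtop : K < ∞ := by
    rw [hK]
    exact ENNReal.add_lt_top.2 ⟨by simp, ENNReal.mul_lt_top (by simp) (ENNReal.inv_lt_top.2 hη0.bot_lt)⟩
  have hηK : 4 ≤ η * K := by
    calc (4 : ℝ≥0∞) = 4 * (η * η⁻¹) := by rw [ENNReal.mul_inv_cancel hη0 hηtop, mul_one]
      _ = η * (4 * η⁻¹) := by ring
      _ ≤ η * K := by gcongr; exact le_add_self
  obtain ⟨Y₀, hY₀⟩ := hE.exists_lintegral_tailInt_le (τ := η / 2)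
    (ENNReal.div_pos hη0 (by simp))
  have hZ : B * (K * g₀ + 2 * B) + (K * g₁ + 2) ≠ ∞ := by
    finiteness
  set z := (B * (K * g₀ + 2 * B) + (K * g₁ + 2)).toReal with hz
  have hz0 : 0 ≤ z := ENNReal.toReal_nonneg
  have hzE : ENNReal.ofReal z = B * (K * g₀ + 2 * B) + (K * g₁ + 2) := ENNReal.ofReal_toReal hZ
  set Y := max (max Y₀ 0) (z ^ 4) with hY
  have hY0 : 0 ≤ Y := (le_max_right _ _).trans (le_max_left _ _)
  have hhpos : ∀ w, 0 ≤ w → h w = ENNReal.ofReal ((1 + w) ^ (1 / 4 : ℝ)) := fun w hw => by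
    simp only [hh, max_eq_left hw]
  have hhsq : ∀ w, 0 ≤ w → h w * h w = rootWeight w := fun w hw => by
    rw [hhpos w hw, rootWeight, ← ENNReal.ofReal_mul (by positivity), ← Real.rpow_add (by positivity)]
    norm_num
  have hone : ∀ w, 0 ≤ w → 1 ≤ h w := fun w hw => by
    rw [hhpos w hw, ← ENNReal.ofReal_one]
    exact ENNReal.ofReal_le_ofReal (Real.one_le_rpow (by linarith) (by norm_num))
  have hhle : ∀ w, 0 ≤ w → h w ≤ rootWeight w := fun w hw => by
    rw [← hhsq w hw]
    exact le_mul_of_one_le_left zero_le (hone w hw)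
  have hbig : ∀ w, Y < w → ENNReal.ofReal z ≤ h w := fun w hw => by
    have hw0 : 0 ≤ w := hY0.trans hw.le
    rw [hhpos w hw0]
    refine ENNReal.ofReal_le_ofReal ?_
    have hzw : z ^ 4 ≤ 1 + w := by linarith [(le_max_right (max Y₀ 0) (z ^ 4)).trans hw.le]
    calc z = (z ^ 4) ^ (1 / 4 : ℝ) := by
          rw [← Real.rpow_natCast, ← Real.rpow_mul hz0]; norm_num
      _ ≤ (1 + w) ^ (1 / 4 : ℝ) := Real.rpow_le_rpow (by positivity) hzw (by norm_num)
  have hctl : ExcursionControl E t h B g₀ g₁ K η Y :=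
    { le_bound := hE.eDens_le
      t_zero := by simp [ht]
      excursion := fun k hk w hw c hc => by
        refine (hexc k hk w hw c hc).trans (le_of_eq ?_)
        rw [hhpos w hw, ENNReal.ofReal_mul (by positivity)]
        simp [ht, hk.ne']
      h_mono := fun a b hab => ENNReal.ofReal_le_ofReal (Real.rpow_le_rpow (by positivity)
        (by gcongr) (by norm_num))
      one_le_h := hone
      h_le := hhle
      one_le_K := le_self_add
      tail_le := htail
      lintegral_tail_le := le_rfl
      Y_nonneg := hY0
      far_atom := fun w hw => by
        have hw0 : 0 ≤ w := hY0.trans hw.le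
        calc B * (K * g₀ + 2 * B) ≤ ENNReal.ofReal z := by rw [hzE]; exact le_self_add
          _ ≤ rootWeight w := (hbig w hw).trans (hhle w hw0)
          _ ≤ _ := le_mul_of_one_le_left zero_le (le_trans (by norm_num) hηK)
      far := fun w hw => by
        have hw0 : 0 ≤ w := hY0.trans hw.le
        calc h w * (K * g₁ + 2) ≤ h w * ENNReal.ofReal z := by rw [hzE]; exact mul_le_mul_right le_add_self _
          _ ≤ h w * h w := by gcongr; exact hbig w hw
          _ = rootWeight w := hhsq w hw0
          _ ≤ _ := le_mul_of_one_le_left zero_le (le_trans (by norm_num) hηK)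
      near := fun w hw => by
        rw [mul_comm]
        refine mul_le_mul' ?_ (hhle w hw.le)
        have h1 : ∫⁻ x in Ioi Y, tailInt E x ≤ η / 2 :=
          hY₀ Y ((le_max_left _ _).trans (le_max_left _ _))
        calc K * (∫⁻ x in Ioi Y, tailInt E x) + 2 ≤ K * (η / 2) + η * K / 2 := by
              gcongr
              rw [ENNReal.le_div_iff_mul_le (by simp) (by simp)]
              exact le_trans (by norm_num) hηK
          _ = η * K / 2 + η * K / 2 := by simp only [div_eq_mul_inv]; ring
          _ = η * K := ENNReal.add_halves _ }
  set D := (K * g₀ + 2 * B) / η with hD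
  have hDtop : D ≠ ∞ := ENNReal.div_ne_top (by finiteness) hη0
  have hDle : ē * (K * g₀ + 2 * B) ≤ ē * η * D := by
    rw [mul_assoc, hD, ENNReal.mul_div_cancel hη0 hηtop]
  set Q := (1 + D) * (K * g₀ + 2 * B) + ē * h Y * (1 + D) * (B * (K * g₀ + 2 * B) + K * g₁ + 2) with hQ
  have hhY : h Y ≠ ∞ := ENNReal.ofReal_ne_top
  have hQtop : Q ≠ ∞ := by finiteness
  have hη'0 : ē * η ≠ 0 := mul_ne_zero hē0 hη0
  have hη'top : ē * η ≠ ∞ := ENNReal.mul_ne_top hē hηtop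
  refine ⟨Y, hY0, fun n => (ē * η)⁻¹ * Q * renewalSeq (ē * (1 + B)) (ē * η) (excWeight t) n, ?_, ?_⟩
  · have hs := tsum_renewalSeq_le (A := ē * (1 + B)) (by finiteness) hη'top.lt_top hR hsub
    have : ∑' n : ℕ, (1 + (n : ℝ≥0∞)) * ((ē * η)⁻¹ * Q *
        renewalSeq (ē * (1 + B)) (ē * η) (excWeight t) n) = (ē * η)⁻¹ * Q *
        ∑' n : ℕ, (1 + (n : ℝ≥0∞)) * renewalSeq (ē * (1 + B)) (ē * η) (excWeight t) n := by
      rw [← ENNReal.tsum_mul_left]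
      exact tsum_congr fun n => by ring
    rw [this]
    refine ENNReal.mul_lt_top (ENNReal.mul_lt_top (ENNReal.inv_lt_top.2 hη'0.bot_lt) hQtop.lt_top)
      (hs.trans_lt ?_)
    finiteness
  · intro e he f hf b F hF n hn y hy hyY
    have := hF.step_start_le hE hctl le_rfl hf he hη1 hDle hn hy hyY
    calc step E e (F n) (0, y) = (ē * η)⁻¹ * (ē * η * step E e (F n) (0, y)) := by
          rw [← mul_assoc, ENNReal.inv_mul_cancel hη'0 hη'top, one_mul]
      _ ≤ (ē * η)⁻¹ * (Q * (f 0 + ∫⁻ x in Ioc 0 Y, f x) *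
          renewalSeq (ē * (1 + B)) (ē * η) (excWeight t) (n + 2)) := mul_le_mul_right this _
      _ = _ := by ring

/-- The indicator of the origin. -/
def atOrigin : ℝ × ℝ → ℝ≥0∞ := ({(0, 0)} : Set (ℝ × ℝ)).indicator 1

/-- Weight of the loops of length `n` at the origin. -/
def loopWeight (E : ℝ → ℝ) (e : ℝ≥0∞) (n : ℕ) : ℝ≥0∞ := (step E e)^[n] atOrigin (0, 0)

/-- One step followed by killing on `A`. -/
def killStep (E : ℝ → ℝ) (e : ℝ≥0∞) (A : Set (ℝ × ℝ)) (f : ℝ × ℝ → ℝ≥0∞) : ℝ × ℝ → ℝ≥0∞ :=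
  Aᶜ.indicator (step E e f)

/-- States just after a contact, at height at most `Y`. -/
def afterContact (Y : ℝ) : Set (ℝ × ℝ) := {0} ×ˢ Icc 0 Y

/-- States at a contact, preceded by a height at most `Y`. -/
def beforeContact (Y : ℝ) : Set (ℝ × ℝ) := Iic Y ×ˢ {0}

lemma measurable_atOrigin : Measurable atOrigin :=
  measurable_one.indicator (measurableSet_singleton _)

lemma measurableSet_afterContact (Y : ℝ) : MeasurableSet (afterContact Y) :=
  (measurableSet_singleton 0).prod measurableSet_Icc

lemma measurableSet_beforeContact (Y : ℝ) : MeasurableSet (beforeContact Y) :=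
  measurableSet_Iic.prod (measurableSet_singleton 0)

lemma killStep_mono (E : ℝ → ℝ) (e : ℝ≥0∞) (A : Set (ℝ × ℝ)) : Monotone (killStep E e A) :=
  fun _ _ hfg s => indicator_le_indicator (step_mono E e hfg s)

lemma killStep_le_step (E : ℝ → ℝ) (e : ℝ≥0∞) (A : Set (ℝ × ℝ)) (f : ℝ × ℝ → ℝ≥0∞) :
    killStep E e A f ≤ step E e f := indicator_le_self _ _

lemma step_eq_add_killStep (E : ℝ → ℝ) (e : ℝ≥0∞) (A : Set (ℝ × ℝ)) (f : ℝ × ℝ → ℝ≥0∞) (s : ℝ × ℝ) :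
    step E e f s = A.indicator (step E e f) s + killStep E e A f s := by
  rw [killStep, indicator_self_add_compl_apply]

namespace IsStepDensity

variable {E : ℝ → ℝ} {σ M : ℝ}

lemma measurable_iterate_step (h : IsStepDensity E σ M) (e : ℝ≥0∞) {f : ℝ × ℝ → ℝ≥0∞}
    (hf : Measurable f) (n : ℕ) : Measurable ((step E e)^[n] f) := by
  induction n with
  | zero => exact hf
  | succ n ih => rw [Function.iterate_succ_apply']; exact h.measurable_step e ih

lemma measurable_killStep (h : IsStepDensity E σ M) (e : ℝ≥0∞) {A : Set (ℝ × ℝ)}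
    (hA : MeasurableSet A) {f : ℝ × ℝ → ℝ≥0∞} (hf : Measurable f) : Measurable (killStep E e A f) :=
  (h.measurable_step e hf).indicator hA.compl

lemma measurable_iterate_killStep (h : IsStepDensity E σ M) (e : ℝ≥0∞) {A : Set (ℝ × ℝ)}
    (hA : MeasurableSet A) {f : ℝ × ℝ → ℝ≥0∞} (hf : Measurable f) (n : ℕ) :
    Measurable ((killStep E e A)^[n] f) := by
  induction n with
  | zero => exact hf
  | succ n ih => rw [Function.iterate_succ_apply']; exact h.measurable_killStep e hA ih

lemma step_sum (h : IsStepDensity E σ M) (e : ℝ≥0∞) {ι : Type*} (s : Finset ι)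
    {f : ι → ℝ × ℝ → ℝ≥0∞} (hf : ∀ i ∈ s, Measurable (f i)) :
    step E e (fun q => ∑ i ∈ s, f i q) = fun p => ∑ i ∈ s, step E e (f i) p := by
  funext p
  simp only [step, stepZero]
  rw [h.stepPos_sum s hf, Finset.sum_add_distrib, Finset.mul_sum, Finset.mul_sum]

lemma iterate_step_sum (h : IsStepDensity E σ M) (e : ℝ≥0∞) {ι : Type*} (s : Finset ι)
    {f : ι → ℝ × ℝ → ℝ≥0∞} (hf : ∀ i ∈ s, Measurable (f i)) (n : ℕ) :
    (step E e)^[n] (fun q => ∑ i ∈ s, f i q) = fun p => ∑ i ∈ s, (step E e)^[n] (f i) p := by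
  induction n with
  | zero => rfl
  | succ n ih =>
    simp only [Function.iterate_succ_apply', ih]
    exact h.step_sum e s fun i hi => h.measurable_iterate_step e (hf i hi) n

lemma step_const_mul (h : IsStepDensity E σ M) (e a : ℝ≥0∞) {f : ℝ × ℝ → ℝ≥0∞}
    (hf : Measurable f) : step E e (fun p => a * f p) = fun p => a * step E e f p := by
  funext s
  simp only [step, stepZero, h.stepPos_const_mul a hf]
  ring

lemma iterate_step_const_mul (h : IsStepDensity E σ M) (e a : ℝ≥0∞) {f : ℝ × ℝ → ℝ≥0∞}
    (hf : Measurable f) (n : ℕ) :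
    (step E e)^[n] (fun p => a * f p) = fun p => a * (step E e)^[n] f p := by
  induction n with
  | zero => rfl
  | succ n ih =>
    simp only [Function.iterate_succ_apply', ih]
    exact h.step_const_mul e a (h.measurable_iterate_step e hf n)

lemma killStep_sum (h : IsStepDensity E σ M) (e : ℝ≥0∞) (A : Set (ℝ × ℝ)) {ι : Type*} (s : Finset ι)
    {f : ι → ℝ × ℝ → ℝ≥0∞} (hf : ∀ i ∈ s, Measurable (f i)) :
    killStep E e A (fun q => ∑ i ∈ s, f i q) = fun p => ∑ i ∈ s, killStep E e A (f i) p := by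
  funext p
  rw [killStep, h.step_sum e s hf]
  by_cases hp : p ∈ Aᶜ <;> simp [killStep, hp]

lemma iterate_killStep_sum (h : IsStepDensity E σ M) (e : ℝ≥0∞) {A : Set (ℝ × ℝ)}
    (hA : MeasurableSet A) {ι : Type*} (s : Finset ι)
    {f : ι → ℝ × ℝ → ℝ≥0∞} (hf : ∀ i ∈ s, Measurable (f i)) (n : ℕ) :
    (killStep E e A)^[n] (fun q => ∑ i ∈ s, f i q) = fun p => ∑ i ∈ s, (killStep E e A)^[n] (f i) p := by
  induction n with
  | zero => rfl
  | succ n ih =>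
    simp only [Function.iterate_succ_apply', ih]
    exact h.killStep_sum e A s fun i hi => h.measurable_iterate_killStep e hA (hf i hi) n

/-- Decomposition according to the last visit of `A`. -/
lemma iterate_step_le_sum_last (h : IsStepDensity E σ M) (e : ℝ≥0∞) {A : Set (ℝ × ℝ)}
    (hA : MeasurableSet A) {o : ℝ × ℝ} (ho : o ∈ A) (n : ℕ) {f : ℝ × ℝ → ℝ≥0∞} (hf : Measurable f) :
    (step E e)^[n + 1] f o ≤ ∑ i ∈ Finset.range (n + 1),
      (step E e)^[i] (A.indicator (step E e ((killStep E e A)^[n - i] f))) o := by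
  induction n generalizing f with
  | zero => simp [indicator_of_mem ho]
  | succ n ih =>
    rw [Finset.sum_range_succ, Function.iterate_succ_apply]
    have hsplit : step E e f = fun s => ∑ j : Fin 2,
        (![killStep E e A f, A.indicator (step E e f)] j) s := by
      funext s
      rw [Fin.sum_univ_two, add_comm]
      exact step_eq_add_killStep E e A f s
    rw [hsplit, h.iterate_step_sum]
    · beta_reduce
      rw [Fin.sum_univ_two]
      refine add_le_add ((ih (h.measurable_killStep e hA hf)).trans (Finset.sum_le_sum fun i hi => ?_))
        (by simp)
      have : n + 1 - i = (n - i) + 1 := by have := Finset.mem_range.1 hi; omega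
      rw [this, Function.iterate_succ_apply]
    · intro j _
      fin_cases j
      · exact h.measurable_killStep e hA hf
      · exact (h.measurable_step e hf).indicator hA

/-- Decomposition according to the first visit of `A`. -/
lemma iterate_step_le_sum_first (h : IsStepDensity E σ M) (e : ℝ≥0∞) {A : Set (ℝ × ℝ)}
    (hA : MeasurableSet A) {f : ℝ × ℝ → ℝ≥0∞} (hf : Measurable f) (hfA : ∀ s ∉ A, f s = 0) (n : ℕ)
    (s : ℝ × ℝ) :
    (step E e)^[n] f s ≤ ∑ b ∈ Finset.range (n + 1),
      (killStep E e A)^[b] (A.indicator ((step E e)^[n - b] f)) s := by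
  induction n generalizing s with
  | zero =>
    by_cases hs : s ∈ A
    · simp [hs]
    · simp [hfA s hs]
  | succ n ih =>
    rw [Function.iterate_succ_apply', step_eq_add_killStep E e A, Finset.sum_range_succ', add_comm]
    refine add_le_add ?_ (by simp [Function.iterate_succ_apply'])
    refine (killStep_mono E e A ih s).trans (le_of_eq ?_)
    have hm : ∀ b ∈ Finset.range (n + 1), Measurable
        ((killStep E e A)^[b] (A.indicator ((step E e)^[n - b] f))) := fun b _ =>
      h.measurable_iterate_killStep e hA ((h.measurable_iterate_step e hf _).indicator hA) b
    rw [h.killStep_sum e A _ hm]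
    refine Finset.sum_congr rfl fun b _ => ?_
    rw [Function.iterate_succ_apply', Nat.add_sub_add_right]

/-- The killed word between the last visit after a contact and the first visit before a contact. -/
lemma isKilledWord (h : IsStepDensity E σ M) (e : ℝ≥0∞) {Y : ℝ} (b : ℕ) {u : ℝ × ℝ → ℝ≥0∞}
    (hu : Measurable u) :
    IsKilledWord E e Y (fun x => u (x, 0)) b (fun n => if n ≤ b then
      (killStep E e (beforeContact Y))^[n] ((beforeContact Y).indicator u) else
      (killStep E e (afterContact Y))^[n - b - 1] (step E e
        ((killStep E e (beforeContact Y))^[b] ((beforeContact Y).indicator u)))) where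
  measurable n := by
    have h1 : ∀ n, Measurable ((killStep E e (beforeContact Y))^[n] ((beforeContact Y).indicator u)) :=
      h.measurable_iterate_killStep e (measurableSet_beforeContact Y)
        (hu.indicator (measurableSet_beforeContact Y))
    split_ifs
    · exact h1 n
    · exact h.measurable_iterate_killStep e (measurableSet_afterContact Y) (h.measurable_step e (h1 b)) _
  zero_of_pos u v hv := by simp [beforeContact, hv.ne']
  contact_zero_le x := by
    by_cases hx : x ≤ Y <;> simp [beforeContact, hx, indicator]
  succ_le n := by
    rcases lt_trichotomy n b with hn | rfl | hn
    · rw [if_pos (by omega), if_pos (by omega), Function.iterate_succ_apply']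
      exact killStep_le_step _ _ _ _
    · rw [if_neg (by omega), if_pos le_rfl]
      simp
    · rw [if_neg (by omega), if_neg (by omega), show n + 1 - b - 1 = (n - b - 1) + 1 by omega,
        Function.iterate_succ_apply']
      exact killStep_le_step _ _ _ _
  early n hn x hx hxY := by
    rw [if_pos (by omega), Function.iterate_succ_apply', killStep, indicator_of_notMem]
    simp [beforeContact, hxY]
  late n hn w hw hwY := by
    rw [if_neg (by omega), show n + 1 - b - 1 = (n - b - 1) + 1 by omega,
        Function.iterate_succ_apply', killStep, indicator_of_notMem]
    simp [afterContact, hw, hwY]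

/-- Loops decomposed around a fixed time, in terms of visits of compact sets. -/
lemma loopWeight_le (h : IsStepDensity E σ M) {e : ℝ≥0∞} {Y : ℝ} (hY : 0 ≤ Y) {δ : ℕ → ℝ≥0∞}
    (hδ : ∀ f : ℝ → ℝ≥0∞, Measurable f → ∀ b F,
      IsKilledWord E e Y f b F → ∀ n, 0 < n → ∀ y, 0 ≤ y → y ≤ Y →
        step E e (F n) (0, y) ≤ (f 0 + ∫⁻ x in Ioc 0 Y, f x) * δ (n + 2)) (L m : ℕ) :
    loopWeight E e (L + 2 + m) ≤ ∑ i ∈ Finset.range (L + 1), ∑ b ∈ Finset.range (m + 1),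
      (step E e)^[i] ((afterContact Y).indicator 1) (0, 0) * δ (L - i + b + 3) *
        ((step E e)^[m - b] atOrigin (0, 0) +
          ∫⁻ x in Ioc 0 Y, (step E e)^[m - b] atOrigin (x, 0)) := by
  have hA := measurableSet_afterContact Y
  have hB := measurableSet_beforeContact Y
  have hu : ∀ n, Measurable ((step E e)^[n] atOrigin) := h.measurable_iterate_step e measurable_atOrigin
  set W : ℕ → ℝ × ℝ → ℝ≥0∞ := fun b => (killStep E e (beforeContact Y))^[b]
    ((beforeContact Y).indicator ((step E e)^[m - b] atOrigin)) with hW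
  have hWm : ∀ b, Measurable (W b) := fun b =>
    h.measurable_iterate_killStep e hB ((hu _).indicator hB) b
  rw [loopWeight, show L + 2 + m = (L + 1) + (1 + m) by omega, Function.iterate_add_apply]
  have h1 : (step E e)^[1 + m] atOrigin ≤ fun s => ∑ b ∈ Finset.range (m + 1), step E e (W b) s := by
    rw [Function.iterate_add_apply, Function.iterate_one, ← h.step_sum e _ fun b _ => hWm b]
    refine step_mono E e fun s => h.iterate_step_le_sum_first e hB measurable_atOrigin ?_ m s
    intro s hs
    rw [atOrigin, indicator_of_notMem]
    rintro rfl
    exact hs (by simp [beforeContact, hY])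
  refine ((step_mono E e).iterate (L + 1) h1 (0, 0)).trans ?_
  refine (h.iterate_step_le_sum_last e hA (by simp [afterContact, hY]) L
    (Finset.measurable_fun_sum _ fun b _ => h.measurable_step e (hWm b))).trans ?_
  refine Finset.sum_le_sum fun i hi => ?_
  have hiL := Finset.mem_range.1 hi
  rw [h.iterate_killStep_sum e hA _ fun b _ => h.measurable_step e (hWm b)]
  have hKm : ∀ b, Measurable ((killStep E e (afterContact Y))^[L - i] (step E e (W b))) := fun b =>
    h.measurable_iterate_killStep e hA (h.measurable_step e (hWm b)) _
  rw [h.step_sum e _ fun b _ => hKm b]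
  set Λ : ℕ → ℝ≥0∞ := fun b => (step E e)^[m - b] atOrigin (0, 0) +
    ∫⁻ x in Ioc 0 Y, (step E e)^[m - b] atOrigin (x, 0) with hΛ
  have h2 : (afterContact Y).indicator (fun p => ∑ b ∈ Finset.range (m + 1),
      step E e ((killStep E e (afterContact Y))^[L - i] (step E e (W b))) p) ≤
      fun s => (∑ b ∈ Finset.range (m + 1), Λ b * δ (L - i + b + 3)) * (afterContact Y).indicator 1 s := by
    intro s
    by_cases hs : s ∈ afterContact Y
    · obtain ⟨x, y⟩ := s
      simp only [afterContact, mem_prod, mem_singleton_iff, mem_Icc] at hs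
      obtain ⟨rfl, hy, hyY⟩ := hs
      have hs' : ((0 : ℝ), y) ∈ afterContact Y := by simp [afterContact, hy, hyY]
      rw [indicator_of_mem hs']
      beta_reduce
      rw [indicator_of_mem hs', Pi.one_apply, mul_one]
      refine Finset.sum_le_sum fun b _ => ?_
      have := hδ (fun x => (step E e)^[m - b] atOrigin (x, 0))
        ((hu _).comp (measurable_id.prodMk measurable_const)) b _
        (h.isKilledWord e b (hu (m - b))) (L - i + b + 1) (by omega) y hy hyY
      rw [if_neg (by omega), show L - i + b + 1 - b - 1 = L - i by omega] at this
      exact this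
    · rw [indicator_of_notMem hs]; exact zero_le
  refine ((step_mono E e).iterate i h2 (0, 0)).trans ?_
  rw [h.iterate_step_const_mul e _ (measurable_one.indicator hA)]
  beta_reduce
  rw [Finset.sum_mul]
  refine Finset.sum_le_sum fun b _ => le_of_eq ?_
  ring

end IsStepDensity

lemma step_weight_mono (E : ℝ → ℝ) {e e' : ℝ≥0∞} (he : e ≤ e') (f : ℝ × ℝ → ℝ≥0∞) :
    step E e f ≤ step E e' f := fun _ => add_le_add (mul_le_mul_left he _) le_rfl

lemma iterate_step_weight_mono (E : ℝ → ℝ) {e e' : ℝ≥0∞} (he : e ≤ e') (f : ℝ × ℝ → ℝ≥0∞) (n : ℕ) :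
    (step E e)^[n] f ≤ (step E e')^[n] f := by
  induction n with
  | zero => exact le_rfl
  | succ n ih =>
    rw [Function.iterate_succ_apply', Function.iterate_succ_apply']
    exact (step_mono E e ih).trans (step_weight_mono E he _)

/-- A nonnegative path with small second differences which starts at `0`, visits `y` at time `1`
and is absorbed at `0` at time `K + 1`. -/
def bridgePath (K : ℕ) (y : ℝ) (j : ℕ) : ℝ := y * (j * ((K + 1 - j : ℕ) : ℝ) ^ 2 / (K : ℝ) ^ 2)

lemma bridgePath_zero (K : ℕ) (y : ℝ) : bridgePath K y 0 = 0 := by simp [bridgePath]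

lemma bridgePath_one {K : ℕ} (hK : 0 < K) (y : ℝ) : bridgePath K y 1 = y := by
  have : (K : ℝ) ≠ 0 := by positivity
  simp [bridgePath, this]

lemma bridgePath_eq_zero (K : ℕ) (y : ℝ) {j : ℕ} (hj : K + 1 ≤ j) : bridgePath K y j = 0 := by
  simp [bridgePath, Nat.sub_eq_zero_of_le hj]

lemma bridgePath_nonneg (K : ℕ) {y : ℝ} (hy : 0 ≤ y) (j : ℕ) : 0 ≤ bridgePath K y j := by
  unfold bridgePath; positivity

lemma abs_secondDiff_bridgePath_le {K : ℕ} (hK : 0 < K) {y : ℝ} (hy : 0 ≤ y) (j : ℕ) :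
    |bridgePath K y (j + 2) + bridgePath K y j - 2 * bridgePath K y (j + 1)| ≤ y * (8 / K) := by
  have hK1 : (1 : ℝ) ≤ K := by exact_mod_cast hK
  have hfac : bridgePath K y (j + 2) + bridgePath K y j - 2 * bridgePath K y (j + 1) =
      y * (((j + 2 : ℕ) * ((K + 1 - (j + 2) : ℕ) : ℝ) ^ 2 + j * ((K + 1 - j : ℕ) : ℝ) ^ 2 -
        2 * ((j + 1 : ℕ) * ((K + 1 - (j + 1) : ℕ) : ℝ) ^ 2)) / (K : ℝ) ^ 2) := by
    unfold bridgePath; ring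
  rw [hfac, abs_mul, abs_of_nonneg hy, abs_div, abs_of_nonneg (by positivity : (0 : ℝ) ≤ (K : ℝ) ^ 2)]
  refine mul_le_mul_of_nonneg_left ?_ hy
  rw [div_le_div_iff₀ (by positivity) (by positivity), show (8 : ℝ) * (K : ℝ) ^ 2 = 8 * K * K by ring]
  refine mul_le_mul_of_nonneg_right ?_ (by positivity)
  rw [abs_le]
  rcases lt_trichotomy j K with hj | rfl | hj
  · obtain ⟨l, rfl⟩ := Nat.exists_eq_add_of_lt hj
    rw [show j + l + 1 + 1 - (j + 2) = l by omega, show j + l + 1 + 1 - j = l + 2 by omega,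
      show j + l + 1 + 1 - (j + 1) = l + 1 by omega]
    push_cast
    constructor <;> nlinarith
  · rw [show j + 1 - (j + 2) = 0 by omega, show j + 1 - j = 1 by omega, Nat.sub_self]
    push_cast
    constructor <;> nlinarith
  · rw [show K + 1 - (j + 2) = 0 by omega, show K + 1 - j = 0 by omega,
      show K + 1 - (j + 1) = 0 by omega]
    push_cast
    constructor <;> nlinarith

/-- `E` is bounded below by `c` on `[-r, r]`. -/
def LowerBoundNear (E : ℝ → ℝ) (r : ℝ) (c : ℝ≥0∞) : Prop := ∀ x, |x| ≤ r → c ≤ eDens E x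

lemma LowerBoundNear.le_step {E : ℝ → ℝ} {r : ℝ} {c : ℝ≥0∞} (hc : LowerBoundNear E r c) (e : ℝ≥0∞)
    {p q t u v : ℝ} (hp : |t + p - 2 * q| ≤ r / 2) (hu : |u - p| ≤ r / 8) (hv : |v - q| ≤ r / 8)
    {f : ℝ × ℝ → ℝ≥0∞} (hf : Measurable f) :
    c * ∫⁻ w in Ioi 0 ∩ Icc (t - r / 8) (t + r / 8), f (v, w) ≤ step E e f (u, v) := by
  refine le_trans ?_ (le_add_self : stepPos E f (u, v) ≤ _)
  rw [stepPos, ← lintegral_const_mul _ (by fun_prop)]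
  refine (setLIntegral_mono' (measurableSet_Ioi.inter measurableSet_Icc) fun w hw => ?_).trans
    (lintegral_mono_set inter_subset_left)
  refine mul_le_mul_left (hc _ ?_) _
  have h1 := abs_le.1 hp
  have h2 := abs_le.1 hu
  have h3 := abs_le.1 hv
  have h4 := hw.2
  rw [mem_Icc] at h4
  rw [abs_le]
  constructor <;> dsimp only <;> linarith

lemma LowerBoundNear.le_iterate_step {E : ℝ → ℝ} {r : ℝ} {c : ℝ≥0∞} (hc : LowerBoundNear E r c)
    (e : ℝ≥0∞) (n : ℕ) {p : ℕ → ℝ} (hp0 : ∀ j, 0 ≤ p j)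
    (hp : ∀ j < n, |p (j + 2) + p j - 2 * p (j + 1)| ≤ r / 2) {f : ℝ × ℝ → ℝ≥0∞} (hf : Measurable f)
    (hstep : ∀ g, Measurable g → Measurable (step E e g)) {a : ℝ≥0∞}
    (hfa : ∀ u v, |u - p n| ≤ r / 8 → |v - p (n + 1)| ≤ r / 8 → a ≤ f (u, v)) (u v : ℝ)
    (hu : |u - p 0| ≤ r / 8) (hv : |v - p 1| ≤ r / 8) :
    (c * ENNReal.ofReal (r / 8)) ^ n * a ≤ (step E e)^[n] f (u, v) := by
  induction n generalizing f a with
  | zero => simpa using hfa u v hu hv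
  | succ n ih =>
    rw [Function.iterate_succ_apply, pow_succ, mul_assoc]
    refine ih (fun j hj => hp j (by omega)) (hstep f hf) fun u v hu hv => ?_
    refine le_trans ?_ (hc.le_step e (hp n (by omega)) hu hv hf)
    rw [mul_assoc]
    refine mul_le_mul_right ?_ _
    calc ENNReal.ofReal (r / 8) * a ≤ ∫⁻ w in Ioc (p (n + 2)) (p (n + 2) + r / 8), a := by
          rw [setLIntegral_const, Real.volume_Ioc, mul_comm]
          simp
      _ ≤ ∫⁻ w in Ioi 0 ∩ Icc (p (n + 2) - r / 8) (p (n + 2) + r / 8), a := by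
          refine lintegral_mono_set fun w hw => ?_
          have := hp0 (n + 2)
          rw [mem_Ioc] at hw
          refine ⟨mem_Ioi.2 (by linarith), mem_Icc.2 ⟨by linarith, hw.2⟩⟩
      _ ≤ _ := setLIntegral_mono' (measurableSet_Ioi.inter measurableSet_Icc) fun w hw =>
          hfa v w hv (by
            have := mem_Icc.1 hw.2
            rw [abs_le]; constructor <;> linarith)

lemma LowerBoundNear.contact_le_step {E : ℝ → ℝ} {r : ℝ} {c : ℝ≥0∞} (hc : LowerBoundNear E r c)
    (e : ℝ≥0∞) {u v : ℝ} (huv : |u - 2 * v| ≤ r) (f : ℝ × ℝ → ℝ≥0∞) :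
    e * c * f (v, 0) ≤ step E e f (u, v) := by
  refine le_trans ?_ (le_self_add : e * stepZero E (fun x => f (x, 0)) (u, v) ≤ _)
  rw [mul_assoc]
  exact mul_le_mul_right (mul_le_mul_left (hc _ huv) _) _

namespace IsStepDensity

variable {E : ℝ → ℝ} {σ M : ℝ}

lemma exists_lowerBoundNear (h : IsStepDensity E σ M) :
    ∃ r c, 0 < r ∧ c ≠ 0 ∧ c ≠ ∞ ∧ LowerBoundNear E r c := by
  obtain ⟨r, a, hr, -, ha, hE⟩ := h.exists_lower
  exact ⟨r, ENNReal.ofReal a, hr, by simpa using ha, by simp, fun x hx =>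
    ENNReal.ofReal_le_ofReal (hE x hx)⟩

/-- From a state just after a contact at bounded height, the origin is reached with weight bounded
below. -/
lemma exists_afterContact_le (h : IsStepDensity E σ M) {e₀ : ℝ≥0∞} (he₀ : e₀ ≠ 0) (he₀' : e₀ ≠ ∞)
    (Y : ℝ) : ∃ (k : ℕ) (a : ℝ≥0∞), a ≠ 0 ∧ a ≠ ∞ ∧ ∀ e, e₀ ≤ e →
      (fun s => a * (afterContact Y).indicator 1 s) ≤ (step E e)^[k] atOrigin := by
  obtain ⟨r, c, hr, hc0, hct, hc⟩ := h.exists_lowerBoundNear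
  obtain ⟨K, hK⟩ := exists_nat_gt (16 * |Y| / r)
  have hK0 : 0 < K := by
    have : (0 : ℝ) < K := lt_of_le_of_lt (by positivity) hK
    exact_mod_cast this
  refine ⟨K + 1 + 2, (c * ENNReal.ofReal (r / 8)) ^ (K + 1) * (e₀ * c * (e₀ * c)), ?_, ?_,
    fun e he => ?_⟩
  · have : ENNReal.ofReal (r / 8) ≠ 0 := by simpa using hr
    simp [*]
  · finiteness
  refine le_trans ?_ (iterate_step_weight_mono E he _ _)
  rintro ⟨u, v⟩
  beta_reduce
  by_cases hs : (u, v) ∈ afterContact Y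
  swap
  · rw [indicator_of_notMem hs]; simp
  rw [indicator_of_mem hs, Pi.one_apply, mul_one, Function.iterate_add_apply]
  simp only [afterContact, mem_prod, mem_singleton_iff, mem_Icc] at hs
  obtain ⟨rfl, hv, hvY⟩ := hs
  refine hc.le_iterate_step e₀ (K + 1) (p := bridgePath K v) (bridgePath_nonneg K hv) (fun j _ => ?_)
    (h.measurable_iterate_step e₀ measurable_atOrigin 2) (fun g hg => h.measurable_step e₀ hg)
    (fun x y hx hy => ?_) 0 v (by simp [bridgePath_zero]; positivity)
    (by simp [bridgePath_one hK0]; positivity)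
  · refine (abs_secondDiff_bridgePath_le hK0 hv j).trans ?_
    have hK' : (0 : ℝ) < K := by exact_mod_cast hK0
    rw [div_lt_iff₀ hr] at hK
    rw [← mul_div_assoc, div_le_iff₀ hK']
    nlinarith [le_abs_self Y]
  · rw [bridgePath_eq_zero K v (by omega), sub_zero] at hx hy
    have hxy : |x - 2 * y| ≤ r := by
      rw [abs_le] at *; constructor <;> linarith
    have hy' : |y - 2 * 0| ≤ r := by
      rw [abs_le] at *; constructor <;> linarith
    calc e₀ * c * (e₀ * c) = e₀ * c * (e₀ * c * atOrigin (0, 0)) := by simp [atOrigin]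
      _ ≤ e₀ * c * step E e₀ atOrigin (y, 0) := mul_le_mul_right (hc.contact_le_step e₀ hy' _) _
      _ ≤ _ := hc.contact_le_step e₀ hxy _

lemma le_iterate_step_origin {r : ℝ} {c : ℝ≥0∞} (hr : 0 ≤ r) (hc : LowerBoundNear E r c) (e : ℝ≥0∞)
    (n : ℕ) (g : ℝ × ℝ → ℝ≥0∞) : (e * c) ^ n * g (0, 0) ≤ (step E e)^[n] g (0, 0) := by
  induction n with
  | zero => simp
  | succ n ih =>
    rw [Function.iterate_succ_apply', pow_succ', mul_assoc]
    exact (mul_le_mul_right ih _).trans (hc.contact_le_step e (by simpa using hr) _)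

/-- From the origin, every contact state at bounded previous height is reached with density bounded
below. -/
lemma exists_contact_integral_le (h : IsStepDensity E σ M) {e₀ : ℝ≥0∞} (he₀ : e₀ ≠ 0)
    (he₀' : e₀ ≠ ∞) {Y : ℝ} (hY : 0 ≤ Y) : ∃ (k : ℕ) (C : ℝ≥0∞), C ≠ ∞ ∧ ∀ e, e₀ ≤ e →
      ∀ g : ℝ × ℝ → ℝ≥0∞, Measurable g →
        g (0, 0) + ∫⁻ x in Ioc 0 Y, g (x, 0) ≤ C * (step E e)^[k] g (0, 0) := by
  obtain ⟨r, c, hr, hc0, hct, hc⟩ := h.exists_lowerBoundNear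
  obtain ⟨n, hn⟩ := exists_nat_gt (16 * (Y + r) / r)
  have hr0 : ENNReal.ofReal (r / 8) ≠ 0 := by simpa using hr
  set A := (c * ENNReal.ofReal (r / 8)) ^ n * (c * (e₀ * c)) with hA
  have hA0 : A ≠ 0 := by simp [*]
  have hAt : A ≠ ∞ := by finiteness
  have hpath : ∀ x, 0 ≤ x → x ≤ Y + r → ∀ g : ℝ × ℝ → ℝ≥0∞, Measurable g →
      A * ∫⁻ w in Ioi 0 ∩ Icc (x - r / 8) (x + r / 8), g (w, 0) ≤ (step E e₀)^[n + 2] g (0, 0) := by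
    intro x hx hxY g hg
    have hdiff : ∀ j, |bridgePath (n + 1) x (j + 2) + bridgePath (n + 1) x j -
        2 * bridgePath (n + 1) x (j + 1)| ≤ r / 2 := fun j => by
      refine (abs_secondDiff_bridgePath_le n.succ_pos hx j).trans ?_
      rw [div_lt_iff₀ hr] at hn
      rw [← mul_div_assoc, div_le_iff₀ (by positivity)]
      push_cast
      nlinarith
    have hone : bridgePath (n + 1) x 1 = x := bridgePath_one n.succ_pos x
    rw [Function.iterate_add_apply, hA, mul_assoc]
    refine hc.le_iterate_step e₀ n (p := fun j => bridgePath (n + 1) x (n + 3 - j))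
      (fun j => bridgePath_nonneg _ hx _) (fun j hj => ?_) (h.measurable_iterate_step e₀ hg 2)
      (fun g hg => h.measurable_step e₀ hg) (fun u v hu hv => ?_) 0 0
      (by rw [bridgePath_eq_zero _ _ (by omega)]; simp; positivity)
      (by rw [bridgePath_eq_zero _ _ (by omega)]; simp; positivity)
    · have := hdiff (n + 1 - j)
      rw [show n + 3 - j = n + 1 - j + 2 by omega, show n + 3 - (j + 1) = n + 1 - j + 1 by omega,
        show n + 3 - (j + 2) = n + 1 - j by omega]
      rwa [add_comm (bridgePath (n + 1) x (n + 1 - j))]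
    · rw [show n + 3 - n = 3 by omega] at hu
      rw [show n + 3 - (n + 1) = 2 by omega] at hv
      have h1 := hdiff 1
      have h0 := abs_le.1 (hdiff 0)
      rw [bridgePath_zero, zero_add, zero_add, hone] at h0
      rw [show 1 + 2 = 3 from rfl, show 1 + 1 = 2 from rfl, hone, add_comm] at h1
      refine le_trans ?_ (hc.le_step e₀ h1 hu hv (h.measurable_step e₀ hg))
      rw [mul_assoc, ← lintegral_const_mul _ (by fun_prop)]
      refine mul_le_mul_right (setLIntegral_mono' (measurableSet_Ioi.inter measurableSet_Icc)
        fun w hw => hc.contact_le_step e₀ ?_ g) _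
      have h2 := mem_Icc.1 hw.2
      have h3 := abs_le.1 hv
      rw [abs_le]
      constructor <;> linarith
  obtain ⟨Q, hQ⟩ : ∃ Q : ℕ, Q = ⌊8 * Y / r⌋₊ := ⟨_, rfl⟩
  have hQY : (Q : ℝ) * (r / 8) ≤ Y := by
    have := Nat.floor_le (by positivity : 0 ≤ 8 * Y / r)
    rw [← hQ, le_div_iff₀ hr] at this
    linarith
  have hcover : Ioc 0 Y ⊆ ⋃ i : Fin (Q + 1),
      (Ioi 0 ∩ Icc (((i : ℕ) : ℝ) * (r / 8) - r / 8) (((i : ℕ) : ℝ) * (r / 8) + r / 8)) := by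
    intro x hx
    rw [mem_Ioc] at hx
    have hx8 : 0 ≤ 8 * x / r := by have := hx.1; positivity
    have hl := Nat.floor_le hx8
    have hu := (Nat.lt_floor_add_one (8 * x / r)).le
    rw [le_div_iff₀ hr] at hl
    rw [div_le_iff₀ hr] at hu
    have hmono : ⌊8 * x / r⌋₊ ≤ Q := by
      rw [hQ]; exact Nat.floor_le_floor (by gcongr; exact hx.2)
    rw [mem_iUnion]
    exact ⟨⟨⌊8 * x / r⌋₊, by omega⟩, mem_Ioi.2 hx.1, mem_Icc.2 ⟨by linarith, by linarith⟩⟩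
  refine ⟨n + 2, ((e₀ * c) ^ (n + 2))⁻¹ + (Q + 1 : ℕ) * A⁻¹, ?_, fun e he g hg => ?_⟩
  · have : (e₀ * c) ^ (n + 2) ≠ 0 := by simp [*]
    finiteness
  refine le_trans ?_ (mul_le_mul_right (iterate_step_weight_mono E he g _ _) _)
  rw [add_mul]
  refine add_le_add ?_ ?_
  · rw [← ENNReal.div_eq_inv_mul, ENNReal.le_div_iff_mul_le (Or.inl (by simp [*])) (Or.inl (by finiteness)),
      mul_comm]
    exact le_iterate_step_origin hr.le hc e₀ _ g
  · calc ∫⁻ x in Ioc 0 Y, g (x, 0)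
        ≤ ∑ i ∈ Finset.range (Q + 1), ∫⁻ x in
          Ioi 0 ∩ Icc ((i : ℝ) * (r / 8) - r / 8) ((i : ℝ) * (r / 8) + r / 8), g (x, 0) :=
          (lintegral_mono_set hcover).trans ((lintegral_iUnion_le _ _).trans_eq
            (by rw [tsum_fintype, Finset.sum_range]))
      _ ≤ ∑ i ∈ Finset.range (Q + 1), A⁻¹ * (step E e₀)^[n + 2] g (0, 0) := by
          refine Finset.sum_le_sum fun i hi => ?_
          have hiQ : (i : ℝ) ≤ Q := by exact_mod_cast Nat.lt_succ_iff.1 (Finset.mem_range.1 hi)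
          rw [← ENNReal.div_eq_inv_mul, ENNReal.le_div_iff_mul_le (Or.inl hA0) (Or.inl hAt), mul_comm]
          refine hpath _ (by positivity) ?_ g hg
          nlinarith
      _ = _ := by rw [Finset.sum_const, Finset.card_range, nsmul_eq_mul, mul_assoc]

/-- The loop weights satisfy a renewal-type inequality with a summable kernel, around any time. -/
lemma exists_loopWeight_le (h : IsStepDensity E σ M) {e₀ ē : ℝ≥0∞} (he₀ : e₀ ≠ 0) (he₀' : e₀ ≠ ∞)
    (hē0 : ē ≠ 0) (hē : ē ≠ ∞) :
    ∃ (k l : ℕ) (δ : ℕ → ℝ≥0∞), ∑' n : ℕ, (1 + (n : ℝ≥0∞)) * δ n < ∞ ∧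
      ∀ e, e₀ ≤ e → e ≤ ē → ∀ L m, loopWeight E e (L + 2 + m) ≤
        ∑ i ∈ Finset.range (L + 1), ∑ b ∈ Finset.range (m + 1),
          loopWeight E e (i + k) * δ (L - i + b + 3) * loopWeight E e (m - b + l) := by
  obtain ⟨Y, hY, δ, hδ, hblock⟩ := h.exists_killedWord_le hē0 hē
  obtain ⟨k, a, ha0, hat, hk⟩ := h.exists_afterContact_le he₀ he₀' Y
  obtain ⟨l, C, hC, hl⟩ := h.exists_contact_integral_le he₀ he₀' hY
  refine ⟨k, l, fun n => (a⁻¹ * C) * δ n, ?_, fun e he he' L m => ?_⟩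
  · simp only [mul_left_comm _ (a⁻¹ * C)]
    rw [ENNReal.tsum_mul_left]
    exact ENNReal.mul_lt_top (by finiteness) hδ
  refine (h.loopWeight_le hY (hblock e he') L m).trans
    (Finset.sum_le_sum fun i _ => Finset.sum_le_sum fun b _ => ?_)
  have h1 : (step E e)^[i] ((afterContact Y).indicator 1) (0, 0) ≤ a⁻¹ * loopWeight E e (i + k) := by
    have := (step_mono E e).iterate i (hk e he) (0, 0)
    rw [h.iterate_step_const_mul e a (measurable_one.indicator (measurableSet_afterContact Y)),
      ← Function.iterate_add_apply] at this
    rw [← ENNReal.div_eq_inv_mul, ENNReal.le_div_iff_mul_le (Or.inl ha0) (Or.inl hat), mul_comm]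
    exact this
  have h2 : (step E e)^[m - b] atOrigin (0, 0) + ∫⁻ x in Ioc 0 Y, (step E e)^[m - b] atOrigin (x, 0) ≤
      C * loopWeight E e (m - b + l) := by
    rw [loopWeight, add_comm (m - b) l, Function.iterate_add_apply]
    exact hl e he _ (h.measurable_iterate_step e measurable_atOrigin _)
  refine (mul_le_mul' (mul_le_mul' h1 le_rfl) h2).trans (le_of_eq ?_)
  ring

end IsStepDensity

/-- The tail sums `∑_b δ (j + b + 3)`. -/
def kernelTail (δ : ℕ → ℝ≥0∞) (j : ℕ) : ℝ≥0∞ := ∑' b : ℕ, δ (j + b + 3)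

lemma tsum_tsum_add (g : ℕ → ℝ≥0∞) :
    ∑' j : ℕ, ∑' b : ℕ, g (j + b) = ∑' n : ℕ, (n + 1 : ℕ) * g n := by
  rw [← ENNReal.tsum_prod (f := fun j b => g (j + b)),
    ← Finset.HasAntidiagonal.sigmaAntidiagonalEquivProd.tsum_eq, ENNReal.tsum_sigma']
  refine tsum_congr fun n => ?_
  rw [tsum_fintype]
  calc _ = ∑ _p : Finset.HasAntidiagonal.antidiagonal n, g n := by
        refine Finset.sum_congr rfl fun p _ => ?_
        exact congrArg g (Finset.HasAntidiagonal.mem_antidiagonal.1 p.2)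
    _ = _ := by simp

lemma tsum_kernelTail_lt_top {δ : ℕ → ℝ≥0∞} (hδ : ∑' n : ℕ, (1 + (n : ℝ≥0∞)) * δ n < ∞) :
    ∑' j, kernelTail δ j < ∞ := by
  refine lt_of_le_of_lt ?_ hδ
  unfold kernelTail
  rw [tsum_tsum_add fun n => δ (n + 3)]
  refine le_trans (ENNReal.tsum_le_tsum fun n => ?_)
    (ENNReal.tsum_comp_le_tsum_of_injective (add_left_injective (3 : ℕ)) fun n : ℕ => (1 + (n : ℝ≥0∞)) * δ n)
  refine mul_le_mul_left ?_ _
  rw [add_comm]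
  push_cast
  exact add_le_add le_rfl le_self_add

/-- A renewal-type inequality of total mass at most one gives boundedness. -/
lemma bounded_of_renewal_le {a δ : ℕ → ℝ≥0∞} {k l L : ℕ} (hl : l ≤ L)
    (ha : ∀ m, a (L + 2 + m) ≤ ∑ i ∈ Finset.range (L + 1), ∑ b ∈ Finset.range (m + 1),
      a (i + k) * δ (L - i + b + 3) * a (m - b + l))
    (hmass : ∑ i ∈ Finset.range (L + 1), a (i + k) * kernelTail δ (L - i) ≤ 1) (n : ℕ) :
    a n ≤ ∑ j ∈ Finset.range (L + 2), a j := by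
  set B := ∑ j ∈ Finset.range (L + 2), a j with hB
  induction n using Nat.strong_induction_on with
  | _ n ih =>
    rcases lt_or_ge n (L + 2) with hn | hn
    · exact Finset.single_le_sum_of_canonicallyOrdered (f := a) (Finset.mem_range.2 hn)
    obtain ⟨m, rfl⟩ := Nat.exists_eq_add_of_le hn
    calc a (L + 2 + m) ≤ ∑ i ∈ Finset.range (L + 1), ∑ b ∈ Finset.range (m + 1),
          a (i + k) * δ (L - i + b + 3) * B := by
          refine (ha m).trans (Finset.sum_le_sum fun i _ => Finset.sum_le_sum fun b _ => ?_)
          exact mul_le_mul_right (ih _ (by omega)) _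
      _ = (∑ i ∈ Finset.range (L + 1), a (i + k) *
            ∑ b ∈ Finset.range (m + 1), δ (L - i + b + 3)) * B := by
          simp only [Finset.sum_mul, Finset.mul_sum]
      _ ≤ (∑ i ∈ Finset.range (L + 1), a (i + k) * kernelTail δ (L - i)) * B := by
          refine mul_le_mul_left (Finset.sum_le_sum fun i _ => mul_le_mul_right ?_ _) _
          exact ENNReal.sum_le_tsum _
      _ ≤ 1 * B := mul_le_mul_left hmass _
      _ = B := one_mul _

lemma pow_mul_le_of_supermul {a : ℕ → ℝ≥0∞} (hsup : ∀ m n, a m * a n ≤ a (m + n)) (m n : ℕ) :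
    a m * a 1 ^ n ≤ a (m + n) := by
  induction n with
  | zero => simp
  | succ n ih =>
    rw [pow_succ, ← mul_assoc, ← add_assoc]
    exact (mul_le_mul_left ih _).trans (hsup _ _)

/-- A supermultiplicative sequence bounded by one whose convolution with a summable sequence
does not decay is bounded below. -/
lemma exists_le_of_one_le_conv {a τ : ℕ → ℝ≥0∞} {k l : ℕ} (h0 : a 0 = 1) (ha : ∀ n, a n ≤ 1)
    (hsup : ∀ m n, a m * a n ≤ a (m + n)) (ha1 : a 1 ≠ 0) (hτ : ∑' j, τ j < ∞)
    (hone : ∀ L, l ≤ L → 1 ≤ ∑ i ∈ Finset.range (L + 1), a (i + k) * τ (L - i)) :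
    ∃ c, c ≠ 0 ∧ ∀ n, c ≤ a n := by
  obtain ⟨N, hN⟩ : ∃ N, ∑' j, τ (j + N) ≤ 1 / 2 :=
    ((ENNReal.tendsto_sum_nat_add τ hτ.ne).eventually_le_const (by simp)).exists
  set T := ∑' j, τ j with hT
  have ha1t : a 1 ≠ ∞ := ((ha 1).trans_lt ENNReal.one_lt_top).ne
  have hlarge : ∀ L, l ≤ L → a 1 ^ N / 2 ≤ a (L + k) * T := by
    intro L hL
    have hsplit : ∑ i ∈ Finset.range (L + 1), a (i + k) * τ (L - i) * a 1 ^ N ≤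
        a (L + k) * T + a 1 ^ N / 2 := by
      rw [← Finset.sum_range_reflect]
      calc _ ≤ ∑ j ∈ Finset.range (L + 1), (a (L + k) * τ j +
            (if N ≤ j then τ j else 0) * a 1 ^ N) := by
            refine Finset.sum_le_sum fun j hj => ?_
            have hj' := Finset.mem_range.1 hj
            rw [show L + 1 - 1 - j = L - j by omega, show L - (L - j) = j by omega]
            split_ifs with hNj
            · refine le_trans ?_ le_add_self
              refine mul_le_mul_left ?_ _
              calc _ ≤ 1 * τ j := mul_le_mul_left (ha _) _
                _ = _ := one_mul _
            · refine le_trans ?_ le_self_add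
              calc a (L - j + k) * τ j * a 1 ^ N = a (L - j + k) * a 1 ^ N * τ j := by ring
                _ ≤ a (L - j + k) * a 1 ^ j * τ j := by
                    refine mul_le_mul_left (mul_le_mul_right ?_ _) _
                    exact pow_le_pow_right_of_le_one' (ha 1) (by omega)
                _ ≤ a (L + k) * τ j := by
                    refine mul_le_mul_left ((pow_mul_le_of_supermul hsup _ _).trans_eq ?_) _
                    congr 1; omega
        _ = a (L + k) * ∑ j ∈ Finset.range (L + 1), τ j +
            (∑ j ∈ Finset.range (L + 1), if N ≤ j then τ j else 0) * a 1 ^ N := by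
            rw [Finset.sum_add_distrib, Finset.mul_sum, Finset.sum_mul]
        _ ≤ a (L + k) * T + 1 / 2 * a 1 ^ N := by
            refine add_le_add (mul_le_mul_right (ENNReal.sum_le_tsum _) _) (mul_le_mul_left ?_ _)
            refine ((ENNReal.sum_le_tsum _).trans ?_).trans hN
            rw [← ENNReal.summable.sum_add_tsum_nat_add' (k := N)]
            rw [Finset.sum_eq_zero fun j hj => if_neg (by have := Finset.mem_range.1 hj; omega), zero_add]
            exact ENNReal.tsum_le_tsum fun j => by simp
        _ = _ := by rw [mul_comm (1 / 2), mul_one_div]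
    rw [← Finset.sum_mul] at hsplit
    have h1 : a 1 ^ N ≤ a (L + k) * T + a 1 ^ N / 2 :=
      le_trans (by rw [one_mul]) ((mul_le_mul_left (hone L hL) _).trans hsplit)
    have hfin : a 1 ^ N / 2 ≠ ∞ := by finiteness
    refine ENNReal.le_of_add_le_add_right hfin ?_
    rwa [ENNReal.add_halves]
  refine ⟨min (a 1 ^ N / 2 / (T + 1)) (a 1 ^ (l + k)), ?_, fun n => ?_⟩
  · have h1 : a 1 ^ N / 2 / (T + 1) ≠ 0 := by
      have : T + 1 ≠ ∞ := by finiteness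
      simp [ENNReal.div_eq_zero_iff, ha1, this]
    have h2 : a 1 ^ (l + k) ≠ 0 := pow_ne_zero _ ha1
    exact (lt_min (pos_iff_ne_zero.2 h1) (pos_iff_ne_zero.2 h2)).ne'
  · rcases lt_or_ge n (l + k) with hn | hn
    · refine (min_le_right _ _).trans ((pow_le_pow_right_of_le_one' (ha 1) hn.le).trans ?_)
      simpa [h0] using pow_mul_le_of_supermul hsup 0 n
    · refine (min_le_left _ _).trans (ENNReal.div_le_of_le_mul ?_)
      have := hlarge (n - k) (by omega)
      rw [show n - k + k = n by omega] at this
      exact this.trans (mul_le_mul_right le_self_add _)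

/-- Bounded partition functions have nonpositive free energy. -/
lemma freeEnergy_le_zero {z : ℕ → ℝ} {B : ℝ} (hz : ∀ N, 1 ≤ N → 0 < z N) (hB : ∀ N, 1 ≤ N → z N ≤ B)
    {F : EReal} (hF : Tendsto (fun N : ℕ => (((N : ℝ)⁻¹ * Real.log (z N) : ℝ) : EReal)) atTop (𝓝 F)) :
    F ≤ 0 := by
  have hlim : Tendsto (fun N : ℕ => (((N : ℝ)⁻¹ * Real.log B : ℝ) : EReal)) atTop (𝓝 0) := by
    have : Tendsto (fun N : ℕ => (N : ℝ)⁻¹ * Real.log B) atTop (𝓝 0) := by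
      simpa using (tendsto_inv_atTop_nhds_zero_nat (𝕜 := ℝ)).mul_const (Real.log B)
    exact_mod_cast (continuous_coe_real_ereal.tendsto 0).comp this
  refine le_of_tendsto_of_tendsto hF hlim ?_
  filter_upwards [eventually_ge_atTop 1] with N hN
  rw [EReal.coe_le_coe_iff]
  exact mul_le_mul_of_nonneg_left (Real.log_le_log (hz N hN) (hB N hN)) (by positivity)

/-- Vanishing free energy bounds a supermultiplicative sequence by one. -/
lemma le_one_of_freeEnergy_le_zero {r z : ℕ → ℝ} {κ : ℝ} (hκ : 0 < κ) (hr : ∀ n, 0 < r n)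
    (hsup : ∀ m n, r m * r n ≤ r (m + n)) (hz : ∀ N, 1 ≤ N → z N * κ = r (N + 1))
    {F : EReal} (hF : Tendsto (fun N : ℕ => (((N : ℝ)⁻¹ * Real.log (z N) : ℝ) : EReal)) atTop (𝓝 F))
    (hF0 : F ≤ 0) {n : ℕ} (hn : 0 < n) : r n ≤ 1 := by
  by_contra! hcon
  have hlog : 0 < Real.log (r n) := Real.log_pos hcon
  have hpow : ∀ k, r n ^ (k + 1) ≤ r (n * (k + 1)) := fun k => by
    induction k with
    | zero => simp
    | succ k ih =>
      rw [pow_succ, mul_add n (k + 1) 1, mul_one]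
      exact (mul_le_mul_of_nonneg_right ih (hr n).le).trans (hsup _ _)
  have hsub : Tendsto (fun k : ℕ => n * (k + 2) - 1) atTop atTop := by
    refine tendsto_atTop_mono (fun k => ?_) tendsto_id
    have : k + 2 ≤ n * (k + 2) := Nat.le_mul_of_pos_left _ hn
    simp only [id]
    omega
  set w := Real.log (r n) / n with hw
  have hlower : Tendsto (fun N : ℕ => w + (N : ℝ)⁻¹ * (w - Real.log κ)) atTop (𝓝 w) := by
    simpa using ((tendsto_inv_atTop_nhds_zero_nat (𝕜 := ℝ)).mul_const (w - Real.log κ)).const_add w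
  have hle : (w : EReal) ≤ F := by
    refine le_of_tendsto_of_tendsto ((continuous_coe_real_ereal.tendsto _).comp (hlower.comp hsub))
      (hF.comp hsub) (Eventually.of_forall fun k => ?_)
    have hk : k + 2 ≤ n * (k + 2) := Nat.le_mul_of_pos_left _ hn
    obtain ⟨N, hN⟩ : ∃ N, N = n * (k + 2) - 1 := ⟨_, rfl⟩
    have hN1 : N + 1 = n * (k + 1 + 1) := by rw [hN, show k + 1 + 1 = k + 2 from rfl]; omega
    simp only [Function.comp_apply, ← hN]
    rw [EReal.coe_le_coe_iff]
    have hNpos : (0 : ℝ) < N := by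
      have : 0 < N := by omega
      exact_mod_cast this
    have hzN : z N = r (N + 1) / κ := by rw [← hz N (by omega)]; field_simp
    have hlogr : (N + 1 : ℝ) * w ≤ Real.log (r (N + 1)) := by
      have hn' : (n : ℝ) ≠ 0 := by positivity
      have hcast : (N + 1 : ℝ) = n * ((k + 1 + 1 : ℕ) : ℝ) := by exact_mod_cast hN1
      calc (N + 1 : ℝ) * w = Real.log (r n ^ (k + 1 + 1)) := by
            rw [Real.log_pow, hcast, hw]; field_simp
        _ ≤ _ := by
            rw [hN1]
            exact Real.log_le_log (pow_pos (hr n) _) (hpow (k + 1))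
    rw [hzN, Real.log_div (hr _).ne' hκ.ne']
    calc w + (N : ℝ)⁻¹ * (w - Real.log κ) = (N : ℝ)⁻¹ * ((N + 1) * w - Real.log κ) := by
          field_simp; ring
      _ ≤ _ := mul_le_mul_of_nonneg_left (by linarith) (by positivity)
  have : ((0 : ℝ) : EReal) < (w : EReal) :=
    EReal.coe_lt_coe_iff.2 (by positivity)
  exact absurd (this.trans_le (hle.trans hF0)) (by simp)

lemma loopWeight_zero (E : ℝ → ℝ) (e : ℝ≥0∞) : loopWeight E e 0 = 1 := by simp [loopWeight, atOrigin]

lemma step_scale_le (E : ℝ → ℝ) {e e' t : ℝ≥0∞} (ht : 1 ≤ t) (he : e' ≤ t * e) (f : ℝ × ℝ → ℝ≥0∞) :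
    step E e' f ≤ fun s => t * step E e f s := fun s => by
  simp only [step]
  rw [mul_add, ← mul_assoc]
  refine add_le_add (mul_le_mul_left he _) ?_
  calc _ = 1 * stepPos E f s := (one_mul _).symm
    _ ≤ _ := mul_le_mul_left ht _

namespace IsStepDensity

variable {E : ℝ → ℝ} {σ M : ℝ}

lemma loopWeight_supermul (h : IsStepDensity E σ M) (e : ℝ≥0∞) (m n : ℕ) :
    loopWeight E e m * loopWeight E e n ≤ loopWeight E e (m + n) := by
  have hle : (fun s => loopWeight E e n * atOrigin s) ≤ (step E e)^[n] atOrigin := fun s => by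
    by_cases hs : s = (0, 0)
    · subst hs; simp [atOrigin, loopWeight]
    · simp [atOrigin, hs]
  have := (step_mono E e).iterate m hle (0, 0)
  rw [h.iterate_step_const_mul e _ measurable_atOrigin, ← Function.iterate_add_apply] at this
  rw [mul_comm]
  exact this

lemma loopWeight_ne_zero (h : IsStepDensity E σ M) {e : ℝ≥0∞} (he : e ≠ 0) (n : ℕ) :
    loopWeight E e n ≠ 0 := by
  obtain ⟨r, c, hr, hc0, -, hc⟩ := h.exists_lowerBoundNear
  have := le_iterate_step_origin hr.le hc e n atOrigin
  have hpos : (e * c) ^ n * atOrigin (0, 0) ≠ 0 := by simp [atOrigin, he, hc0]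
  exact (lt_of_lt_of_le (pos_iff_ne_zero.2 hpos) this).ne'

lemma step_one_le (h : IsStepDensity E σ M) (e : ℝ≥0∞) :
    step E e 1 ≤ fun _ => e * ENNReal.ofReal M + 1 := fun s => by
  refine add_le_add (mul_le_mul_right ?_ _) (h.stepPos_one_le s)
  simpa [stepZero] using h.eDens_le _

lemma iterate_step_one_le (h : IsStepDensity E σ M) (e : ℝ≥0∞) (n : ℕ) :
    (step E e)^[n] 1 ≤ fun _ => (e * ENNReal.ofReal M + 1) ^ n := by
  induction n with
  | zero => intro s; simp
  | succ n ih =>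
    rw [Function.iterate_succ_apply']
    refine (step_mono E e ih).trans fun s => ?_
    have : (fun _ : ℝ × ℝ => (e * ENNReal.ofReal M + 1) ^ n) =
        fun p => (e * ENNReal.ofReal M + 1) ^ n * (1 : ℝ × ℝ → ℝ≥0∞) p := by simp
    rw [this, h.step_const_mul e _ measurable_one, pow_succ]
    exact mul_le_mul_right (h.step_one_le e s) _

lemma loopWeight_ne_top (h : IsStepDensity E σ M) {e : ℝ≥0∞} (he : e ≠ ∞) (n : ℕ) :
    loopWeight E e n ≠ ∞ := by
  have hle : atOrigin ≤ 1 := fun s => indicator_le_self' (fun _ _ => zero_le) s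
  have := ((step_mono E e).iterate n hle (0, 0)).trans (h.iterate_step_one_le e n (0, 0))
  exact (this.trans_lt (by finiteness)).ne

lemma loopWeight_scale_le (h : IsStepDensity E σ M) {e e' t : ℝ≥0∞} (ht : 1 ≤ t) (he : e' ≤ t * e)
    (n : ℕ) : loopWeight E e' n ≤ t ^ n * loopWeight E e n := by
  have : ∀ n, (step E e')^[n] atOrigin ≤ fun s => t ^ n * (step E e)^[n] atOrigin s := by
    intro n
    induction n with
    | zero => intro s; simp
    | succ n ih =>
      rw [Function.iterate_succ_apply', Function.iterate_succ_apply']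
      refine (step_mono E e' ih).trans fun s => ?_
      rw [h.step_const_mul e' _ (h.measurable_iterate_step e measurable_atOrigin n), pow_succ, mul_assoc]
      exact mul_le_mul_right (step_scale_le E ht he _ s) _
  exact this n (0, 0)

/-- At the critical point the loop weights are bounded by one and bounded below. -/
lemma exists_le_loopWeight (h : IsStepDensity E σ M) {Z : ℝ → ℕ → ℝ} {F : ℝ → EReal}
    (hZ : ∀ ε, 0 < ε → ∀ N, 1 ≤ N →
      Z ε N * ε ^ 2 = (loopWeight E (ENNReal.ofReal ε) (N + 1)).toReal)
    (hF0 : ∀ ε, 0 < ε → 0 ≤ F ε)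
    (hF : ∀ ε, 0 < ε → Tendsto (fun N : ℕ => (((N : ℝ)⁻¹ * Real.log (Z ε N) : ℝ) : EReal)) atTop
      (𝓝 (F ε)))
    {εc : ℝ} (hlub : IsLUB {ε : ℝ | 0 < ε ∧ F ε = 0} εc) (hpos : 0 < εc) :
    (∀ n, loopWeight E (ENNReal.ofReal εc) n ≤ 1) ∧
      ∃ c, c ≠ 0 ∧ ∀ n, c ≤ loopWeight E (ENNReal.ofReal εc) n := by
  have hof : ∀ {ε : ℝ}, 0 < ε → ENNReal.ofReal ε ≠ 0 := fun hε => by simpa using hε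
  have htr : ∀ {ε : ℝ}, 0 < ε → ∀ n, 0 < (loopWeight E (ENNReal.ofReal ε) n).toReal := fun hε n =>
    ENNReal.toReal_pos (h.loopWeight_ne_zero (hof hε) n) (h.loopWeight_ne_top ENNReal.ofReal_ne_top n)
  have hscale : ∀ {ε ε' : ℝ}, 0 < ε → ε ≤ ε' → ∀ n, loopWeight E (ENNReal.ofReal ε') n ≤
      ENNReal.ofReal (ε' / ε) ^ n * loopWeight E (ENNReal.ofReal ε) n := fun {ε ε'} hε hεε' n => by
    refine h.loopWeight_scale_le ?_ ?_ n
    · rw [ENNReal.one_le_ofReal, one_le_div hε]; exact hεε'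
    · rw [← ENNReal.ofReal_mul (div_nonneg (hε.le.trans hεε') hε.le), div_mul_cancel₀ _ hε.ne']
  have hle1 : ∀ n, loopWeight E (ENNReal.ofReal εc) n ≤ 1 := by
    intro n
    rcases Nat.eq_zero_or_pos n with rfl | hn
    · rw [loopWeight_zero]
    have hbound : ∀ ε ∈ {ε : ℝ | 0 < ε ∧ F ε = 0},
        loopWeight E (ENNReal.ofReal εc) n ≤ ENNReal.ofReal (εc / ε) ^ n := by
      rintro ε ⟨hε, hFε⟩
      have h1 : (loopWeight E (ENNReal.ofReal ε) n).toReal ≤ 1 :=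
        le_one_of_freeEnergy_le_zero (r := fun n => (loopWeight E (ENNReal.ofReal ε) n).toReal)
          (z := Z ε) (κ := ε ^ 2) (by positivity) (htr hε) (fun m n => by
            rw [← ENNReal.toReal_mul]
            exact ENNReal.toReal_mono (h.loopWeight_ne_top ENNReal.ofReal_ne_top _)
              (h.loopWeight_supermul _ m n)) (hZ ε hε) (hF ε hε) hFε.le hn
      have h2 : loopWeight E (ENNReal.ofReal ε) n ≤ 1 := by
        rw [← ENNReal.toReal_one] at h1
        exact (ENNReal.toReal_le_toReal (h.loopWeight_ne_top ENNReal.ofReal_ne_top _) (by simp)).1 h1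
      refine (hscale hε (hlub.1 ⟨hε, hFε⟩) n).trans ?_
      calc _ ≤ ENNReal.ofReal (εc / ε) ^ n * 1 := mul_le_mul_right h2 _
        _ = _ := mul_one _
    have hne : ({ε : ℝ | 0 < ε ∧ F ε = 0} : Set ℝ).Nonempty := hlub.nonempty
    obtain ⟨u, -, -, hu, humem⟩ := hlub.exists_seq_monotone_tendsto hne
    have hlim : Tendsto (fun k => ENNReal.ofReal (εc / u k) ^ n) atTop (𝓝 1) := by
      have : Tendsto (fun k => εc / u k) atTop (𝓝 1) := by
        have := (tendsto_const_nhds (x := εc)).div hu hpos.ne'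
        rwa [div_self hpos.ne'] at this
      simpa [Function.comp_def] using
        (ENNReal.continuous_pow n).continuousAt.tendsto.comp (ENNReal.tendsto_ofReal this)
    exact ge_of_tendsto' hlim fun k => hbound _ (humem k)
  refine ⟨hle1, ?_⟩
  obtain ⟨k, l, δ, hδ, hrec⟩ := h.exists_loopWeight_le (hof hpos) ENNReal.ofReal_ne_top
    (hof (mul_pos two_pos hpos)) ENNReal.ofReal_ne_top
  refine exists_le_of_one_le_conv (τ := kernelTail δ) (k := k) (l := l) (loopWeight_zero _ _) hle1
    (h.loopWeight_supermul _) (h.loopWeight_ne_zero (hof hpos) 1) (tsum_kernelTail_lt_top hδ)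
    fun L hL => ?_
  set ρ := ∑ i ∈ Finset.range (L + 1), loopWeight E (ENNReal.ofReal εc) (i + k) * kernelTail δ (L - i)
    with hρ
  have hone : ∀ ε, εc < ε → ε ≤ 2 * εc → 1 ≤ ENNReal.ofReal (ε / εc) ^ (L + k) * ρ := by
    intro ε hε hε2
    have hε0 : 0 < ε := hpos.trans hε
    have hmass : 1 ≤ ∑ i ∈ Finset.range (L + 1),
        loopWeight E (ENNReal.ofReal ε) (i + k) * kernelTail δ (L - i) := by
      by_contra! hcon
      have hbdd := bounded_of_renewal_le (a := loopWeight E (ENNReal.ofReal ε)) hL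
        (hrec _ (ENNReal.ofReal_le_ofReal hε.le) (ENNReal.ofReal_le_ofReal hε2) L) hcon.le
      set B := ∑ j ∈ Finset.range (L + 2), loopWeight E (ENNReal.ofReal ε) j with hB
      have hBt : B ≠ ∞ := (ENNReal.sum_lt_top.2 fun j _ =>
        (h.loopWeight_ne_top ENNReal.ofReal_ne_top j).lt_top).ne
      have hZeq : ∀ N, 1 ≤ N → Z ε N = (loopWeight E (ENNReal.ofReal ε) (N + 1)).toReal / ε ^ 2 :=
        fun N hN => by rw [← hZ ε hε0 N hN]; field_simp
      have hFle : F ε ≤ 0 := freeEnergy_le_zero (B := B.toReal / ε ^ 2)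
        (fun N hN => by rw [hZeq N hN]; exact div_pos (htr hε0 _) (by positivity))
        (fun N hN => by
          rw [hZeq N hN]
          exact div_le_div_of_nonneg_right (ENNReal.toReal_mono hBt (hbdd _)) (by positivity))
        (hF ε hε0)
      exact absurd (hlub.1 ⟨hε0, le_antisymm hFle (hF0 ε hε0)⟩) (not_le.2 hε)
    refine hmass.trans ?_
    rw [hρ, Finset.mul_sum]
    refine Finset.sum_le_sum fun i hi => ?_
    rw [← mul_assoc]
    refine mul_le_mul_left ((hscale hpos hε.le _).trans (mul_le_mul_left ?_ _)) _
    refine pow_le_pow_right₀ ?_ (by have := Finset.mem_range.1 hi; omega)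
    rw [ENNReal.one_le_ofReal, one_le_div hpos]; exact hε.le
  have hlim : Tendsto (fun ε => ENNReal.ofReal (ε / εc) ^ (L + k) * ρ) (𝓝[>] εc) (𝓝 (1 * ρ)) := by
    refine ENNReal.Tendsto.mul_const ?_ (Or.inl one_ne_zero)
    have : Tendsto (fun ε : ℝ => ε / εc) (𝓝[>] εc) (𝓝 1) := by
      simpa [div_self hpos.ne'] using
        ((continuous_id.div_const εc).tendsto εc).mono_left nhdsWithin_le_nhds
    simpa [Function.comp_def] using
        (ENNReal.continuous_pow (L + k)).continuousAt.tendsto.comp (ENNReal.tendsto_ofReal this)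
  rw [one_mul] at hlim
  refine ge_of_tendsto hlim ?_
  filter_upwards [Ioc_mem_nhdsGT (by linarith : εc < 2 * εc)] with ε hε
  rw [mem_Ioc] at hε
  exact hone ε hε.1 hε.2

end IsStepDensity

instance sigmaFinite_wetFactor (ε : ℝ) : SigmaFinite (wetFactor ε) := by
  have : IsFiniteMeasure (ENNReal.ofReal ε • Measure.dirac (0 : ℝ)) :=
    Measure.smul_finite _ ENNReal.ofReal_ne_top
  unfold wetFactor
  infer_instance

lemma lintegral_wetFactor (E : ℝ → ℝ) (ε : ℝ) (f : ℝ × ℝ → ℝ≥0∞) (s : ℝ × ℝ) :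
    ∫⁻ w, eDens E (w + s.1 - 2 * s.2) * f (s.2, w) ∂(wetFactor ε) = step E (ENNReal.ofReal ε) f s := by
  rw [wetFactor, lintegral_add_measure, lintegral_smul_measure, lintegral_dirac,
    setLIntegral_congr Ioi_ae_eq_Ici.symm, zero_add]
  rfl

lemma lintegral_pi_fin_succ {n : ℕ} (μ : Measure ℝ) [SigmaFinite μ] {f : (Fin (n + 1) → ℝ) → ℝ≥0∞}
    (hf : Measurable f) :
    ∫⁻ φ, f φ ∂(Measure.pi fun _ => μ) =
      ∫⁻ w, ∫⁻ ψ, f (Fin.cons w ψ : Fin (n + 1) → ℝ) ∂(Measure.pi fun _ : Fin n => μ) ∂μ := by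
  have hmp := (measurePreserving_piFinSuccAbove (fun _ : Fin (n + 1) => μ) 0).symm
  rw [← hmp.lintegral_comp hf, lintegral_prod]
  · simp [MeasurableEquiv.piFinSuccAbove, Fin.insertNthEquiv]
  · exact (hf.comp hmp.measurable).aemeasurable

/-- The weight of a field, given its two preceding heights. -/
def pathWeight (E : ℝ → ℝ) : (n : ℕ) → (Fin n → ℝ) → ℝ × ℝ → ℝ
  | 0, _, s => E (s.1 - 2 * s.2) * E s.2
  | n + 1, φ, s => E (φ 0 + s.1 - 2 * s.2) * pathWeight E n (Fin.tail φ) (s.2, φ 0)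

lemma pathWeight_eq_prod (E : ℝ → ℝ) {n : ℕ} (φ : Fin n → ℝ) (y : ℕ → ℝ)
    (hy : ∀ j : Fin n, y (j + 2) = φ j) (hn : y (n + 2) = 0) (hn' : y (n + 3) = 0) :
    pathWeight E n φ (y 0, y 1) =
      ∏ j ∈ Finset.range (n + 2), E (y (j + 2) + y j - 2 * y (j + 1)) := by
  induction n generalizing y with
  | zero =>
    simp only [zero_add] at hn hn'
    simp [pathWeight, Finset.prod_range_succ, hn, hn']
  | succ n ih =>
    have h0 : y 2 = φ 0 := hy 0
    rw [Finset.prod_range_succ', pathWeight, mul_comm, ← h0]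
    congr 1
    exact ih (Fin.tail φ) (fun j => y (j + 1)) (fun j => hy j.succ) hn hn'

lemma hamWeight_eq (E : ℝ → ℝ) (n : ℕ) (φ : Fin n → ℝ) :
    hamWeight E (n + 1) φ = pathWeight E n φ (0, 0) := by
  set y : ℕ → ℝ := fun j => fieldExt (n + 1) φ (j - 1) with hy
  have h0 : y 0 = 0 := by simp [hy, fieldExt]
  have h1 : y 1 = 0 := by simp [hy, fieldExt]
  have h2 : y (n + 2) = 0 := by
    simp only [hy, fieldExt]; rw [dif_neg]; push_cast; omega
  have h3 : y (n + 3) = 0 := by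
    simp only [hy, fieldExt]; rw [dif_neg]; push_cast; omega
  have hφ : ∀ j : Fin n, y (j + 2) = φ j := fun j => by
    simp only [hy, fieldExt]
    rw [dif_pos (by push_cast; omega)]
    congr 1
    ext
    simp only
    push_cast
    omega
  have := pathWeight_eq_prod E φ y hφ h2 h3
  rw [h0, h1] at this
  rw [this, hamWeight]
  refine Finset.prod_nbij' Int.toNat (fun j => (j : ℤ)) ?_ ?_ ?_ ?_ ?_
  · intro a ha; simp only [Finset.mem_Icc, Finset.mem_range] at *; push_cast at ha; omega
  · intro a ha; simp only [Finset.mem_Icc, Finset.mem_range] at *; push_cast; omega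
  · intro a ha; simp only [Finset.mem_Icc] at ha; omega
  · intro a _; simp
  · intro a ha
    obtain ⟨b, rfl⟩ := Int.eq_ofNat_of_zero_le (Finset.mem_Icc.1 ha).1
    simp only [hy, Int.toNat_natCast]
    push_cast
    ring_nf

/-- The event that the two consecutive coordinates `j` and `j + 1` vanish. -/
def doubleContact (n j : ℕ) : Set (Fin n → ℝ) :=
  {φ | ∀ i : Fin n, (i : ℕ) = j ∨ (i : ℕ) = j + 1 → φ i = 0}

lemma measurableSet_doubleContact (n j : ℕ) : MeasurableSet (doubleContact n j) := by
  have : doubleContact n j = ⋂ i : Fin n, ⋂ _ : (i : ℕ) = j ∨ (i : ℕ) = j + 1, {φ | φ i = 0} := by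
    ext φ; simp [doubleContact]
  rw [this]
  exact MeasurableSet.iInter fun i => MeasurableSet.iInter fun _ =>
    measurableSet_eq_fun (measurable_pi_apply i) measurable_const

/-- The partition function started from a general state. -/
def statePartition (E : ℝ → ℝ) (ε : ℝ) (n : ℕ) (s : ℝ × ℝ) : ℝ≥0∞ :=
  ∫⁻ φ, ENNReal.ofReal (pathWeight E n φ s) ∂(Measure.pi fun _ => wetFactor ε)

/-- The partition function restricted to a double contact, from a general state. -/
def contactPartition (E : ℝ → ℝ) (ε : ℝ) (n j : ℕ) (s : ℝ × ℝ) : ℝ≥0∞ :=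
  ∫⁻ φ in doubleContact n j, ENNReal.ofReal (pathWeight E n φ s) ∂(Measure.pi fun _ => wetFactor ε)

lemma step_atOrigin (E : ℝ → ℝ) (e : ℝ≥0∞) (s : ℝ × ℝ) :
    step E e atOrigin s = e * (eDens E (s.1 - 2 * s.2) * atOrigin (s.2, 0)) := by
  have : stepPos E atOrigin s = 0 := by
    rw [stepPos]
    refine (setLIntegral_congr_fun measurableSet_Ioi fun w hw => ?_).trans lintegral_zero
    have : atOrigin (s.2, w) = 0 := by
      have := (mem_Ioi.1 hw).ne'
      simp [atOrigin, this]
    simp [this]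
  rw [step, this, add_zero, stepZero]

namespace IsStepDensity

variable {E : ℝ → ℝ} {σ M : ℝ}

lemma pathWeight_nonneg (h : IsStepDensity E σ M) (n : ℕ) (φ : Fin n → ℝ) (s : ℝ × ℝ) :
    0 ≤ pathWeight E n φ s := by
  induction n generalizing s with
  | zero => exact mul_nonneg (h.nonneg _) (h.nonneg _)
  | succ n ih => exact mul_nonneg (h.nonneg _) (ih _ _)

lemma measurable_pathWeight (h : IsStepDensity E σ M) (n : ℕ) :
    Measurable fun p : (Fin n → ℝ) × (ℝ × ℝ) => pathWeight E n p.1 p.2 := by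
  have hE := h.cont.measurable
  induction n with
  | zero => simp only [pathWeight]; fun_prop
  | succ n ih =>
    simp only [pathWeight]
    refine Measurable.mul (by fun_prop) (ih.comp (f := fun p : (Fin (n + 1) → ℝ) × (ℝ × ℝ) =>
      (Fin.tail p.1, (p.2.2, p.1 0))) (Measurable.prodMk (measurable_pi_lambda _ fun i => ?_) (by fun_prop)))
    simp only [Fin.tail]
    fun_prop

lemma measurable_statePartition (h : IsStepDensity E σ M) (ε : ℝ) (n : ℕ) :
    Measurable (statePartition E ε n) :=
  Measurable.lintegral_prod_right' (f := fun p : (ℝ × ℝ) × (Fin n → ℝ) =>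
    ENNReal.ofReal (pathWeight E n p.2 p.1))
    ((h.measurable_pathWeight n).comp measurable_swap).ennreal_ofReal

lemma ofReal_pathWeight_cons (h : IsStepDensity E σ M) (n : ℕ) (w : ℝ) (ψ : Fin n → ℝ) (s : ℝ × ℝ) :
    ENNReal.ofReal (pathWeight E (n + 1) (Fin.cons w ψ : Fin (n + 1) → ℝ) s) =
      eDens E (w + s.1 - 2 * s.2) * ENNReal.ofReal (pathWeight E n ψ (s.2, w)) := by
  rw [pathWeight, ENNReal.ofReal_mul (h.nonneg _)]
  rfl

lemma measurable_pathWeight_left (h : IsStepDensity E σ M) (n : ℕ) (s : ℝ × ℝ) :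
    Measurable fun φ : Fin n → ℝ => ENNReal.ofReal (pathWeight E n φ s) :=
  ((h.measurable_pathWeight n).comp (measurable_id.prodMk measurable_const)).ennreal_ofReal

lemma statePartition_succ (h : IsStepDensity E σ M) (ε : ℝ) (n : ℕ) :
    statePartition E ε (n + 1) = step E (ENNReal.ofReal ε) (statePartition E ε n) := by
  funext s
  rw [statePartition, lintegral_pi_fin_succ _ (h.measurable_pathWeight_left _ _), ← lintegral_wetFactor]
  refine lintegral_congr fun w => ?_
  simp only [h.ofReal_pathWeight_cons]
  rw [lintegral_const_mul _ (h.measurable_pathWeight_left _ _)]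
  rfl

lemma step_step_atOrigin (h : IsStepDensity E σ M) (ε : ℝ) :
    (fun s => ENNReal.ofReal ε ^ 2 * statePartition E ε 0 s) =
      (step E (ENNReal.ofReal ε))^[2] atOrigin := by
  funext s
  have hzero : stepPos E (step E (ENNReal.ofReal ε) atOrigin) s = 0 := by
    rw [stepPos]
    refine (setLIntegral_congr_fun measurableSet_Ioi fun w hw => ?_).trans lintegral_zero
    have : atOrigin (w, 0) = 0 := by
      have := (mem_Ioi.1 hw).ne'
      simp [atOrigin, this]
    simp [step_atOrigin, this]
  rw [Function.iterate_succ_apply, Function.iterate_one, step, hzero, add_zero, stepZero,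
    step_atOrigin]
  have : atOrigin (0, 0) = 1 := by simp [atOrigin]
  simp only [statePartition, pathWeight, lintegral_const, mul_zero, sub_zero, this, mul_one]
  rw [ENNReal.ofReal_mul (h.nonneg _)]
  simp [eDens]
  ring

lemma statePartition_eq (h : IsStepDensity E σ M) (ε : ℝ) (n : ℕ) :
    (fun s => ENNReal.ofReal ε ^ 2 * statePartition E ε n s) =
      (step E (ENNReal.ofReal ε))^[n + 2] atOrigin := by
  induction n with
  | zero => exact h.step_step_atOrigin ε
  | succ n ih =>
    rw [show n + 1 + 2 = (n + 2) + 1 by ring, Function.iterate_succ_apply', ← ih,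
      h.step_const_mul _ _ (h.measurable_statePartition ε n), h.statePartition_succ]

lemma contactPartition_succ (h : IsStepDensity E σ M) (ε : ℝ) (n j : ℕ) :
    contactPartition E ε (n + 1) (j + 1) = step E (ENNReal.ofReal ε) (contactPartition E ε n j) := by
  funext s
  rw [contactPartition, ← lintegral_indicator (measurableSet_doubleContact _ _), lintegral_pi_fin_succ _
    ((h.measurable_pathWeight_left _ _).indicator (measurableSet_doubleContact _ _)),
    ← lintegral_wetFactor]
  refine lintegral_congr fun w => ?_
  rw [contactPartition, ← lintegral_const_mul _ (h.measurable_pathWeight_left _ _),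
    ← lintegral_indicator (measurableSet_doubleContact _ _)]
  refine lintegral_congr fun ψ => ?_
  have hiff : (Fin.cons w ψ : Fin (n + 1) → ℝ) ∈ doubleContact (n + 1) (j + 1) ↔
      ψ ∈ doubleContact n j := by
    simp [doubleContact, Fin.forall_fin_succ]
  by_cases hψ : ψ ∈ doubleContact n j
  · rw [indicator_of_mem (hiff.2 hψ), indicator_of_mem hψ, h.ofReal_pathWeight_cons]
  · rw [indicator_of_notMem (hiff.not.2 hψ), indicator_of_notMem hψ]

lemma contactPartition_zero (h : IsStepDensity E σ M) (ε : ℝ) (n : ℕ) :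
    contactPartition E ε (n + 2) 0 =
      (step E (ENNReal.ofReal ε))^[2] (fun s => atOrigin s * statePartition E ε n s) := by
  funext s
  rw [Function.iterate_succ_apply, Function.iterate_one, contactPartition,
    ← lintegral_indicator (measurableSet_doubleContact _ _), lintegral_pi_fin_succ _
    ((h.measurable_pathWeight_left _ _).indicator (measurableSet_doubleContact _ _)),
    ← lintegral_wetFactor]
  refine lintegral_congr fun w => ?_
  have hcons : Measurable fun φ : Fin (n + 1) → ℝ => (Fin.cons w φ : Fin (n + 2) → ℝ) := by
    refine measurable_pi_lambda _ fun i => ?_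
    refine Fin.cases ?_ (fun i => ?_) i
    · simp
    · simpa using measurable_pi_apply i
  have hm : Measurable fun φ : Fin (n + 1) → ℝ => (doubleContact (n + 2) 0).indicator
      (fun φ => ENNReal.ofReal (pathWeight E (n + 2) φ s)) (Fin.cons w φ : Fin (n + 2) → ℝ) :=
    ((h.measurable_pathWeight_left _ _).indicator (measurableSet_doubleContact _ _)).comp hcons
  rw [lintegral_pi_fin_succ _ hm, ← lintegral_wetFactor, ← lintegral_const_mul]
  · refine lintegral_congr fun w' => ?_
    simp only [statePartition]
    rw [← lintegral_const_mul _ (h.measurable_pathWeight_left _ _),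
      ← lintegral_const_mul _ ((h.measurable_pathWeight_left _ _).const_mul _),
      ← lintegral_const_mul _ (((h.measurable_pathWeight_left _ _).const_mul _).const_mul _)]
    refine lintegral_congr fun ψ => ?_
    have hiff : (Fin.cons w (Fin.cons w' ψ : Fin (n + 1) → ℝ) : Fin (n + 2) → ℝ) ∈
        doubleContact (n + 2) 0 ↔ (w, w') = (0, 0) := by
      simp [doubleContact, Fin.forall_fin_succ]
    by_cases hw : (w, w') = (0, 0)
    · rw [indicator_of_mem (hiff.2 hw), h.ofReal_pathWeight_cons, h.ofReal_pathWeight_cons, hw]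
      simp [atOrigin]
    · rw [indicator_of_notMem (hiff.not.2 hw)]
      simp [atOrigin, hw]
  · have hE := h.measurable_eDens
    have hm := h.measurable_statePartition ε n
    have ho := measurable_atOrigin
    fun_prop

lemma contactPartition_eq (h : IsStepDensity E σ M) (ε : ℝ) (n j : ℕ) :
    ENNReal.ofReal ε ^ 2 * contactPartition E ε (n + 2 + j) j (0, 0) =
      loopWeight E (ENNReal.ofReal ε) (j + 2) * loopWeight E (ENNReal.ofReal ε) (n + 2) := by
  have hiter : ∀ j, contactPartition E ε (n + 2 + j) j = (step E (ENNReal.ofReal ε))^[j + 2]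
      (fun s => atOrigin s * statePartition E ε n s) := by
    intro j
    induction j with
    | zero => exact h.contactPartition_zero ε n
    | succ j ih =>
      rw [← add_assoc, h.contactPartition_succ, ih]
      exact (Function.iterate_succ_apply' _ _ _).symm
  have hconst : (fun s => atOrigin s * statePartition E ε n s) =
      fun s => statePartition E ε n (0, 0) * atOrigin s := by
    funext s
    by_cases hs : s = (0, 0)
    · subst hs; rw [mul_comm]
    · simp [atOrigin, hs]
  rw [hiter, hconst, h.iterate_step_const_mul _ _ measurable_atOrigin]
  have hn := congrFun (h.statePartition_eq ε n) (0, 0)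
  beta_reduce at hn ⊢
  rw [← mul_assoc, hn, mul_comm]
  rfl

end IsStepDensity

lemma measurable_fieldExt (N : ℕ) (i : ℤ) : Measurable fun φ : Fin (N - 1) → ℝ => fieldExt N φ i := by
  unfold fieldExt
  split_ifs
  · exact measurable_pi_apply _
  · exact measurable_const

open scoped Classical in
lemma contact_eq_sum (N : ℕ) (φ : Fin (N - 1) → ℝ) :
    contact N φ = ∑ i ∈ Finset.Icc (1 : ℤ) N, if fieldExt N φ i = 0 then 1 else 0 := by
  rw [contact, Finset.card_filter]

lemma contact_le (N : ℕ) (φ : Fin (N - 1) → ℝ) : contact N φ ≤ N := by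
  rw [contact]
  exact (Finset.card_filter_le _ _).trans (by simp)

lemma measurable_contact (N : ℕ) : Measurable (contact N) := by
  classical
  have : contact N = fun φ => ∑ i ∈ Finset.Icc (1 : ℤ) N, if fieldExt N φ i = 0 then 1 else 0 := by
    funext φ
    rw [contact_eq_sum]
  rw [this]
  exact Finset.measurable_fun_sum _ fun i _ => Measurable.ite
    (measurableSet_eq_fun (measurable_fieldExt N i) measurable_const) measurable_const measurable_const

/-- Double contacts bound the number of contacts from below. -/
lemma sum_doubleContact_le_contact (n : ℕ) (φ : Fin (n + 2) → ℝ) :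
    ∑ j ∈ Finset.range (n + 1), (doubleContact (n + 2) j).indicator (1 : (Fin (n + 2) → ℝ) → ℝ≥0∞) φ ≤
      (contact (n + 3) φ : ℝ≥0∞) := by
  classical
  have hcard : ((Finset.range (n + 1)).filter fun j => φ ∈ doubleContact (n + 2) j).card ≤
      contact (n + 3) φ := by
    refine Finset.card_le_card_of_injOn (fun j : ℕ => (j : ℤ) + 1) (fun j hj => ?_)
      (fun a _ b _ hab => by simpa using hab)
    rw [Finset.mem_coe, Finset.mem_filter, Finset.mem_range] at hj
    rw [Finset.mem_coe, Finset.mem_filter, Finset.mem_Icc]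
    beta_reduce
    refine ⟨⟨by omega, by push_cast; omega⟩, ?_⟩
    rw [fieldExt, dif_pos (by push_cast; omega)]
    refine hj.2 _ (Or.inl ?_)
    simp only
    omega
  calc _ = (((Finset.range (n + 1)).filter fun j => φ ∈ doubleContact (n + 2) j).card : ℝ≥0∞) := by
        rw [Finset.card_filter]
        push_cast
        exact Finset.sum_congr rfl fun j _ => by simp [indicator]
    _ ≤ _ := by exact_mod_cast hcard

namespace IsStepDensity

variable {E : ℝ → ℝ} {σ M : ℝ}

lemma lintegral_hamWeight (h : IsStepDensity E σ M) (ε : ℝ) (n : ℕ) :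
    ENNReal.ofReal ε ^ 2 * ∫⁻ φ : Fin n → ℝ, ENNReal.ofReal (hamWeight E (n + 1) φ)
      ∂(Measure.pi fun _ => wetFactor ε) = loopWeight E (ENNReal.ofReal ε) (n + 2) := by
  simp only [hamWeight_eq]
  exact congrFun (h.statePartition_eq ε n) (0, 0)

lemma Zwet_eq (h : IsStepDensity E σ M) (ε : ℝ) (n : ℕ) :
    Zwet E ε (n + 1) = (∫⁻ φ : Fin n → ℝ, ENNReal.ofReal (hamWeight E (n + 1) φ)
      ∂(Measure.pi fun _ => wetFactor ε)).toReal := by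
  rw [Zwet, integral_eq_lintegral_of_nonneg_ae]
  · rfl
  · exact Eventually.of_forall fun φ => by
      rw [hamWeight_eq]; exact h.pathWeight_nonneg _ _ _
  · refine Measurable.aestronglyMeasurable ?_
    have := (h.measurable_pathWeight n).comp
      (measurable_id.prodMk (measurable_const (a := ((0 : ℝ), (0 : ℝ)))))
    have heq : hamWeight E (n + 1) = fun φ : Fin n → ℝ => pathWeight E n φ (0, 0) :=
      funext (hamWeight_eq E n)
    exact heq ▸ this

lemma Zwet_mul (h : IsStepDensity E σ M) {ε : ℝ} (hε : 0 < ε) {N : ℕ} (hN : 1 ≤ N) :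
    Zwet E ε N * ε ^ 2 = (loopWeight E (ENNReal.ofReal ε) (N + 1)).toReal := by
  obtain ⟨n, rfl⟩ := Nat.exists_eq_add_of_le' hN
  rw [h.Zwet_eq, ← h.lintegral_hamWeight, ENNReal.toReal_mul, ENNReal.toReal_pow,
    ENNReal.toReal_ofReal hε.le, mul_comm]

lemma Zwet_pos (h : IsStepDensity E σ M) {ε : ℝ} (hε : 0 < ε) {N : ℕ} (hN : 1 ≤ N) :
    0 < Zwet E ε N := by
  have := ENNReal.toReal_pos (h.loopWeight_ne_zero (e := ENNReal.ofReal ε) (by simpa using hε) (N + 1))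
    (h.loopWeight_ne_top ENNReal.ofReal_ne_top _)
  rw [← h.Zwet_mul hε hN] at this
  exact pos_of_mul_pos_left this (by positivity)

/-- The wetting measure of an event, in terms of the restricted partition function. -/
lemma Pwet_apply (h : IsStepDensity E σ M) {ε : ℝ} (hε : 0 < ε) (n : ℕ) {A : Set (Fin n → ℝ)}
    (hA : MeasurableSet A) :
    Pwet E ε (n + 1) A = (ENNReal.ofReal ε ^ 2 * ∫⁻ φ in A, ENNReal.ofReal (pathWeight E n φ (0, 0))
      ∂(Measure.pi fun _ => wetFactor ε)) / loopWeight E (ENNReal.ofReal ε) (n + 2) := by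
  have hZ := h.Zwet_pos hε (Nat.le_add_left 1 n)
  have hof : ENNReal.ofReal ε ^ 2 ≠ 0 := pow_ne_zero _ (by simpa using hε)
  have hloop : loopWeight E (ENNReal.ofReal ε) (n + 2) =
      ENNReal.ofReal ε ^ 2 * ENNReal.ofReal (Zwet E ε (n + 1)) := by
    rw [← ENNReal.ofReal_toReal (h.loopWeight_ne_top ENNReal.ofReal_ne_top (n + 2)),
      ← h.Zwet_mul hε (Nat.le_add_left 1 n), ENNReal.ofReal_mul hZ.le, ENNReal.ofReal_pow hε.le, mul_comm]
  rw [hloop, ENNReal.mul_div_mul_left _ _ hof (by finiteness)]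
  refine (withDensity_apply _ hA).trans ?_
  rw [ENNReal.div_eq_inv_mul, ← lintegral_const_mul _ (h.measurable_pathWeight_left n _)]
  refine lintegral_congr fun φ => ?_
  rw [ENNReal.ofReal_div_of_pos hZ, ENNReal.div_eq_inv_mul, hamWeight_eq]

lemma Pwet_univ (h : IsStepDensity E σ M) {ε : ℝ} (hε : 0 < ε) (n : ℕ) :
    Pwet E ε (n + 1) univ = 1 := by
  refine (h.Pwet_apply hε n (A := univ) MeasurableSet.univ).trans ?_
  have := h.lintegral_hamWeight ε n
  simp only [hamWeight_eq] at this
  rw [Measure.restrict_univ, this]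
  exact ENNReal.div_self (h.loopWeight_ne_zero (by simpa using hε) _)
    (h.loopWeight_ne_top ENNReal.ofReal_ne_top _)

lemma Pwet_doubleContact (h : IsStepDensity E σ M) {ε : ℝ} (hε : 0 < ε) (n j : ℕ) :
    Pwet E ε (n + 2 + j + 1) (doubleContact (n + 2 + j) j) =
      loopWeight E (ENNReal.ofReal ε) (j + 2) * loopWeight E (ENNReal.ofReal ε) (n + 2) /
        loopWeight E (ENNReal.ofReal ε) (n + 2 + j + 2) := by
  rw [← h.contactPartition_eq]
  exact h.Pwet_apply hε _ (measurableSet_doubleContact _ _)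

lemma le_lintegral_contact (h : IsStepDensity E σ M) {ε : ℝ} (hε : 0 < ε) {c : ℝ≥0∞}
    (hle : ∀ n, loopWeight E (ENNReal.ofReal ε) n ≤ 1)
    (hc : ∀ n, c ≤ loopWeight E (ENNReal.ofReal ε) n) (n : ℕ) :
    (n + 1 : ℕ) * c ^ 2 ≤ ∫⁻ φ, (contact (n + 3) φ : ℝ≥0∞) ∂(Pwet E ε (n + 3)) := by
  calc (n + 1 : ℕ) * c ^ 2 = ∑ _j ∈ Finset.range (n + 1), c ^ 2 := by simp
    _ ≤ ∑ j ∈ Finset.range (n + 1), Pwet E ε (n + 3) (doubleContact (n + 2) j) := by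
        refine Finset.sum_le_sum fun j hj => ?_
        obtain ⟨m, rfl⟩ := Nat.exists_eq_add_of_le' (Nat.lt_succ_iff.1 (Finset.mem_range.1 hj))
        have hP := h.Pwet_doubleContact hε m j
        rw [show m + 2 + j = m + j + 2 by ring] at hP
        refine le_of_le_of_eq ?_ hP.symm
        rw [ENNReal.le_div_iff_mul_le (Or.inl (h.loopWeight_ne_zero (by simpa using hε) _))
          (Or.inl (h.loopWeight_ne_top ENNReal.ofReal_ne_top _)), sq]
        calc _ ≤ c * c * 1 := mul_le_mul_right (hle _) _
          _ ≤ _ := by rw [mul_one]; exact mul_le_mul' (hc _) (hc _)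
    _ = ∑ j ∈ Finset.range (n + 1), ∫⁻ φ, (doubleContact (n + 2) j).indicator 1 φ ∂(Pwet E ε (n + 3)) :=
        Finset.sum_congr rfl fun j _ =>
          (lintegral_indicator_one (measurableSet_doubleContact (n + 2) j)).symm
    _ = ∫⁻ φ, ∑ j ∈ Finset.range (n + 1), (doubleContact (n + 2) j).indicator 1 φ ∂(Pwet E ε (n + 3)) :=
        (lintegral_finsetSum' _ fun j _ =>
          (measurable_one.indicator (measurableSet_doubleContact (n + 2) j)).aemeasurable).symm
    _ ≤ _ := lintegral_mono fun φ => sum_doubleContact_le_contact n φ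

lemma integral_contact_eq (E : ℝ → ℝ) (ε : ℝ) (N : ℕ) :
    ∫ φ, (contact N φ : ℝ) ∂(Pwet E ε N) = (∫⁻ φ, (contact N φ : ℝ≥0∞) ∂(Pwet E ε N)).toReal := by
  rw [integral_eq_lintegral_of_nonneg_ae (Eventually.of_forall fun φ => Nat.cast_nonneg _)]
  · simp
  · exact ((measurable_from_nat (f := fun n : ℕ => (n : ℝ))).comp
      (measurable_contact N)).aestronglyMeasurable

lemma lintegral_contact_le (h : IsStepDensity E σ M) {ε : ℝ} (hε : 0 < ε) (n : ℕ) :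
    ∫⁻ φ, (contact (n + 1) φ : ℝ≥0∞) ∂(Pwet E ε (n + 1)) ≤ (n + 1 : ℕ) := by
  calc _ ≤ ∫⁻ _φ, ((n + 1 : ℕ) : ℝ≥0∞) ∂(Pwet E ε (n + 1)) :=
        lintegral_mono fun φ => Nat.cast_le.2 (contact_le (n + 1) φ)
    _ = _ := by rw [lintegral_const, h.Pwet_univ hε, mul_one]

end IsStepDensity

/-- **Theorem 1.3** (Critical wetting model).  At the wetting critical point the contact
fraction stays bounded away from zero:
`liminf_{N→∞} (1/N) E^w_{ε_c^w,N}[ℓ_N] > 0`. -/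
theorem critical_wetting_first_order
    (E : ℝ → ℝ) (σ : ℝ)
    (hE_nonneg : ∀ x, 0 ≤ E x) (hE_cont : Continuous E)
    (hE_bdd : ∃ M, ∀ x, E x ≤ M) (hE_pos : 0 < E 0)
    (hE_int : Integrable E) (hE_mass : ∫ x, E x = 1)
    (hE_mom1 : Integrable fun x => x * E x) (hE_mean : ∫ x, x * E x = 0)
    (hE_mom2 : Integrable fun x => x ^ 2 * E x) (hE_var : ∫ x, x ^ 2 * E x = σ ^ 2)
    (hσ : 0 < σ)
    (Fw : ℝ → EReal)
    (hFw_nonneg : ∀ ε : ℝ, 0 ≤ ε → 0 ≤ Fw ε)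
    (hFw : ∀ ε : ℝ, 0 ≤ ε → Tendsto
      (fun N : ℕ => (((N : ℝ)⁻¹ * Real.log (Zwet E ε N) : ℝ) : EReal)) atTop (𝓝 (Fw ε)))
    (εcw : ℝ) (hεcw : IsLUB {ε : ℝ | 0 < ε ∧ Fw ε = 0} εcw) (hεcw_pos : 0 < εcw) :
    0 < Filter.liminf
      (fun N : ℕ => (∫ φ, (contact N φ : ℝ) ∂(Pwet E εcw N)) / (N : ℝ)) atTop := by
  obtain ⟨M, hM⟩ := hE_bdd
  have h : IsStepDensity E σ M := ⟨hE_nonneg, hE_cont, hM, hE_pos, hE_int, hE_mass, hE_mom1, hE_mean,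
    hE_mom2, hE_var, hσ⟩
  obtain ⟨hle, c, hc0, hc⟩ := h.exists_le_loopWeight (Z := Zwet E) (F := Fw)
    (fun ε hε N hN => h.Zwet_mul hε hN) (fun ε hε => hFw_nonneg ε hε.le) (fun ε hε => hFw ε hε.le)
    hεcw hεcw_pos
  have hct : c ≠ ∞ := ((hc 0).trans_lt ((hle 0).trans_lt ENNReal.one_lt_top)).ne
  have hcpos : 0 < c.toReal := ENNReal.toReal_pos hc0 hct
  have hupper : ∀ᶠ N : ℕ in atTop, (∫ φ, (contact N φ : ℝ) ∂(Pwet E εcw N)) / (N : ℝ) ≤ 1 := by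
    filter_upwards [eventually_ge_atTop 1] with N hN
    obtain ⟨n, rfl⟩ := Nat.exists_eq_add_of_le' hN
    refine div_le_one_of_le₀ ?_ (by positivity)
    rw [IsStepDensity.integral_contact_eq]
    exact (ENNReal.toReal_mono (ENNReal.natCast_ne_top _) (h.lintegral_contact_le hεcw_pos n)).trans_eq
      (ENNReal.toReal_natCast _)
  have hlower : ∀ᶠ N : ℕ in atTop,
      c.toReal ^ 2 / 3 ≤ (∫ φ, (contact N φ : ℝ) ∂(Pwet E εcw N)) / (N : ℝ) := by
    filter_upwards [eventually_ge_atTop 3] with N hN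
    obtain ⟨n, rfl⟩ := Nat.exists_eq_add_of_le' hN
    have hfin := ((h.lintegral_contact_le hεcw_pos (n + 2)).trans_lt (ENNReal.natCast_lt_top _)).ne
    have := ENNReal.toReal_mono hfin (h.le_lintegral_contact hεcw_pos hle hc n)
    rw [ENNReal.toReal_mul, ENNReal.toReal_pow, ENNReal.toReal_natCast] at this
    rw [IsStepDensity.integral_contact_eq, div_le_div_iff₀ (by norm_num) (by positivity)]
    push_cast at this ⊢
    nlinarith [sq_nonneg c.toReal, (Nat.cast_nonneg n : (0 : ℝ) ≤ n)]
  refine lt_of_lt_of_le (by positivity : 0 < c.toReal ^ 2 / 3) (le_liminf_of_le ?_ hlower)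
  exact IsBoundedUnder.isCoboundedUnder_ge ⟨1, by simpa using hupper⟩
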